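/- Let q ≥ 3 be a fixed integer. Then there exist an absolute constant c > 0 and a sequence of real numbers x_i → ∞ (depending on q) such that G(x_i; q) ≥ c · x_i · (log log log x_i)² for every i. The same oscillation result holds with V_Λ(x_i;q) in place of G(x_i;q). -/

import Mathlib

open Filter Real Complex
open scoped Classical

/-- `θ(x;q,a) = ∑_{p ≤ x, p ≡ a (mod q)} log p`. -/
noncomputable def thetaQA (x : ℝ) (q a : ℕ) : ℝ :=
  ∑ p ∈ (Finset.range (Nat.floor x + 1)).filter (fun p => p.Prime ∧ p % q = a), Real.log p

/-- The variance `G(x;q)` of primes in arithmetic progressions mod `q`, weighted by `log p`. -/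
noncomputable def Gvar (x : ℝ) (q : ℕ) : ℝ :=
  ∑ a ∈ (Finset.range q).filter (fun a => Nat.Coprime a q),
    (thetaQA x q a - x / (Nat.totient q)) ^ 2

/-- The variance `V_Λ(x;q)`. -/
noncomputable def Vvar (x : ℝ) (q : ℕ) : ℝ :=
  ∑ a ∈ (Finset.range q).filter (fun a => Nat.Coprime a q),
    ((∑ n ∈ (Finset.range (Nat.floor x + 1)).filter (fun n => n % q = a),
        ArithmeticFunction.vonMangoldt n)
      - (1 / (Nat.totient q : ℝ)) *
        ∑ n ∈ (Finset.range (Nat.floor x + 1)).filter (fun n => Nat.Coprime n q),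
          ArithmeticFunction.vonMangoldt n) ^ 2

namespace FixedQ

/-- The real digamma function. -/
noncomputable def realDigamma (x : ℝ) : ℝ := deriv (fun y => Real.log (Real.Gamma y)) x

lemma differentiableAt_log_Gamma {x : ℝ} (hx : 0 < x) :
    DifferentiableAt ℝ (fun y => Real.log (Real.Gamma y)) x := by
  refine DifferentiableAt.log (Real.differentiableAt_Gamma fun m => ?_) (Real.Gamma_pos_of_pos hx).ne'
  have : (0:ℝ) ≤ m := m.cast_nonneg
  linarith

lemma realDigamma_add_one {x : ℝ} (hx : 0 < x) :
    realDigamma (x + 1) = realDigamma x + 1 / x := by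
  have h1 : realDigamma (x + 1) = deriv (fun y => Real.log (Real.Gamma (y + 1))) x := by
    unfold realDigamma
    rw [← deriv_comp_add_const]
  have h2 : (fun y => Real.log (Real.Gamma (y + 1))) =ᶠ[nhds x]
      fun y => Real.log (Real.Gamma y) + Real.log y := by
    filter_upwards [lt_mem_nhds hx] with y hy
    rw [Real.Gamma_add_one hy.ne', Real.log_mul hy.ne' (Real.Gamma_pos_of_pos hy).ne', add_comm]
  rw [h1, h2.deriv_eq, deriv_fun_add (differentiableAt_log_Gamma hx)
    (Real.differentiableAt_log hx.ne'), Real.deriv_log, one_div]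
  rfl

lemma log_Gamma_slope {x : ℝ} (hx : 0 < x) :
    Real.log (Real.Gamma (x + 1)) - Real.log (Real.Gamma x) = Real.log x := by
  rw [Real.Gamma_add_one hx.ne', Real.log_mul hx.ne' (Real.Gamma_pos_of_pos hx).ne']
  ring

lemma realDigamma_le_log {x : ℝ} (hx : 0 < x) : realDigamma x ≤ Real.log x := by
  have h := Real.convexOn_log_Gamma.deriv_le_slope (x := x) (y := x + 1) hx
    (Set.mem_Ioi.2 (by linarith)) (by linarith) (differentiableAt_log_Gamma hx)
  rw [slope_def_field] at h
  simp only [Function.comp_apply, log_Gamma_slope hx] at h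
  simpa [realDigamma, Function.comp_def] using h

lemma log_sub_inv_le_realDigamma {x : ℝ} (hx : 0 < x) :
    Real.log x - 1 / x ≤ realDigamma x := by
  have h := Real.convexOn_log_Gamma.slope_le_deriv (x := x) (y := x + 1) hx
    (Set.mem_Ioi.2 (by linarith)) (by linarith) (differentiableAt_log_Gamma (by linarith))
  rw [slope_def_field] at h
  simp only [Function.comp_apply, log_Gamma_slope hx] at h
  have h' : Real.log x ≤ realDigamma (x + 1) := by
    simpa [realDigamma, Function.comp_def] using h
  rw [realDigamma_add_one hx] at h'
  linarith

lemma realDigamma_add_nat {x : ℝ} (hx : 0 < x) (n : ℕ) :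
    realDigamma (x + n) = realDigamma x + ∑ k ∈ Finset.range n, 1 / (x + k) := by
  induction n with
  | zero => simp
  | succ n ih =>
    rw [Finset.sum_range_succ, ← add_assoc, ← ih, Nat.cast_succ, ← add_assoc,
      realDigamma_add_one (by positivity)]

lemma summable_inv_mul_inv {x y : ℝ} (hx : 0 < x) (hy : 0 < y) :
    Summable fun k : ℕ => 1 / ((x + k) * (y + k)) := by
  rw [← summable_nat_add_iff 1]
  refine Summable.of_nonneg_of_le (fun k => by positivity) (fun k => ?_)
    ((summable_nat_add_iff 1).2 (Real.summable_one_div_nat_pow.2 one_lt_two))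
  have : ((k + 1 : ℕ) : ℝ) > 0 := by positivity
  gcongr
  rw [sq]
  gcongr <;> linarith

/-- The partial fraction expansion of the digamma function on the positive reals. -/
lemma hasSum_realDigamma_sub {x y : ℝ} (hx : 0 < x) (hy : 0 < y) :
    HasSum (fun k : ℕ => (x - y) / ((x + k) * (y + k))) (realDigamma x - realDigamma y) := by
  have hs : Summable fun k : ℕ => (x - y) / ((x + k) * (y + k)) := by
    simpa [div_eq_mul_inv] using (summable_inv_mul_inv hx hy).mul_left (x - y)
  have key : ∀ n : ℕ, ∑ k ∈ Finset.range n, (x - y) / ((x + k) * (y + k)) =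
      (realDigamma x - realDigamma y) - (realDigamma (x + n) - realDigamma (y + n)) := by
    intro n
    rw [realDigamma_add_nat hx, realDigamma_add_nat hy]
    have : ∀ k ∈ Finset.range n, (x - y) / ((x + k) * (y + k)) = 1 / (y + k) - 1 / (x + k) := by
      intro k _
      have : x + k ≠ 0 := by positivity
      have : y + k ≠ 0 := by positivity
      field_simp
      ring
    rw [Finset.sum_congr rfl this, Finset.sum_sub_distrib]
    ring
  have hinv : ∀ z : ℝ, Tendsto (fun n : ℕ => 1 / (z + n)) atTop (nhds 0) := fun z =>
    (tendsto_const_nhds (x := (1:ℝ))).div_atTop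
      (tendsto_atTop_add_const_left _ _ tendsto_natCast_atTop_atTop)
  have hd : ∀ z : ℝ, 0 < z →
      Tendsto (fun n : ℕ => realDigamma (z + n) - Real.log (z + n)) atTop (nhds 0) := by
    intro z hz
    refine tendsto_of_tendsto_of_tendsto_of_le_of_le (by simpa using (hinv z).neg)
      tendsto_const_nhds (fun n => ?_) (fun n => ?_)
    · have := log_sub_inv_le_realDigamma (x := z + n) (by positivity)
      rw [one_div] at this
      linarith
    · have := realDigamma_le_log (x := z + n) (by positivity)
      linarith
  have hl : Tendsto (fun n : ℕ => Real.log (x + n) - Real.log (y + n)) atTop (nhds 0) := by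
    have h1 : Tendsto (fun n : ℕ => 1 + (x - y) * (1 / (y + n))) atTop (nhds (1 + (x - y) * 0)) :=
      ((hinv y).const_mul _).const_add _
    rw [mul_zero, add_zero] at h1
    have h2 := (Real.continuousAt_log one_ne_zero).tendsto.comp h1
    rw [Real.log_one] at h2
    refine h2.congr fun n => ?_
    have h3 : y + n ≠ 0 := by positivity
    have h4 : x + n ≠ 0 := by positivity
    rw [Function.comp_apply, ← Real.log_div h4 h3]
    congr 1
    field_simp
    ring
  have hlim : Tendsto (fun n : ℕ => realDigamma (x + n) - realDigamma (y + n)) atTop (nhds 0) := by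
    have := ((hd x hx).sub (hd y hy)).add hl
    simp only [sub_zero, add_zero] at this
    refine this.congr fun n => by ring
  have ht := hs.hasSum.tendsto_sum_nat
  simp only [key] at ht
  have := tendsto_nhds_unique ht (by simpa using hlim.const_sub (realDigamma x - realDigamma y))
  rw [← this]
  exact hs.hasSum

/-- Division of an entire function by a power of `z - a`. -/
lemma exists_entire_div_pow {g : ℂ → ℂ} (hg : Differentiable ℂ g) {a : ℂ} {g₀ : ℂ → ℂ} {n : ℕ}
    (hg₀ : AnalyticAt ℂ g₀ a) (h : ∀ᶠ z in nhds a, g z = (z - a) ^ n * g₀ z) :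
    ∃ k : ℂ → ℂ, Differentiable ℂ k ∧ k a = g₀ a ∧ ∀ z, g z = (z - a) ^ n * k z := by
  let k : ℂ → ℂ := fun z => if z = a then g₀ a else g z / (z - a) ^ n
  have hka : k =ᶠ[nhds a] g₀ := by
    filter_upwards [h] with z hz
    by_cases hza : z = a
    · simp [k, hza]
    · have : (z - a) ^ n ≠ 0 := pow_ne_zero _ (sub_ne_zero.mpr hza)
      simp [k, hza, hz, mul_div_cancel_left₀ _ this]
  refine ⟨k, fun z => ?_, by simp [k], fun z => ?_⟩
  · by_cases hza : z = a
    · subst hza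
      exact (hka.differentiableAt_iff).mpr hg₀.differentiableAt
    · have h1 : k =ᶠ[nhds z] fun w => g w / (w - a) ^ n := by
        filter_upwards [isOpen_ne.mem_nhds hza] with w hw
        have hw' : w ≠ a := hw
        simp [k, hw']
      refine h1.differentiableAt_iff.mpr ?_
      exact (hg z).div (by fun_prop) (pow_ne_zero _ (sub_ne_zero.mpr hza))
  · by_cases hza : z = a
    · subst hza
      simpa [k] using h.self_of_nhds
    · have : (z - a) ^ n ≠ 0 := pow_ne_zero _ (sub_ne_zero.mpr hza)
      simp [k, hza, mul_div_cancel₀ _ this]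

lemma analyticOrderAt_ne_top_of_entire {f : ℂ → ℂ} (hf : Differentiable ℂ f) {c : ℂ}
    (hc : f c ≠ 0) (z : ℂ) : analyticOrderAt f z ≠ ⊤ := by
  intro h
  rw [analyticOrderAt_eq_top] at h
  have := AnalyticOnNhd.eqOn_zero_of_preconnected_of_eventuallyEq_zero
    (fun w _ => hf.analyticAt w) isPreconnected_univ (Set.mem_univ z) h
  exact hc (this (Set.mem_univ c))

/-- Extraction of finitely many zeros from an entire function. -/
lemma exists_entire_factor {f : ℂ → ℂ} (hf : Differentiable ℂ f) {c : ℂ} (hc : f c ≠ 0)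
    (S : Finset ℂ) :
    ∃ g : ℂ → ℂ, Differentiable ℂ g ∧ (∀ ρ ∈ S, g ρ ≠ 0) ∧
      ∀ z, f z = (∏ ρ ∈ S, (z - ρ) ^ analyticOrderNatAt f ρ) * g z := by
  induction S using Finset.induction_on with
  | empty => exact ⟨f, hf, by simp, by simp⟩
  | insert a S ha ih =>
    obtain ⟨g, hg, hgS, hfg⟩ := ih
    obtain ⟨f₀, hf₀, hf₀a, hfe⟩ := ((hf.analyticAt a).analyticOrderAt_ne_top).mp
      (analyticOrderAt_ne_top_of_entire hf hc a)
    set n := analyticOrderNatAt f a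
    have hP : ∀ z, z ∉ S → (∏ ρ ∈ S, (z - ρ) ^ analyticOrderNatAt f ρ) ≠ 0 := by
      intro z hz
      refine Finset.prod_ne_zero_iff.mpr fun ρ hρ => pow_ne_zero _ (sub_ne_zero.mpr ?_)
      rintro rfl
      exact hz hρ
    obtain ⟨k, hk, hka, hkg⟩ := exists_entire_div_pow hg (a := a) (n := n)
      (g₀ := fun z => f₀ z / (∏ ρ ∈ S, (z - ρ) ^ analyticOrderNatAt f ρ)) (by
        refine hf₀.div ?_ (hP a ha)
        exact Differentiable.analyticAt (by fun_prop) a) (by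
        have hS : ∀ᶠ z in nhds a, z ∉ S :=
          (S.finite_toSet.isClosed.isOpen_compl).mem_nhds (by simpa using ha)
        filter_upwards [hfe, hS] with z hz hzS
        have := hP z hzS
        rw [hfg z] at hz
        simp only [smul_eq_mul] at hz
        field_simp
        linear_combination hz)
    refine ⟨k, hk, fun ρ hρ => ?_, fun z => ?_⟩
    · rcases Finset.mem_insert.mp hρ with rfl | hρ
      · rw [hka]; exact div_ne_zero hf₀a (hP _ ha)
      · intro h0
        apply hgS ρ hρ
        rw [hkg, h0, mul_zero]
    · rw [Finset.prod_insert ha, hfg z, hkg z]; ring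

/-- A zero-free function on a disc whose modulus is controlled has slowly varying logarithmic
derivative near the centre. -/
lemma norm_logDeriv_sub_le {g : ℂ → ℂ} (hg : Differentiable ℂ g) {c : ℂ} {R M : ℝ} (hR : 0 < R)
    (hM : 0 < M) (hne : ∀ z ∈ Metric.ball c (R / 2), g z ≠ 0)
    (hb : ∀ z ∈ Metric.ball c (R / 2), ‖g z‖ ≤ Real.exp M * ‖g c‖) {z w : ℂ}
    (hz : z ∈ Metric.ball c (R / 16)) (hw : w ∈ Metric.ball c (R / 16)) :
    ‖logDeriv g z - logDeriv g w‖ ≤ 256 * M / R ^ 2 * ‖z - w‖ := by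
  have hd : DifferentiableOn ℂ (logDeriv g) (Metric.ball c (R / 2)) := by
    intro x hx
    exact ((hg.analyticAt x).deriv.differentiableAt.div (hg x) (hne x hx)).differentiableWithinAt
  have hcc : c ∈ Metric.ball c (R / 2) := Metric.mem_ball_self (by positivity)
  obtain ⟨l, hlc, hl⟩ := hd.isExactOn_ball.with_val_at c 0
  have hlw : ∀ x ∈ Metric.ball c (R / 2), g x = g c * Complex.exp (l x) := by
    intro x hx
    have hconst : ∀ y ∈ Metric.ball c (R / 2),
        HasDerivWithinAt (fun y => g y * Complex.exp (-l y)) 0 (Metric.ball c (R / 2)) y := by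
      intro y hy
      have := (hg y).hasDerivAt.mul ((hl y hy).neg.cexp)
      have h0 : deriv g y * Complex.exp (-l y) + g y * (Complex.exp (-l y) * -logDeriv g y) = 0 := by
        simp only [logDeriv_apply]
        have := hne y hy
        field_simp
        ring
      exact (h0 ▸ this : HasDerivAt _ (0 : ℂ) y).hasDerivWithinAt
    have := (convex_ball c (R / 2)).is_const_of_fderivWithin_eq_zero (𝕜 := ℂ)
      (f := fun y => g y * Complex.exp (-l y))
      (fun y hy => (hconst y hy).differentiableWithinAt) (fun y hy => by
        have h1 := (hconst y hy).hasFDerivWithinAt.fderivWithin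
          (Metric.isOpen_ball.uniqueDiffWithinAt hy)
        rw [h1]; ext; simp) hx hcc
    simp only [hlc, neg_zero, Complex.exp_zero, mul_one] at this
    rw [← this, mul_assoc, ← Complex.exp_add]; simp
  have hre : ∀ x ∈ Metric.ball c (R / 2), (l x).re ≤ M := by
    intro x hx
    have h1 := hb x hx
    rw [hlw x hx, norm_mul, Complex.norm_exp, mul_comm] at h1
    have h2 : 0 < ‖g c‖ := norm_pos_iff.mpr (hne c hcc)
    exact Real.exp_le_exp.mp (le_of_mul_le_mul_right h1 h2)
  have hBC : ∀ x ∈ Metric.closedBall c (R / 4), ‖l x‖ ≤ 2 * M := by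
    intro x hx
    have hxR : ‖x - c‖ ≤ R / 4 := by simpa [dist_eq_norm] using hx
    have h1 := Complex.borelCaratheodory_zero (f := fun y => l (c + y)) (R := R / 2) (z := x - c) hM
      (by
        intro y hy
        have hy' : c + y ∈ Metric.ball c (R / 2) := by simpa [dist_eq_norm] using hy
        exact ((hl _ hy').differentiableAt.comp y (by fun_prop)).differentiableWithinAt)
      (by
        intro y hy
        have hy' : c + y ∈ Metric.ball c (R / 2) := by simpa [dist_eq_norm] using hy
        exact hre _ hy') (by positivity) (by simp; linarith) (by simp [hlc])
    simp only [add_sub_cancel] at h1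
    refine h1.trans ?_
    rw [div_le_iff₀ (by linarith)]
    nlinarith
  have hsub : ∀ {x : ℂ} {r s : ℝ}, x ∈ Metric.ball c r → ∀ y ∈ Metric.closedBall x s,
      y ∈ Metric.ball c (r + s) := by
    intro x r s hx y hy
    rw [Metric.mem_ball] at *
    rw [Metric.mem_closedBall] at hy
    linarith [dist_triangle y x c]
  have hl1 : ∀ x ∈ Metric.ball c (R / 8), ‖logDeriv g x‖ ≤ 16 * M / R := by
    intro x hx
    have hs : ∀ y ∈ Metric.closedBall x (R / 8), y ∈ Metric.ball c (R / 4) := by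
      intro y hy
      have := hsub hx y hy
      rwa [show R / 8 + R / 8 = R / 4 by ring] at this
    have h2 : Metric.ball c (R / 4) ⊆ Metric.ball c (R / 2) :=
      Metric.ball_subset_ball (by linarith)
    have hx2 : x ∈ Metric.ball c (R / 2) := Metric.ball_subset_ball (by linarith) hx
    rw [← (hl x hx2).deriv]
    refine (Complex.norm_deriv_le_of_forall_mem_sphere_norm_le (R := R / 8) (C := 2 * M)
      (by positivity) ?_ ?_).trans (le_of_eq (by field_simp; norm_num))
    · refine DifferentiableOn.diffContOnCl_ball (U := Metric.ball c (R / 2)) ?_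
        fun y hy => h2 (hs y hy)
      exact fun y hy => (hl y hy).differentiableAt.differentiableWithinAt
    · exact fun y hy => hBC y (Metric.ball_subset_closedBall (hs y (Metric.sphere_subset_closedBall hy)))
  have hl2 : ∀ x ∈ Metric.ball c (R / 16), ‖deriv (logDeriv g) x‖ ≤ 256 * M / R ^ 2 := by
    intro x hx
    have hs : ∀ y ∈ Metric.closedBall x (R / 16), y ∈ Metric.ball c (R / 8) := by
      intro y hy
      have := hsub hx y hy
      rwa [show R / 16 + R / 16 = R / 8 by ring] at this
    refine (Complex.norm_deriv_le_of_forall_mem_sphere_norm_le (R := R / 16) (C := 16 * M / R)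
      (by positivity) ?_ ?_).trans (le_of_eq (by field_simp; norm_num))
    · exact DifferentiableOn.diffContOnCl_ball hd
        fun y hy => Metric.ball_subset_ball (by linarith) (hs y hy)
    · exact fun y hy => hl1 y (hs y (Metric.sphere_subset_closedBall hy))
  refine (convex_ball c (R / 16)).norm_image_sub_le_of_norm_deriv_le (𝕜 := ℂ) (fun x hx => ?_) hl2 hw hz
  exact (hd.differentiableAt (Metric.isOpen_ball.mem_nhds (Metric.ball_subset_ball (by linarith) hx)))

/-- Approximate partial fraction expansion of the logarithmic derivative. -/
lemma norm_logDeriv_sub_sub_sum_le {f : ℂ → ℂ} (hf : Differentiable ℂ f) {c : ℂ} (hc : f c ≠ 0)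
    {R M : ℝ} (hR : 0 < R) (hM : 0 < M)
    (hb : ∀ z ∈ Metric.closedBall c R, ‖f z‖ ≤ Real.exp M * ‖f c‖) (S : Finset ℂ)
    (hS : ∀ ρ, ρ ∈ S ↔ f ρ = 0 ∧ ‖ρ - c‖ ≤ R / 2) {z w : ℂ}
    (hz : z ∈ Metric.ball c (R / 16)) (hw : w ∈ Metric.ball c (R / 16)) (hfz : f z ≠ 0)
    (hfw : f w ≠ 0) :
    ‖logDeriv f z - logDeriv f w
      - ∑ ρ ∈ S, (analyticOrderNatAt f ρ : ℂ) * (1 / (z - ρ) - 1 / (w - ρ))‖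
      ≤ 256 * M / R ^ 2 * ‖z - w‖ := by
  obtain ⟨g, hg, hgS, hfg⟩ := exists_entire_factor hf hc S
  have hgc : g c ≠ 0 := by
    intro h; apply hc; rw [hfg, h, mul_zero]
  have hld : ∀ x, f x ≠ 0 → logDeriv f x
      = ∑ ρ ∈ S, (analyticOrderNatAt f ρ : ℂ) * (1 / (x - ρ)) + logDeriv g x := by
    intro x hx
    have hx' := hx
    rw [hfg] at hx'
    have h1 : ∀ ρ ∈ S, x - ρ ≠ 0 := by
      intro ρ hρ h
      rw [sub_eq_zero] at h
      exact hx (h ▸ ((hS ρ).mp hρ).1)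
    have hfe : f = fun z => (∏ ρ ∈ S, (z - ρ) ^ analyticOrderNatAt f ρ) * g z := funext hfg
    conv_lhs => rw [hfe]
    rw [logDeriv_mul x (left_ne_zero_of_mul hx') (right_ne_zero_of_mul hx') (by fun_prop) (hg x)]
    congr 1
    have := logDeriv_prod (ι := ℂ) (s := S) (f := fun ρ z => (z - ρ) ^ analyticOrderNatAt f ρ)
      (x := x) (fun ρ hρ => pow_ne_zero _ (h1 ρ hρ)) (fun ρ hρ => by fun_prop)
    rw [this]
    refine Finset.sum_congr rfl fun ρ hρ => ?_
    rw [logDeriv_fun_pow (by fun_prop)]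
    congr 1
    simp [logDeriv_apply]
  have hsph : ∀ x ∈ Metric.closedBall c R, ‖g x‖ ≤ Real.exp M * ‖g c‖ := by
    intro x hx
    refine Complex.norm_le_of_forall_mem_frontier_norm_le (U := Metric.ball c R)
      Metric.isBounded_ball hg.diffContOnCl (fun y hy => ?_)
      (by rwa [closure_ball c hR.ne'])
    rw [frontier_ball c hR.ne'] at hy
    have hyR : ‖y - c‖ = R := by simpa [dist_eq_norm] using hy
    have h1 := hb y (Metric.sphere_subset_closedBall hy)
    rw [hfg y, hfg c, norm_mul, norm_mul] at h1
    set P := ‖∏ ρ ∈ S, (y - ρ) ^ analyticOrderNatAt f ρ‖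
    set P0 := ‖∏ ρ ∈ S, (c - ρ) ^ analyticOrderNatAt f ρ‖
    have hle : P0 ≤ P := by
      simp only [P, P0, norm_prod, norm_pow]
      refine Finset.prod_le_prod (fun _ _ => by positivity) fun ρ hρ => ?_
      have h2 := ((hS ρ).mp hρ).2
      refine pow_le_pow_left₀ (norm_nonneg _) ?_ _
      rw [norm_sub_rev c ρ]
      have : ‖y - c‖ ≤ ‖y - ρ‖ + ‖ρ - c‖ := norm_sub_le_norm_sub_add_norm_sub y ρ c
      linarith
    have hP0 : 0 < P0 := by
      rw [norm_pos_iff]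
      have := hc
      rw [hfg] at this
      exact left_ne_zero_of_mul this
    have h3 : P * ‖g y‖ ≤ P * (Real.exp M * ‖g c‖) := by
      calc P * ‖g y‖ ≤ P0 * (Real.exp M * ‖g c‖) := by linarith
        _ ≤ _ := by gcongr
    exact le_of_mul_le_mul_left h3 (hP0.trans_le hle)
  have hball : Metric.ball c (R / 2) ⊆ Metric.closedBall c R :=
    (Metric.ball_subset_ball (by linarith)).trans Metric.ball_subset_closedBall
  have hmain := norm_logDeriv_sub_le hg hR hM (c := c) (fun x hx h0 => by
    by_cases hfx : f x = 0
    · exact hgS x ((hS x).mpr ⟨hfx, by rw [Metric.mem_ball, dist_eq_norm] at hx; exact hx.le⟩) h0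
    · apply hfx; rw [hfg, h0, mul_zero]) (fun x hx => hsph x (hball hx)) hz hw
  convert hmain using 2
  rw [hld z hfz, hld w hfw]
  simp only [mul_sub, Finset.sum_sub_distrib]
  ring

lemma finite_zeros_of_entire {f : ℂ → ℂ} (hf : Differentiable ℂ f) {c : ℂ} (hc : f c ≠ 0) (R : ℝ) :
    {z | f z = 0 ∧ ‖z - c‖ ≤ R}.Finite := by
  by_contra hinf
  obtain ⟨x, -, hx⟩ := Set.Infinite.exists_accPt_of_subset_isCompact (K := Metric.closedBall c R) hinf
    (isCompact_closedBall c R) (fun z hz => by simpa [dist_eq_norm] using hz.2)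
  rw [accPt_iff_frequently] at hx
  rcases (hf.analyticAt x).eventually_eq_zero_or_eventually_ne_zero with h | h
  · exact analyticOrderAt_ne_top_of_entire hf hc x (analyticOrderAt_eq_top.mpr h)
  · rw [eventually_nhdsWithin_iff] at h
    obtain ⟨y, hy, hy'⟩ := (hx.and_eventually h).exists
    exact hy' hy.1 hy.2.1

/-- Partial fraction expansion of the logarithmic derivative of an entire function of order at most
`3/2`, even up to a constant, all of whose zeros are purely imaginary. -/
theorem hasSum_logDeriv_of_entire {f : ℂ → ℂ} (hf : Differentiable ℂ f) {κ : ℂ}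
    (hsymm : ∀ z, f (-z) = κ * f z) (hzero : ∀ z, f z = 0 → z.re = 0) {C : ℝ}
    (hC : 0 ≤ C) (hgrowth : ∀ z, ‖f z‖ ≤ Real.exp (C * (1 + ‖z‖) ^ (3 / 2 : ℝ))) {x : ℝ} (hx : 0 < x) :
    HasSum (fun ρ : {ρ : ℂ // f ρ = 0} =>
      (analyticOrderNatAt f ρ : ℝ) * (x / (x ^ 2 + (ρ : ℂ).im ^ 2))) (logDeriv f x).re := by
  have hf1 : f 1 ≠ 0 := fun h => by simpa using hzero 1 h
  have hfx : f x ≠ 0 := fun h => hx.ne' (by simpa using hzero x h)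
  have hfx' : f (-x) ≠ 0 := fun h => hx.ne' (by simpa using hzero (-x) h)
  have hodd : logDeriv f (-x) = -logDeriv f x := by
    have h1 : deriv (fun z => f (-z)) (x : ℂ) = -deriv f (-x) := deriv_comp_neg f x
    have h2 : deriv (fun z => f (-z)) (x : ℂ) = κ * deriv f x := by
      rw [funext hsymm]; exact deriv_const_mul _ (hf _)
    have h3 : deriv f (-x) = -(κ * deriv f x) := by rw [← h2, h1, neg_neg]
    have hκ : κ ≠ 0 := fun h => by
      rw [hsymm, h, zero_mul] at hfx'; exact hfx' rfl
    rw [logDeriv_apply, logDeriv_apply, h3, hsymm]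
    field_simp
  set M : ℝ → ℝ := fun R => C * (2 + R) ^ (3 / 2 : ℝ) + |Real.log ‖f 1‖| + 1 with hMdef
  set S : ℝ → Finset ℂ := fun R => (finite_zeros_of_entire hf hf1 (R / 2)).toFinset with hSdef
  set t : ℂ → ℝ := fun ρ => (analyticOrderNatAt f ρ : ℝ) * (x / (x ^ 2 + ρ.im ^ 2)) with htdef
  have hSmem : ∀ R ρ, ρ ∈ S R ↔ f ρ = 0 ∧ ‖ρ - 1‖ ≤ R / 2 := fun R ρ => by simp [hSdef]
  have hterm : ∀ ρ, f ρ = 0 → (analyticOrderNatAt f ρ : ℂ) * (1 / (x - ρ) - 1 / (-x - ρ))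
      = 2 * (t ρ : ℂ) := by
    intro ρ hρ
    have hre := hzero ρ hρ
    have hρe : ρ = ρ.im * I := by
      apply Complex.ext <;> simp [hre]
    have h1 : (x : ℂ) - ρ ≠ 0 := fun h => hx.ne' (by simpa [hre] using congrArg Complex.re h)
    have h2 : -(x : ℂ) - ρ ≠ 0 := fun h => hx.ne' (by simpa [hre] using congrArg Complex.re h)
    have h3 : (x : ℂ) ^ 2 + (ρ.im : ℂ) ^ 2 ≠ 0 := by
      have : x ^ 2 + ρ.im ^ 2 ≠ 0 := by positivity
      exact_mod_cast this
    simp only [htdef]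
    push_cast
    have h4 : ((x : ℂ) - ρ) * (-x - ρ) = -(x ^ 2 + ρ.im ^ 2) := by
      conv_lhs => rw [hρe]
      linear_combination (ρ.im : ℂ) ^ 2 * I_sq
    have h5 : (1 / ((x : ℂ) - ρ) - 1 / (-x - ρ)) = 2 * (x / (x ^ 2 + ρ.im ^ 2)) := by
      rw [div_sub_div _ _ h1 h2, h4]
      field_simp
      ring
    rw [h5]; ring
  have hbound : ∀ᶠ R in atTop, |(logDeriv f x).re - ∑ ρ ∈ S R, t ρ| ≤ 256 * M R / R ^ 2 * x := by
    filter_upwards [eventually_gt_atTop (16 * (x + 1)), eventually_gt_atTop 0] with R hR hR0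
    have hMpos : 0 < M R := by positivity
    have := norm_logDeriv_sub_sub_sum_le hf hf1 hR0 hMpos (fun z hz => by
      have h1 : ‖z‖ ≤ 1 + R := by
        have : ‖z - 1‖ ≤ R := by simpa [dist_eq_norm] using hz
        calc ‖z‖ = ‖(z - 1) + 1‖ := by ring_nf
          _ ≤ ‖z - 1‖ + ‖(1 : ℂ)‖ := norm_add_le _ _
          _ ≤ _ := by rw [norm_one]; linarith
      have h2 : ‖f 1‖ = Real.exp (Real.log ‖f 1‖) := (Real.exp_log (norm_pos_iff.mpr hf1)).symm
      rw [h2, ← Real.exp_add]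
      refine (hgrowth z).trans (Real.exp_le_exp.mpr ?_)
      have h3 : (1 + ‖z‖) ^ (3 / 2 : ℝ) ≤ (2 + R) ^ (3 / 2 : ℝ) :=
        Real.rpow_le_rpow (by positivity) (by linarith) (by norm_num)
      have h4 := neg_abs_le (Real.log ‖f 1‖)
      simp only [hMdef]
      nlinarith) (S R) (hSmem R) (z := x) (w := -x) (by
        rw [Metric.mem_ball, dist_eq_norm]
        refine (norm_sub_le _ _).trans_lt ?_
        simp [abs_of_pos hx]; linarith) (by
        rw [Metric.mem_ball, dist_eq_norm]
        refine (norm_sub_le _ _).trans_lt ?_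
        simp [abs_of_pos hx]; linarith) hfx hfx'
    rw [hodd, Finset.sum_congr rfl (fun ρ hρ => hterm ρ ((hSmem R ρ).mp hρ).1), ← Finset.mul_sum] at this
    have h1 : logDeriv f x - -logDeriv f x - 2 * ∑ ρ ∈ S R, (t ρ : ℂ)
        = 2 * (logDeriv f x - ((∑ ρ ∈ S R, t ρ : ℝ) : ℂ)) := by push_cast; ring
    have h2 : ‖(x : ℂ) - -x‖ = 2 * x := by
      rw [sub_neg_eq_add, ← two_mul, norm_mul, Complex.norm_real, Real.norm_eq_abs, abs_of_pos hx]
      simp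
    rw [h1, norm_mul, h2] at this
    have h3 := Complex.abs_re_le_norm (logDeriv f x - ((∑ ρ ∈ S R, t ρ : ℝ) : ℂ))
    rw [Complex.sub_re, Complex.ofReal_re] at h3
    rw [show ‖(2 : ℂ)‖ = 2 by simp] at this
    linarith
  have hlim : Tendsto (fun R => 256 * M R / R ^ 2 * x) atTop (nhds 0) := by
    have h1 : Tendsto (fun R : ℝ => R ^ (-(1 / 2) : ℝ)) atTop (nhds 0) :=
      tendsto_rpow_neg_atTop (by norm_num)
    have h2 : Tendsto (fun R : ℝ => (R ^ 2)⁻¹) atTop (nhds 0) :=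
      tendsto_inv_atTop_zero.comp (tendsto_pow_atTop two_ne_zero)
    have h3 : Tendsto (fun R : ℝ => 256 * x * (C * 2 ^ (3 / 2 : ℝ) * R ^ (-(1 / 2) : ℝ)
        + (|Real.log ‖f 1‖| + 1) * (R ^ 2)⁻¹)) atTop (nhds 0) := by
      have := ((h1.const_mul (C * 2 ^ (3 / 2 : ℝ))).add
        (h2.const_mul (|Real.log ‖f 1‖| + 1))).const_mul (256 * x)
      simpa using this
    refine tendsto_of_tendsto_of_tendsto_of_le_of_le' tendsto_const_nhds h3 ?_ ?_
    · filter_upwards [eventually_gt_atTop 0] with R hR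
      positivity
    · filter_upwards [eventually_ge_atTop 2] with R hR
      have hR0 : 0 < R := by linarith
      have h4 : (2 + R) ^ (3 / 2 : ℝ) ≤ 2 ^ (3 / 2 : ℝ) * R ^ (3 / 2 : ℝ) := by
        rw [← Real.mul_rpow (by norm_num) hR0.le]
        exact Real.rpow_le_rpow (by positivity) (by linarith) (by norm_num)
      have h5 : R ^ (3 / 2 : ℝ) * (R ^ 2)⁻¹ = R ^ (-(1 / 2) : ℝ) := by
        rw [← Real.rpow_natCast, ← Real.rpow_neg hR0.le, ← Real.rpow_add hR0]; norm_num
      calc 256 * M R / R ^ 2 * x = 256 * x * (C * (2 + R) ^ (3 / 2 : ℝ) * (R ^ 2)⁻¹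
            + (|Real.log ‖f 1‖| + 1) * (R ^ 2)⁻¹) := by
            simp only [hMdef]; ring
        _ ≤ 256 * x * (C * (2 ^ (3 / 2 : ℝ) * R ^ (3 / 2 : ℝ)) * (R ^ 2)⁻¹
            + (|Real.log ‖f 1‖| + 1) * (R ^ 2)⁻¹) := by gcongr
        _ = _ := by rw [← h5]; ring
  have hsub : ∀ R, ∑ ρ ∈ (S R).subtype (fun ρ => f ρ = 0), t ρ = ∑ ρ ∈ S R, t ρ := fun R =>
    Finset.sum_subtype_of_mem t fun ρ hρ => ((hSmem R ρ).mp hρ).1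
  have ht0 : ∀ ρ, 0 ≤ t ρ := fun ρ => by positivity
  refine hasSum_of_isLUB_of_nonneg (f := fun ρ : {ρ : ℂ // f ρ = 0} => t ρ) _ (fun ρ => ht0 ρ) ⟨?_, ?_⟩
  · rintro _ ⟨T, rfl⟩
    have h1 : ∀ᶠ R in atTop, ∑ ρ ∈ T, t ρ ≤ (logDeriv f x).re + 256 * M R / R ^ 2 * x := by
      have hT : ∀ᶠ R : ℝ in atTop, ∀ ρ ∈ T, ‖(ρ : ℂ) - 1‖ ≤ R / 2 := by
        refine (Finset.eventually_all T).mpr fun ρ _ => ?_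
        filter_upwards [eventually_ge_atTop (2 * ‖(ρ : ℂ) - 1‖)] with R hR
        linarith
      filter_upwards [hbound, hT] with R hR hTR
      have h2 : ∑ ρ ∈ T, t ρ ≤ ∑ ρ ∈ S R, t ρ := by
        rw [← hsub]
        refine Finset.sum_le_sum_of_subset_of_nonneg (fun ρ hρ => ?_) fun ρ _ _ => ht0 ρ
        rw [Finset.mem_subtype, hSmem]
        exact ⟨ρ.2, hTR ρ hρ⟩
      have := (abs_le.mp hR).1
      linarith
    have h2 := hlim.const_add (logDeriv f x).re
    rw [add_zero] at h2
    exact ge_of_tendsto h2 h1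
  · intro b hb
    have h2 := hlim.const_add b
    rw [add_zero] at h2
    refine ge_of_tendsto h2 ?_
    filter_upwards [hbound] with R hR
    have h1 : ∑ ρ ∈ S R, t ρ ≤ b := by
      rw [← hsub]; exact hb ⟨_, rfl⟩
    have := (abs_le.mp hR).2
    linarith

/-- A continuous function on `[0,1]` all of whose moments vanish is zero. -/
lemma eq_zero_of_moments {f : ℝ → ℝ} (hf : Continuous f)
    (h : ∀ k : ℕ, ∫ t in (0:ℝ)..1, f t * t ^ k = 0) : ∀ t ∈ Set.Ioo (0:ℝ) 1, f t = 0 := by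
  have hpoly : ∀ p : Polynomial ℝ, ∫ t in (0:ℝ)..1, f t * p.eval t = 0 := by
    intro p
    induction p using Polynomial.induction_on' with
    | add p r hp hr =>
      simp only [Polynomial.eval_add, mul_add]
      rw [intervalIntegral.integral_add, hp, hr, add_zero]
      · exact (hf.mul p.continuous).intervalIntegrable _ _
      · exact (hf.mul r.continuous).intervalIntegrable _ _
    | monomial n a =>
      simp only [Polynomial.eval_monomial]
      have : ∀ t : ℝ, f t * (a * t ^ n) = a * (f t * t ^ n) := fun t => by ring
      simp only [this, intervalIntegral.integral_const_mul, h n, mul_zero]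
  have hsq : ∫ t in (0:ℝ)..1, f t ^ 2 = 0 := by
    set A := ∫ t in (0:ℝ)..1, |f t|
    have hA : 0 ≤ A := intervalIntegral.integral_nonneg zero_le_one fun _ _ => abs_nonneg _
    refine le_antisymm ?_ (intervalIntegral.integral_nonneg zero_le_one fun _ _ => sq_nonneg _)
    refine le_of_forall_pos_le_add fun ε hε => ?_
    obtain ⟨p, hp⟩ := exists_polynomial_near_of_continuousOn 0 1 f hf.continuousOn (ε / (A + 1))
      (by positivity)
    have h1 : ∫ t in (0:ℝ)..1, f t ^ 2 = ∫ t in (0:ℝ)..1, (f t ^ 2 - f t * p.eval t) := by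
      rw [intervalIntegral.integral_sub, hpoly, sub_zero]
      · exact (hf.pow 2).intervalIntegrable _ _
      · exact (hf.mul p.continuous).intervalIntegrable _ _
    have h2 : ∫ t in (0:ℝ)..1, (f t ^ 2 - f t * p.eval t)
        ≤ ∫ t in (0:ℝ)..1, |f t| * (ε / (A + 1)) := by
      refine intervalIntegral.integral_mono_on zero_le_one ?_ ?_ fun t ht => ?_
      · exact ((hf.pow 2).sub (hf.mul p.continuous)).intervalIntegrable _ _
      · exact (hf.abs.mul continuous_const).intervalIntegrable _ _
      · have := hp t ht
        calc f t ^ 2 - f t * p.eval t = f t * (f t - p.eval t) := by ring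
          _ ≤ |f t * (f t - p.eval t)| := le_abs_self _
          _ = |f t| * |p.eval t - f t| := by rw [abs_mul, abs_sub_comm (f t)]
          _ ≤ _ := by gcongr
    rw [intervalIntegral.integral_mul_const] at h2
    have h3 : A * (ε / (A + 1)) ≤ ε := by
      rw [mul_div_assoc', div_le_iff₀ (by positivity)]; nlinarith
    rw [h1]; linarith
  intro t ht
  by_contra hne
  have := intervalIntegral.integral_pos (f := fun t => f t ^ 2) zero_lt_one (hf.pow 2).continuousOn
    (fun _ _ => sq_nonneg _) ⟨t, Set.Ioo_subset_Icc_self ht, by positivity⟩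
  linarith

/-- Uniqueness of Laplace transforms. -/
lemma eq_zero_of_laplace {D : ℝ → ℝ} (hD : Continuous D) {K : ℝ} {a : ℕ}
    (hb : ∀ u, |D u| ≤ K * Real.exp (a * |u|))
    (h : ∀ n : ℕ, a < n → ∫ u in Set.Ioi (0:ℝ), D u * Real.exp (-(n * u)) = 0) :
    ∀ u, 0 < u → D u = 0 := by
  have hK : 0 ≤ K := by simpa using (abs_nonneg _).trans (hb 0)
  set f : ℝ → ℝ := fun t => D (-Real.log t) * t ^ (a + 1) with hfdef
  have hf : Continuous f := by
    rw [continuous_iff_continuousAt]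
    intro t
    by_cases ht : t = 0
    · subst ht
      have h0 : f 0 = 0 := by simp [hfdef]
      have hle : ∀ᶠ t in nhds (0:ℝ), ‖f t‖ ≤ K * |t| := by
        filter_upwards [Metric.ball_mem_nhds (0:ℝ) zero_lt_one] with t ht
        by_cases ht0 : t = 0
        · simp [ht0, h0]
        have htp : 0 < |t| := abs_pos.mpr ht0
        have ht1 : |t| ≤ 1 := by simpa using (Metric.mem_ball.mp ht).le
        have h1 := hb (-Real.log t)
        have h2 : |(-Real.log t)| = -Real.log |t| := by
          rw [abs_neg, Real.log_abs, abs_of_nonpos]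
          rw [← Real.log_abs]; exact Real.log_nonpos htp.le ht1
        have h3 : Real.exp (a * |(-Real.log t)|) * |t| ^ a = 1 := by
          rw [h2, mul_neg, Real.exp_neg, mul_comm (a:ℝ), Real.exp_mul, Real.exp_log htp,
            Real.rpow_natCast]
          exact inv_mul_cancel₀ (by positivity)
        calc ‖f t‖ = |D (-Real.log t)| * |t| ^ (a + 1) := by
              simp [hfdef, Real.norm_eq_abs]
          _ ≤ K * Real.exp (a * |(-Real.log t)|) * |t| ^ (a + 1) := by gcongr
          _ = K * |t| * (Real.exp (a * |(-Real.log t)|) * |t| ^ a) := by ring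
          _ = K * |t| := by rw [h3, mul_one]
      rw [ContinuousAt, h0]
      refine squeeze_zero_norm' hle ?_
      have : Continuous fun t : ℝ => K * |t| := by fun_prop
      simpa using this.tendsto 0
    · exact (hD.continuousAt.comp (Real.continuousAt_log ht).neg).mul (by fun_prop)
  have hmom : ∀ k : ℕ, ∫ t in (0:ℝ)..1, f t * t ^ k = 0 := by
    intro k
    have himg : Set.image (fun u => Real.exp (-u)) (Set.Ioi (0:ℝ)) = Set.Ioo 0 1 := by
      ext t
      simp only [Set.mem_image, Set.mem_Ioi, Set.mem_Ioo]
      constructor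
      · rintro ⟨u, hu, rfl⟩
        exact ⟨Real.exp_pos _, by rw [Real.exp_lt_one_iff]; linarith⟩
      · rintro ⟨h0, h1⟩
        exact ⟨-Real.log t, by linarith [Real.log_neg h0 h1], by rw [neg_neg, Real.exp_log h0]⟩
    rw [intervalIntegral.integral_of_le zero_le_one, MeasureTheory.integral_Ioc_eq_integral_Ioo,
      ← himg, MeasureTheory.integral_image_eq_integral_abs_deriv_smul (F := ℝ) measurableSet_Ioi
        (f := fun u : ℝ => Real.exp (-u)) (f' := fun u => -Real.exp (-u)) (fun u _ => by
          simpa using ((hasDerivAt_neg u).exp).hasDerivWithinAt)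
        (fun u _ v _ huv => by simpa using huv)]
    refine Eq.trans ?_ (h (a + 2 + k) (by omega))
    refine MeasureTheory.integral_congr_ae (Filter.Eventually.of_forall fun u => ?_)
    simp only [hfdef, abs_neg, abs_of_pos (Real.exp_pos _), Real.log_exp, neg_neg, smul_eq_mul]
    have : Real.exp (-(((a + 2 + k : ℕ) : ℝ) * u)) = Real.exp (-u) ^ (a + 2 + k) := by
      rw [← Real.exp_nat_mul]; ring_nf
    rw [this]; ring
  intro u hu
  have := eq_zero_of_moments hf hmom (Real.exp (-u)) ⟨Real.exp_pos _, by
    rw [Real.exp_lt_one_iff]; linarith⟩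
  simp only [hfdef, Real.log_exp, neg_neg] at this
  exact (mul_eq_zero.mp this).resolve_right (by positivity)

/-- The Laplace transform on the half-line. -/
noncomputable def lap (F : ℝ → ℝ) (z : ℝ) : ℝ := ∫ u in Set.Ioi (0:ℝ), F u * Real.exp (-(z * u))

/-- Continuous functions of exponential type at most `a`. -/
def ExpType (a : ℝ) (F : ℝ → ℝ) : Prop :=
  Continuous F ∧ ∃ K : ℝ, ∀ u, |F u| ≤ K * Real.exp (a * |u|)

lemma ExpType.add {a : ℝ} {F G : ℝ → ℝ} (hF : ExpType a F) (hG : ExpType a G) :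
    ExpType a (fun u => F u + G u) := by
  obtain ⟨hF, K, hK⟩ := hF
  obtain ⟨hG, L, hL⟩ := hG
  exact ⟨hF.add hG, K + L, fun u => (abs_add_le _ _).trans (by nlinarith [hK u, hL u])⟩

lemma ExpType.const_mul {a : ℝ} {F : ℝ → ℝ} (hF : ExpType a F) (c : ℝ) :
    ExpType a (fun u => c * F u) := by
  obtain ⟨hF, K, hK⟩ := hF
  refine ⟨hF.const_mul c, |c| * K, fun u => ?_⟩
  rw [abs_mul, mul_assoc]
  gcongr
  exact hK u

lemma ExpType.sum {a : ℝ} {κ : Type*} (s : Finset κ) {F : κ → ℝ → ℝ}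
    (hF : ∀ j, ExpType a (F j)) : ExpType a (fun u => ∑ j ∈ s, F j u) := by
  induction s using Finset.induction_on with
  | empty => exact ⟨by simpa using continuous_const, 0, fun u => by simp⟩
  | insert j s hj ih =>
    simp only [Finset.sum_insert hj]
    exact (hF j).add ih

lemma integrableOn_exp_neg_mul {z : ℝ} (hz : 0 < z) (l : ℝ) :
    MeasureTheory.IntegrableOn (fun u : ℝ => Real.exp (-(z * u))) (Set.Ioi l) := by
  simpa using integrableOn_exp_mul_Ioi (a := -z) (by linarith) l

lemma integral_exp_neg_mul {z : ℝ} (hz : 0 < z) (l : ℝ) :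
    ∫ u in Set.Ioi l, Real.exp (-(z * u)) = Real.exp (-(z * l)) / z := by
  have := integral_exp_mul_Ioi (a := -z) (by linarith) l
  simp only [neg_mul] at this
  rw [this]; field_simp

lemma norm_mul_exp_le {a z K : ℝ} {F : ℝ → ℝ} (hK : ∀ u, |F u| ≤ K * Real.exp (a * |u|)) {u : ℝ}
    (hu : 0 < u) : ‖F u * Real.exp (-(z * u))‖ ≤ K * Real.exp (-((z - a) * u)) := by
  rw [norm_mul, Real.norm_eq_abs, Real.norm_eq_abs, abs_of_pos (Real.exp_pos _)]
  have := hK u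
  rw [abs_of_pos hu] at this
  calc |F u| * Real.exp (-(z * u)) ≤ K * Real.exp (a * u) * Real.exp (-(z * u)) := by gcongr
    _ = _ := by rw [mul_assoc, ← Real.exp_add]; ring_nf

lemma ExpType.integrable {a z : ℝ} (hz : a < z) {F : ℝ → ℝ} (hF : ExpType a F) :
    MeasureTheory.IntegrableOn (fun u => F u * Real.exp (-(z * u))) (Set.Ioi 0) := by
  obtain ⟨hF, K, hK⟩ := hF
  refine MeasureTheory.Integrable.mono' ((integrableOn_exp_neg_mul (sub_pos.mpr hz) 0).const_mul K)
    (by fun_prop) ?_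
  refine (MeasureTheory.ae_restrict_iff' measurableSet_Ioi).mpr (Filter.Eventually.of_forall fun u hu => ?_)
  exact norm_mul_exp_le hK hu

lemma lap_add {a z : ℝ} (hz : a < z) {F G : ℝ → ℝ} (hF : ExpType a F) (hG : ExpType a G) :
    lap (fun u => F u + G u) z = lap F z + lap G z := by
  simp only [lap, add_mul]
  exact MeasureTheory.integral_add (hF.integrable hz) (hG.integrable hz)

lemma lap_const_mul (F : ℝ → ℝ) (c z : ℝ) : lap (fun u => c * F u) z = c * lap F z := by
  simp only [lap, mul_assoc]
  exact MeasureTheory.integral_const_mul _ _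

lemma lap_sum {a z : ℝ} (hz : a < z) {κ : Type*} (s : Finset κ) {F : κ → ℝ → ℝ}
    (hF : ∀ j, ExpType a (F j)) : lap (fun u => ∑ j ∈ s, F j u) z = ∑ j ∈ s, lap (F j) z := by
  simp only [lap, Finset.sum_mul]
  exact MeasureTheory.integral_finsetSum _ fun j _ => (hF j).integrable hz

section Family
variable {ι : Type*} {F : ι → ℝ → ℝ} {b : ι → ℝ} {a : ℝ}

lemma expType_tsum (hF : ∀ i, Continuous (F i))
    (hFb : ∀ i u, |F i u| ≤ b i * Real.exp (a * |u|)) (hb : Summable b) :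
    ExpType a (fun u => ∑' i, F i u) := by
  have hb' : ∀ i u, ‖F i u * Real.exp (-(a * |u|))‖ ≤ b i := by
    intro i u
    rw [norm_mul, Real.norm_eq_abs, Real.norm_eq_abs, abs_of_pos (Real.exp_pos _)]
    calc _ ≤ b i * Real.exp (a * |u|) * Real.exp (-(a * |u|)) := by gcongr; exact hFb i u
      _ = b i := by rw [mul_assoc, ← Real.exp_add]; simp
  constructor
  · have h1 : Continuous fun u => ∑' i, F i u * Real.exp (-(a * |u|)) :=
      continuous_tsum (fun i => (hF i).mul (by fun_prop)) hb hb'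
    have h2 : (fun u => ∑' i, F i u)
        = fun u => (∑' i, F i u * Real.exp (-(a * |u|))) * Real.exp (a * |u|) := by
      ext u
      rw [tsum_mul_right, mul_assoc, ← Real.exp_add]; simp
    rw [h2]
    exact h1.mul (by fun_prop)
  · refine ⟨∑' i, b i, fun u => ?_⟩
    rw [← tsum_mul_right]
    exact tsum_of_norm_bounded (f := fun i => F i u)
      (hb.mul_right (Real.exp (a * |u|))).hasSum fun i => hFb i u

lemma hasSum_lap [Countable ι] (hF : ∀ i, Continuous (F i))
    (hFb : ∀ i u, |F i u| ≤ b i * Real.exp (a * |u|)) (hb : Summable b) {z : ℝ} (hz : a < z) :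
    HasSum (fun i => lap (F i) z) (lap (fun u => ∑' i, F i u) z) := by
  have hInt : ∀ i, MeasureTheory.IntegrableOn (fun u => F i u * Real.exp (-(z * u))) (Set.Ioi 0) :=
    fun i => ExpType.integrable hz ⟨hF i, b i, hFb i⟩
  have := MeasureTheory.hasSum_integral_of_summable_integral_norm
    (μ := MeasureTheory.volume.restrict (Set.Ioi (0:ℝ)))
    (F := fun i u => F i u * Real.exp (-(z * u))) hInt ?_
  · simpa only [lap, tsum_mul_right] using this
  · refine Summable.of_nonneg_of_le (fun i => MeasureTheory.integral_nonneg fun u => norm_nonneg _)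
      (fun i => ?_) (hb.mul_right (∫ u in Set.Ioi (0:ℝ), Real.exp (-((z - a) * u))))
    rw [← MeasureTheory.integral_const_mul]
    refine MeasureTheory.setIntegral_mono_on (hInt i).norm
      ((integrableOn_exp_neg_mul (sub_pos.mpr hz) 0).const_mul _) measurableSet_Ioi fun u hu => ?_
    exact norm_mul_exp_le (hFb i) hu
end Family

lemma lap_exp {b z : ℝ} (h : 0 < z + b) : lap (fun u => Real.exp (-(b * |u|))) z = 1 / (z + b) := by
  have : lap (fun u => Real.exp (-(b * |u|))) z
      = ∫ u in Set.Ioi (0:ℝ), Real.exp (-((z + b) * u)) := by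
    refine MeasureTheory.setIntegral_congr_fun measurableSet_Ioi fun u hu => ?_
    simp only [abs_of_pos (Set.mem_Ioi.mp hu)]
    rw [← Real.exp_add]; ring_nf
  rw [this, integral_exp_neg_mul h]; simp

lemma lap_cos (γ : ℝ) {z : ℝ} (hz : 0 < z) :
    lap (fun u => Real.cos (γ * u)) z = z / (z ^ 2 + γ ^ 2) := by
  have hre : ((-z + γ * I : ℂ)).re < 0 := by simpa using hz
  have h1 := integral_exp_mul_complex_Ioi hre 0
  have h2 := integrableOn_exp_mul_complex_Ioi hre 0
  have h3 : ∀ u : ℝ, Real.cos (γ * u) * Real.exp (-(z * u))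
      = (Complex.exp ((-z + γ * I) * u)).re := by
    intro u
    rw [Complex.exp_re]
    simp [mul_comm]
  have h4 := congrArg Complex.re h1
  rw [← RCLike.re_eq_complex_re, ← integral_re h2] at h4
  simp only [lap, h3]
  simp only [RCLike.re_eq_complex_re] at h4
  rw [h4]
  simp [Complex.div_re, Complex.normSq_apply]
  ring_nf

lemma lap_exp_abs_sub {a l z : ℝ} (ha : 0 < a) (hl : 0 ≤ l) (hz : a < z) :
    lap (fun u => Real.exp (-(a * |u - l|))) z
      = (Real.exp (-(a * l)) - Real.exp (-(z * l))) / (z - a) + Real.exp (-(z * l)) / (z + a) := by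
  have hsplit : ∀ f : ℝ → ℝ, MeasureTheory.IntegrableOn f (Set.Ioi 0) →
      ∫ u in Set.Ioi 0, f u = (∫ u in Set.Ioc 0 l, f u) + ∫ u in Set.Ioi l, f u := by
    intro f hf
    rw [← Set.Ioc_union_Ioi_eq_Ioi hl]
    refine MeasureTheory.setIntegral_union (by
      rw [Set.disjoint_left]; intro x hx hx'; exact absurd hx.2 (not_le.mpr hx')) measurableSet_Ioi ?_ ?_
    · exact hf.mono_set fun x hx => hx.1
    · exact hf.mono_set fun x hx => lt_of_le_of_lt hl hx
  have hE : ExpType a (fun u => Real.exp (-(a * |u - l|))) := by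
    refine ⟨by fun_prop, 1, fun u => ?_⟩
    rw [abs_of_pos (Real.exp_pos _), one_mul]
    refine Real.exp_le_exp.mpr ?_
    have := mul_nonneg ha.le (abs_nonneg (u - l))
    have := mul_nonneg ha.le (abs_nonneg u)
    linarith
  have h1 := hsplit _ (hE.integrable hz)
  have h2 := hsplit _ (integrableOn_exp_neg_mul (sub_pos.mpr hz) 0)
  have h3 : ∫ u in Set.Ioc 0 l, Real.exp (-(a * |u - l|)) * Real.exp (-(z * u))
      = ∫ u in Set.Ioc 0 l, Real.exp (-(a * l)) * Real.exp (-((z - a) * u)) := by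
    refine MeasureTheory.setIntegral_congr_fun measurableSet_Ioc fun u hu => ?_
    simp only [abs_of_nonpos (sub_nonpos.mpr hu.2)]
    rw [← Real.exp_add, ← Real.exp_add]; ring_nf
  have h4 : ∫ u in Set.Ioi l, Real.exp (-(a * |u - l|)) * Real.exp (-(z * u))
      = ∫ u in Set.Ioi l, Real.exp (a * l) * Real.exp (-((z + a) * u)) := by
    refine MeasureTheory.setIntegral_congr_fun measurableSet_Ioi fun u hu => ?_
    simp only [abs_of_pos (sub_pos.mpr (Set.mem_Ioi.mp hu))]
    rw [← Real.exp_add, ← Real.exp_add]; ring_nf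
  rw [lap, h1, h3, h4, MeasureTheory.integral_const_mul, MeasureTheory.integral_const_mul]
  rw [integral_exp_neg_mul (sub_pos.mpr hz), integral_exp_neg_mul (sub_pos.mpr hz)] at h2
  have h5 : ∫ u in Set.Ioc 0 l, Real.exp (-((z - a) * u))
      = Real.exp (-((z - a) * 0)) / (z - a) - Real.exp (-((z - a) * l)) / (z - a) := by linarith
  rw [h5, integral_exp_neg_mul (by linarith)]
  have e1 : Real.exp (-(z * l)) = Real.exp (-(a * l)) * Real.exp (-((z - a) * l)) := by
    rw [← Real.exp_add]; ring_nf
  have e2 : Real.exp (-(z * l)) = Real.exp (a * l) * Real.exp (-((z + a) * l)) := by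
    rw [← Real.exp_add]; ring_nf
  rw [mul_div_assoc', ← e2, e1]
  simp
  ring

/-- Data of an explicit formula: ordinates `γ` of zeros on the central line with multiplicities `m`,
gamma shifts `β`, and Dirichlet coefficients `c`. -/
structure FormulaData where
  ι : Type
  hι : Countable ι
  γ : ι → ℝ
  m : ι → ℝ
  hm : ∀ i, 0 ≤ m i
  κ : Type
  hκ : Fintype κ
  β : κ → ℝ
  hβ : ∀ j, β j = 1 / 2 ∨ β j = 3 / 2
  C₀ : ℝ
  c : ℕ → ℝ
  hc₀ : c 0 = 0
  hc : ∀ x : ℝ, 1 / 2 < x → Summable fun n : ℕ => |c n| * (n : ℝ) ^ (-(1 / 2) - x)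
  formula : ∀ x : ℝ, 1 / 2 < x → HasSum (fun i => m i * (x / (x ^ 2 + γ i ^ 2)))
    (C₀ + ∑ j, 1 / 2 * realDigamma ((x + β j) / 2) - ∑' n : ℕ, c n * (n : ℝ) ^ (-(1 / 2) - x))

attribute [instance] FormulaData.hι FormulaData.hκ

namespace FormulaData
variable (E : FormulaData)

/-- The sum over zeros. -/
noncomputable def h (x : ℝ) : ℝ := ∑' i, E.m i * (x / (x ^ 2 + E.γ i ^ 2))

/-- The archimedean contribution. -/
noncomputable def g (x : ℝ) : ℝ := E.C₀ + ∑ j, 1 / 2 * realDigamma ((x + E.β j) / 2)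

/-- The Dirichlet series. -/
noncomputable def P (x : ℝ) : ℝ := ∑' n : ℕ, E.c n * (n : ℝ) ^ (-(1 / 2) - x)

/-- The smoothed sum over zeros. -/
noncomputable def S (a u : ℝ) : ℝ :=
  ∑' i, E.m i * (2 * a / (a ^ 2 + E.γ i ^ 2)) * Real.cos (E.γ i * u)

/-- The smoothed sum over prime powers. -/
noncomputable def A (a u : ℝ) : ℝ :=
  ∑' n : ℕ, E.c n * (n : ℝ) ^ (-(1 / 2) : ℝ) *
    (Real.exp (-(a * |u - Real.log n|)) + Real.exp (-(a * Real.log n)) * Real.exp (-(a * |u|)))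

/-- The smoothed sum over trivial zeros. -/
noncomputable def Q (a u : ℝ) : ℝ :=
  ∑ j, ∑' k : ℕ, 2 * a / (a + (2 * k + E.β j)) / (a - (2 * k + E.β j)) *
    (Real.exp (-((2 * k + E.β j) * |u|)) + (-1) * Real.exp (-(a * |u|)))

variable {E}

lemma hasSum_h {x : ℝ} (hx : 1 / 2 < x) :
    HasSum (fun i => E.m i * (x / (x ^ 2 + E.γ i ^ 2))) (E.h x) :=
  (E.formula x hx).summable.hasSum

lemma h_eq {x : ℝ} (hx : 1 / 2 < x) : E.h x = E.g x - E.P x := (E.formula x hx).tsum_eq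

lemma rpow_half_sub {n : ℕ} (hn : n ≠ 0) (x : ℝ) :
    (n : ℝ) ^ (-(1 / 2) - x) = (n : ℝ) ^ (-(1 / 2) : ℝ) * Real.exp (-(x * Real.log n)) := by
  have : (0:ℝ) < n := by positivity
  rw [Real.rpow_sub this, Real.rpow_def_of_pos this x, Real.exp_neg, mul_comm x]
  rfl

lemma hc_exp {x : ℝ} (hx : 1 / 2 < x) :
    Summable fun n : ℕ => |E.c n| * (n : ℝ) ^ (-(1 / 2) : ℝ) * Real.exp (-(x * Real.log n)) := by
  refine (E.hc x hx).congr fun n => ?_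
  rcases eq_or_ne n 0 with rfl | hn
  · simp [E.hc₀]
  · rw [rpow_half_sub hn, mul_assoc]

lemma P_eq {x : ℝ} :
    E.P x = ∑' n : ℕ, E.c n * (n : ℝ) ^ (-(1 / 2) : ℝ) * Real.exp (-(x * Real.log n)) := by
  refine tsum_congr fun n => ?_
  rcases eq_or_ne n 0 with rfl | hn
  · simp [E.hc₀]
  · rw [rpow_half_sub hn, mul_assoc]

lemma hasSum_P {x : ℝ} (hx : 1 / 2 < x) :
    HasSum (fun n : ℕ => E.c n * (n : ℝ) ^ (-(1 / 2) : ℝ) * Real.exp (-(x * Real.log n))) (E.P x) := by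
  rw [P_eq]
  refine (Summable.of_norm_bounded (hc_exp (E := E) hx) fun n => ?_).hasSum
  rw [norm_mul, norm_mul, Real.norm_eq_abs, Real.norm_of_nonneg (by positivity),
    Real.norm_of_nonneg (Real.exp_pos _).le]

lemma summable_m {a : ℝ} (ha : 1 / 2 < a) :
    Summable fun i => E.m i * (2 * a / (a ^ 2 + E.γ i ^ 2)) :=
  ((hasSum_h (E := E) ha).summable.mul_left 2).congr fun i => by ring

lemma S_bound {a : ℝ} (ha : 1 / 2 < a) (i : E.ι) (u : ℝ) :
    |E.m i * (2 * a / (a ^ 2 + E.γ i ^ 2)) * Real.cos (E.γ i * u)|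
      ≤ E.m i * (2 * a / (a ^ 2 + E.γ i ^ 2)) * Real.exp (a * |u|) := by
  have h0 : 0 ≤ E.m i * (2 * a / (a ^ 2 + E.γ i ^ 2)) := by
    have := E.hm i
    have : 0 < a := by linarith
    positivity
  rw [abs_mul, abs_of_nonneg h0]
  gcongr
  exact (Real.abs_cos_le_one _).trans (Real.one_le_exp (by positivity))

lemma expType_S {a : ℝ} (ha : 1 / 2 < a) : ExpType a (E.S a) :=
  expType_tsum (fun i => by fun_prop) (S_bound ha) (summable_m ha)

lemma lap_S {a z : ℝ} (ha : 1 / 2 < a) (hz : a < z) :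
    lap (E.S a) z = (2 * z * E.h a - 2 * a * E.h z) / (z ^ 2 - a ^ 2) := by
  have hza : z ^ 2 - a ^ 2 ≠ 0 := by nlinarith
  have h1 := hasSum_lap (fun i => by fun_prop) (S_bound (E := E) ha) (summable_m ha) hz
  have h2 := (((hasSum_h (E := E) ha).mul_left (2 * z)).sub
    ((hasSum_h (E := E) (x := z) (by linarith)).mul_left (2 * a))).div_const (z ^ 2 - a ^ 2)
  refine h1.unique (h2.congr_fun fun i => ?_)
  rw [lap_const_mul, lap_cos _ (by linarith)]
  have e1 : a ^ 2 + E.γ i ^ 2 ≠ 0 := by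
    have : 0 < a := by linarith
    positivity
  have e2 : z ^ 2 + E.γ i ^ 2 ≠ 0 := by
    have : 0 < z := by linarith
    positivity
  field_simp
  ring

lemma A_bound {a : ℝ} (ha : 0 < a) (n : ℕ) (u : ℝ) :
    |E.c n * (n : ℝ) ^ (-(1 / 2) : ℝ) *
    (Real.exp (-(a * |u - Real.log n|)) + Real.exp (-(a * Real.log n)) * Real.exp (-(a * |u|)))|
      ≤ 2 * (|E.c n| * (n : ℝ) ^ (-(1 / 2) : ℝ) * Real.exp (-(a * Real.log n)))
        * Real.exp (a * |u|) := by
  rw [abs_mul, abs_mul, abs_of_nonneg (by positivity : (0:ℝ) ≤ (n : ℝ) ^ (-(1 / 2) : ℝ)),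
    abs_of_pos (by positivity : 0 < Real.exp (-(a * |u - Real.log n|))
      + Real.exp (-(a * Real.log n)) * Real.exp (-(a * |u|)))]
  have hl : 0 ≤ Real.log n := Real.log_natCast_nonneg n
  have h1 : Real.exp (-(a * |u - Real.log n|)) ≤ Real.exp (-(a * Real.log n)) * Real.exp (a * |u|) := by
    rw [← Real.exp_add, Real.exp_le_exp]
    have : Real.log n ≤ |u| + |u - Real.log n| := by
      have := abs_sub_abs_le_abs_sub (Real.log n) u
      rw [abs_of_nonneg hl, abs_sub_comm] at this
      linarith
    nlinarith
  have h2 : Real.exp (-(a * |u|)) ≤ Real.exp (a * |u|) := by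
    rw [Real.exp_le_exp]
    have := mul_nonneg ha.le (abs_nonneg u)
    linarith
  calc _ ≤ |E.c n| * (n : ℝ) ^ (-(1 / 2) : ℝ) * (Real.exp (-(a * Real.log n)) * Real.exp (a * |u|)
      + Real.exp (-(a * Real.log n)) * Real.exp (a * |u|)) := by gcongr
    _ = _ := by ring

lemma expType_A {a : ℝ} (ha : 1 / 2 < a) : ExpType a (E.A a) :=
  expType_tsum (fun n => by fun_prop) (A_bound (by linarith)) ((hc_exp ha).mul_left 2)

lemma lap_A {a z : ℝ} (ha : 1 / 2 < a) (hz : a < z) :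
    lap (E.A a) z = (2 * z * E.P a - 2 * a * E.P z) / (z ^ 2 - a ^ 2) := by
  have hza : z ^ 2 - a ^ 2 ≠ 0 := by nlinarith
  have h1 := hasSum_lap (fun n => by fun_prop) (A_bound (E := E) (by linarith))
    ((hc_exp ha).mul_left 2) hz
  have h2 := (((hasSum_P (E := E) ha).mul_left (2 * z)).sub
    ((hasSum_P (E := E) (x := z) (by linarith)).mul_left (2 * a))).div_const (z ^ 2 - a ^ 2)
  refine h1.unique (h2.congr_fun fun n => ?_)
  have hl : 0 ≤ Real.log n := Real.log_natCast_nonneg n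
  have hE1 : ExpType a (fun u => Real.exp (-(a * |u - Real.log n|))) := by
    refine ⟨by fun_prop, 1, fun u => ?_⟩
    rw [abs_of_pos (Real.exp_pos _), one_mul, Real.exp_le_exp]
    have := mul_nonneg (by linarith : 0 ≤ a) (abs_nonneg (u - Real.log n))
    have := mul_nonneg (by linarith : 0 ≤ a) (abs_nonneg u)
    linarith
  have hE2 : ExpType a (fun u => Real.exp (-(a * |u|))) := by
    refine ⟨by fun_prop, 1, fun u => ?_⟩
    rw [abs_of_pos (Real.exp_pos _), one_mul, Real.exp_le_exp]
    have := mul_nonneg (by linarith : 0 ≤ a) (abs_nonneg u)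
    linarith
  rw [lap_const_mul, lap_add hz hE1 (hE2.const_mul _), lap_const_mul, lap_exp (by linarith),
    lap_exp_abs_sub (by linarith) hl hz]
  have e1 : z - a ≠ 0 := by linarith
  have e2 : z + a ≠ 0 := by linarith
  have e3 : z ^ 2 - a ^ 2 = (z - a) * (z + a) := by ring
  rw [e3]
  field_simp
  ring

lemma β_pos (j : E.κ) : 0 < E.β j := by
  rcases E.hβ j with h | h <;> rw [h] <;> norm_num

lemma nat_sub_ne {a : ℕ} (j : E.κ) (k : ℕ) : 1 / 2 ≤ |(a : ℝ) - (2 * k + E.β j)| := by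
  have key : ∀ p : ℤ, (1:ℝ) / 2 ≤ |(p : ℝ) - 1 / 2| := by
    intro p
    rcases le_or_gt p 0 with hp | hp
    · have : (p : ℝ) ≤ 0 := by exact_mod_cast hp
      rw [abs_of_nonpos (by linarith)]; linarith
    · have : (1 : ℝ) ≤ p := by exact_mod_cast hp
      rw [abs_of_nonneg (by linarith)]; linarith
  rcases E.hβ j with h | h <;> rw [h]
  · have := key (a - 2 * k)
    push_cast at this
    convert this using 2; ring
  · have := key (a - 2 * k - 1)
    push_cast at this
    convert this using 2; ring

lemma Q_coeff_bound {a : ℕ} (ha : 1 ≤ a) (j : E.κ) (k : ℕ) :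
    |2 * (a : ℝ) / (a + (2 * k + E.β j)) / (a - (2 * k + E.β j))|
      ≤ 2 * a * (4 * a + 4) * (1 / (((1:ℝ) + k) * (1 + k))) := by
  have hb := β_pos j
  have hb1 : 1 / 2 ≤ E.β j ∧ E.β j ≤ 3 / 2 := by rcases E.hβ j with h | h <;> rw [h] <;> norm_num
  have ha' : (1:ℝ) ≤ a := by exact_mod_cast ha
  have hk : (0:ℝ) ≤ k := k.cast_nonneg
  set b := 2 * (k:ℝ) + E.β j with hbdef
  have h1 := nat_sub_ne (a := a) j k
  rw [← hbdef] at h1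
  have h2 : (1:ℝ) + k ≤ a + b := by linarith
  have h3 : (1 + k) / (4 * a + 4 : ℝ) ≤ |(a:ℝ) - b| := by
    rw [div_le_iff₀ (by positivity)]
    rcases le_or_gt (2 * (a:ℝ)) b with hab | hab
    · rw [abs_of_nonpos (by linarith)]; nlinarith
    · nlinarith
  rw [abs_div, abs_of_nonneg (by positivity : 0 ≤ 2 * (a:ℝ) / (a + b)), div_div]
  calc 2 * (a:ℝ) / ((a + b) * |(a:ℝ) - b|) ≤ 2 * a / ((1 + k) * ((1 + k) / (4 * a + 4))) := by gcongr
    _ = _ := by field_simp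

lemma Q_bound {a : ℕ} (ha : 1 ≤ a) (j : E.κ) (k : ℕ) (u : ℝ) :
    |2 * (a : ℝ) / (a + (2 * k + E.β j)) / (a - (2 * k + E.β j)) *
      (Real.exp (-((2 * k + E.β j) * |u|)) + (-1) * Real.exp (-(a * |u|)))|
    ≤ 2 * a * (4 * a + 4) * (1 / (((1:ℝ) + k) * (1 + k))) * Real.exp (a * |u|) := by
  have hb := β_pos j
  rw [abs_mul]
  have h1 : |Real.exp (-((2 * k + E.β j) * |u|)) + (-1) * Real.exp (-((a:ℝ) * |u|))| ≤ Real.exp (a * |u|) := by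
    have e0 : (1:ℝ) ≤ Real.exp (a * |u|) := Real.one_le_exp (by positivity)
    have e1 : Real.exp (-((2 * k + E.β j) * |u|)) ≤ 1 := by
      rw [Real.exp_le_one_iff]
      have : 0 ≤ (2 * k + E.β j) * |u| := by positivity
      linarith
    have e2 : Real.exp (-((a:ℝ) * |u|)) ≤ 1 := by
      rw [Real.exp_le_one_iff]
      have : 0 ≤ (a:ℝ) * |u| := by positivity
      linarith
    have e3 := Real.exp_pos (-((2 * k + E.β j) * |u|))
    have e4 := Real.exp_pos (-((a:ℝ) * |u|))
    rw [abs_le]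
    constructor <;> linarith
  gcongr
  exact Q_coeff_bound ha j k

lemma Q_summable (a : ℝ) : Summable fun k : ℕ => 2 * a * (4 * a + 4) * (1 / (((1:ℝ) + k) * (1 + k))) :=
  (summable_inv_mul_inv one_pos one_pos).mul_left _

lemma expType_Q {a : ℕ} (ha : 1 ≤ a) : ExpType a (E.Q a) :=
  ExpType.sum _ fun j => expType_tsum (fun k => by fun_prop) (Q_bound ha j) (Q_summable _)

lemma lap_Q {a : ℕ} {z : ℝ} (ha : 1 ≤ a) (hz : a < z) :
    lap (E.Q a) z = 2 * a * (E.g z - E.g a) / (z ^ 2 - a ^ 2) := by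
  have ha' : (1:ℝ) ≤ a := by exact_mod_cast ha
  have h0 := lap_sum hz Finset.univ (F := fun (j : E.κ) u => ∑' k : ℕ,
    2 * (a:ℝ) / (a + (2 * k + E.β j)) / (a - (2 * k + E.β j)) *
    (Real.exp (-((2 * k + E.β j) * |u|)) + (-1) * Real.exp (-(a * |u|))))
    (fun j => expType_tsum (fun k => by fun_prop) (Q_bound ha j) (Q_summable _))
  refine h0.trans ?_
  have h1 : E.g z - E.g a
      = ∑ j, 1 / 2 * (realDigamma ((z + E.β j) / 2) - realDigamma ((a + E.β j) / 2)) := by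
    simp only [g, mul_sub, Finset.sum_sub_distrib]; ring
  rw [h1, Finset.mul_sum, Finset.sum_div]
  refine Finset.sum_congr rfl fun j _ => ?_
  have hb := β_pos j
  have h2 := hasSum_lap (fun k => by fun_prop) (Q_bound (E := E) ha j) (Q_summable _) hz
  have h3 := (((hasSum_realDigamma_sub (x := (z + E.β j) / 2) (y := (a + E.β j) / 2)
    (by linarith) (by linarith)).mul_left (1 / 2)).mul_left (2 * (a:ℝ))).div_const (z ^ 2 - a ^ 2)
  refine h2.unique (h3.congr_fun fun k => ?_)
  have hne := nat_sub_ne (a := a) j k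
  have hk : (0:ℝ) ≤ k := k.cast_nonneg
  have hE1 : ExpType a (fun u => Real.exp (-((2 * k + E.β j) * |u|))) := by
    refine ⟨by fun_prop, 1, fun u => ?_⟩
    rw [abs_of_pos (Real.exp_pos _), one_mul, Real.exp_le_exp]
    have := mul_nonneg (by linarith : (0:ℝ) ≤ a) (abs_nonneg u)
    have := mul_nonneg (by linarith : 0 ≤ 2 * (k:ℝ) + E.β j) (abs_nonneg u)
    linarith
  have hE2 : ExpType a (fun u => Real.exp (-((a:ℝ) * |u|))) := by
    refine ⟨by fun_prop, 1, fun u => ?_⟩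
    rw [abs_of_pos (Real.exp_pos _), one_mul, Real.exp_le_exp]
    have := mul_nonneg (by linarith : (0:ℝ) ≤ a) (abs_nonneg u)
    linarith
  rw [lap_const_mul, lap_add hz hE1 (hE2.const_mul _), lap_const_mul, lap_exp (by linarith),
    lap_exp (by linarith)]
  have e1 : z - a ≠ 0 := by linarith
  have e2 : z + a ≠ 0 := by linarith
  have e3 : z ^ 2 - (a:ℝ) ^ 2 = (z - a) * (z + a) := by ring
  have e4 : (a:ℝ) - (2 * k + E.β j) ≠ 0 := by
    intro h; rw [h] at hne; norm_num at hne
  have e5 : (a:ℝ) + (2 * k + E.β j) ≠ 0 := by linarith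
  have e6 : z + (2 * k + E.β j) ≠ 0 := by linarith
  have e7 : (z + E.β j) / 2 + k = (z + (2 * k + E.β j)) / 2 := by ring
  have e8 : (a + E.β j) / 2 + k = (a + (2 * k + E.β j)) / 2 := by ring
  have e9 : (z + E.β j) / 2 - (a + E.β j) / 2 = (z - a) / 2 := by ring
  rw [e3, e7, e8, e9]
  generalize 2 * (k:ℝ) + E.β j = b at *
  field_simp
  ring

/-- The smoothed explicit formula. -/
theorem explicit_formula {a : ℕ} (ha : 1 ≤ a) {u : ℝ} (hu : 0 < u) :
    E.S a u + E.A a u + E.Q a u = 2 * E.g a * Real.exp (-(a * u)) := by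
  have ha' : (1:ℝ) ≤ a := by exact_mod_cast ha
  have hE2 : ExpType a (fun u => Real.exp (-((a:ℝ) * |u|))) := by
    refine ⟨by fun_prop, 1, fun u => ?_⟩
    rw [abs_of_pos (Real.exp_pos _), one_mul, Real.exp_le_exp]
    have := mul_nonneg (by linarith : (0:ℝ) ≤ a) (abs_nonneg u)
    linarith
  have hS := expType_S (E := E) (a := a) (by linarith)
  have hA := expType_A (E := E) (a := a) (by linarith)
  have hQ := expType_Q (E := E) ha
  have hG := hE2.const_mul (-(2 * E.g a))
  obtain ⟨hcont, K, hK⟩ := ((hS.add hA).add hQ).add hG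
  have := eq_zero_of_laplace hcont hK (fun n hn => by
    have hn' : (a:ℝ) < n := by exact_mod_cast hn
    have h1 : lap _ n = _ := (lap_add hn' ((hS.add hA).add hQ) hG)
    rw [lap_add hn' (hS.add hA) hQ, lap_add hn' hS hA, lap_const_mul, lap_exp (by linarith),
      lap_S (by linarith) hn', lap_A (by linarith) hn', lap_Q ha hn', h_eq (by linarith),
      h_eq (by linarith)] at h1
    refine h1.trans ?_
    have e1 : (n:ℝ) - a ≠ 0 := by linarith
    have e2 : (n:ℝ) + a ≠ 0 := by linarith
    have e3 : (n:ℝ) ^ 2 - (a:ℝ) ^ 2 = (n - a) * (n + a) := by ring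
    rw [e3]
    field_simp
    ring) u hu
  simp only [abs_of_pos hu] at this
  linarith

lemma Q_nonneg {a : ℕ} {u : ℝ} : 0 ≤ E.Q a u := by
  refine Finset.sum_nonneg fun j _ => tsum_nonneg fun k => ?_
  have hb := β_pos j
  set b := 2 * (k:ℝ) + E.β j
  have hb0 : 0 < b := by positivity
  rw [div_mul_eq_mul_div, mul_div_assoc]
  refine mul_nonneg (by positivity) ?_
  rcases le_total b a with h | h
  · refine div_nonneg ?_ (by linarith)
    have : Real.exp (-(a * |u|)) ≤ Real.exp (-(b * |u|)) := by
      rw [Real.exp_le_exp]; nlinarith [abs_nonneg u]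
    linarith
  · refine div_nonneg_of_nonpos ?_ (by linarith)
    have : Real.exp (-(b * |u|)) ≤ Real.exp (-(a * |u|)) := by
      rw [Real.exp_le_exp]; nlinarith [abs_nonneg u]
    linarith

lemma S_le {a : ℕ} (ha : 1 ≤ a) {u : ℝ} (hu : 0 < u) :
    E.S a u ≤ |E.A a u| + 2 * |E.g a| * Real.exp (-(a * u)) := by
  have h1 := explicit_formula (E := E) ha hu
  have h2 := Q_nonneg (E := E) (a := a) (u := u)
  have h3 := neg_abs_le (E.A a u)
  have h4 : E.g a * Real.exp (-(a * u)) ≤ |E.g a| * Real.exp (-(a * u)) := by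
    gcongr; exact le_abs_self _
  linarith

end FormulaData

/-- The weight in the smoothed prime sum, as a function of `log n`. -/
noncomputable def peak (a u l : ℝ) : ℝ := Real.exp (-(l / 2) - a * |u - l|)

lemma peak_le {a u : ℝ} (ha : 1 / 2 ≤ a) (l : ℝ) : peak a u l ≤ Real.exp (-(u / 2)) := by
  rw [peak, Real.exp_le_exp]
  have := le_abs_self (u - l)
  have := abs_nonneg (u - l)
  nlinarith

lemma peak_mono {a u l l' : ℝ} (ha : 1 / 2 ≤ a) (h : l ≤ l') (h' : l' ≤ u) :
    peak a u l ≤ peak a u l' := by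
  rw [peak, peak, Real.exp_le_exp, abs_of_nonneg (by linarith), abs_of_nonneg (by linarith)]
  nlinarith

lemma peak_anti {a u l l' : ℝ} (ha : 0 ≤ a) (h : l ≤ l') (h' : u ≤ l) :
    peak a u l' ≤ peak a u l := by
  rw [peak, peak, Real.exp_le_exp, abs_of_nonpos (by linarith), abs_of_nonpos (by linarith)]
  nlinarith

lemma peak_telescope {a u l l' : ℝ} (ha : 4 ≤ a) (h : l ≤ l') (h' : u ≤ l) :
    Real.exp (2 * l) * (peak a u l - peak a u l')
      ≤ 2 * (Real.exp (2 * l) * peak a u l - Real.exp (2 * l') * peak a u l') := by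
  rw [peak, peak, abs_of_nonpos (by linarith), abs_of_nonpos (by linarith)]
  set d := l' - l with hd
  have e1 : Real.exp (-(l' / 2) - a * -(u - l'))
      = Real.exp (-(l / 2) - a * -(u - l)) * Real.exp (-((a + 1 / 2) * d)) := by
    rw [← Real.exp_add]; congr 1; rw [hd]; ring
  have e2 : Real.exp (2 * l') = Real.exp (2 * l) * Real.exp (2 * d) := by
    rw [← Real.exp_add]; congr 1; rw [hd]; ring
  have e3 : Real.exp (-((a + 1 / 2) * d)) = Real.exp (-((a + 1 / 2) / 2 * d)) ^ 2 := by
    rw [← Real.exp_nat_mul]; congr 1; push_cast; ring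
  have e4 : Real.exp (2 * d) * Real.exp (-((a + 1 / 2) * d)) ≤ Real.exp (-((a + 1 / 2) / 2 * d)) := by
    rw [← Real.exp_add, Real.exp_le_exp]
    have : 0 ≤ d := by linarith
    nlinarith
  have e5 := sq_nonneg (1 - Real.exp (-((a + 1 / 2) / 2 * d)))
  rw [e1, e2]
  set p := Real.exp (2 * l)
  set w := Real.exp (-(l / 2) - a * -(u - l))
  have hpw : 0 < p * w := by positivity
  have : 0 ≤ p * w * (1 + Real.exp (-((a + 1 / 2) * d))
      - 2 * (Real.exp (2 * d) * Real.exp (-((a + 1 / 2) * d)))) := by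
    refine mul_nonneg hpw.le ?_
    rw [e3] at *
    nlinarith
  nlinarith

/-- Discrete partial summation against the peaked weight. -/
lemma abs_sum_peak_le {c : ℕ → ℝ} (hc0 : c 0 = 0) {a u L : ℝ} (ha : 4 ≤ a) (hu : 0 ≤ u)
    (hL : 0 ≤ L)
    (h1 : ∀ n : ℕ, 1 ≤ n → Real.log n ≤ u → |∑ k ∈ Finset.range (n + 1), c k| ≤ L * Real.exp (u / 2))
    (h2 : ∀ n : ℕ, 1 ≤ n → u ≤ Real.log n → |∑ k ∈ Finset.range (n + 1), c k|
      ≤ L * (Real.exp (2 * Real.log n) * Real.exp (-(3 / 2 * u)))) :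
    ∀ᶠ K : ℕ in atTop, |∑ k ∈ Finset.range K, c k * peak a u (Real.log k)| ≤ 10 * L := by
  set w : ℕ → ℝ := fun n => peak a u (Real.log n) with hw
  set Cs : ℕ → ℝ := fun n => ∑ k ∈ Finset.range (n + 1), c k with hCs
  set T : ℕ → ℝ := fun n => ∑ k ∈ Finset.range (n + 1), c k * w k with hT
  set R : ℕ → ℝ := fun n => T n - Cs n * w (n + 1) with hR
  have hw0 : ∀ n, 0 < w n := fun n => Real.exp_pos _
  have hlog : ∀ {n k : ℕ}, 1 ≤ n → n ≤ k → Real.log n ≤ Real.log k := fun hn hk =>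
    Real.log_le_log (by exact_mod_cast hn) (by exact_mod_cast hk)
  have hstep : ∀ n, R (n + 1) = R n + Cs (n + 1) * (w (n + 1) - w (n + 2)) := by
    intro n
    simp only [hR, hT, hCs, Finset.sum_range_succ _ (n + 1)]
    ring
  have hα : ∀ K : ℕ, Real.log (K + 1 : ℕ) ≤ u → |R K| ≤ L * Real.exp (u / 2) * w (K + 1) := by
    intro K
    induction K with
    | zero =>
      intro _
      have : R 0 = 0 := by simp [hR, hT, hCs, hc0]
      rw [this, abs_zero]
      have := hw0 (0 + 1)
      positivity
    | succ K ih =>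
      intro hK
      have hK' : Real.log (K + 1 : ℕ) ≤ u := (hlog (by omega) (by omega)).trans hK
      have i1 := ih hK'
      have i2 := h1 (K + 1) (by omega) hK'
      have i3 : w (K + 1) ≤ w (K + 2) := peak_mono (by linarith) (hlog (by omega) (by omega)) hK
      rw [hstep]
      have i4 : |Cs (K + 1) * (w (K + 1) - w (K + 2))|
          ≤ L * Real.exp (u / 2) * (w (K + 2) - w (K + 1)) := by
        rw [abs_mul, abs_sub_comm, abs_of_nonneg (sub_nonneg.mpr i3)]
        exact mul_le_mul_of_nonneg_right i2 (sub_nonneg.mpr i3)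
      refine (abs_add_le _ _).trans ?_
      have : w (K + 1 + 1) = w (K + 2) := rfl
      rw [this]
      nlinarith
  set N := ⌊Real.exp u⌋₊ with hN
  have hN1 : 1 ≤ N := Nat.le_floor (by simpa using hu)
  have hNu : Real.log N ≤ u := by
    rw [Real.log_le_iff_le_exp (by exact_mod_cast hN1)]
    exact Nat.floor_le (Real.exp_pos u).le
  have huN : u ≤ Real.log (N + 1 : ℕ) := by
    rw [Real.le_log_iff_exp_le (by positivity)]
    push_cast
    exact (Nat.lt_floor_add_one _).le
  have hee : Real.exp (u / 2) * Real.exp (-(u / 2)) = 1 := by rw [← Real.exp_add]; simp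
  have hRN : |R N| ≤ 2 * L := by
    obtain ⟨K, hK⟩ : ∃ K, N = K + 1 := ⟨N - 1, by omega⟩
    have i1 := hα K (by rw [← hK]; exact hNu)
    have i2 := h1 N hN1 hNu
    have i3 : w N ≤ Real.exp (-(u / 2)) := peak_le (by linarith) _
    have i4 : w (N + 1) ≤ Real.exp (-(u / 2)) := peak_le (by linarith) _
    have i5 : |w N - w (N + 1)| ≤ Real.exp (-(u / 2)) :=
      abs_sub_le_of_nonneg_of_le (hw0 _).le i3 (hw0 _).le i4
    rw [hK, hstep, ← hK]
    rw [show K + 2 = N + 1 by omega]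
    have i6 : L * Real.exp (u / 2) * w N ≤ L := by
      calc _ ≤ L * Real.exp (u / 2) * Real.exp (-(u / 2)) := by gcongr
        _ = L := by rw [mul_assoc, hee, mul_one]
    have i7 : |Cs N * (w N - w (N + 1))| ≤ L := by
      rw [abs_mul]
      calc _ ≤ L * Real.exp (u / 2) * Real.exp (-(u / 2)) := by gcongr
        _ = L := by rw [mul_assoc, hee, mul_one]
    rw [← hK] at i1
    refine (abs_add_le _ _).trans ?_
    linarith
  set e : ℕ → ℝ := fun n => Real.exp (2 * Real.log n) with he
  set q := L * Real.exp (-(3 / 2 * u)) with hq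
  have hq0 : 0 ≤ q := by positivity
  have hβ : ∀ j : ℕ, |R (N + j)| ≤ 2 * L + 2 * q * (e (N + 1) * w (N + 1) - e (N + j + 1) * w (N + j + 1)) := by
    intro j
    induction j with
    | zero => simpa using hRN
    | succ j ih =>
      have hu' : u ≤ Real.log (N + j + 1 : ℕ) := huN.trans (hlog (by omega) (by omega))
      have hl := hlog (n := N + j + 1) (k := N + j + 2) (by omega) (by omega)
      have i1 : w (N + j + 2) ≤ w (N + j + 1) := peak_anti (by linarith) hl hu'
      have i2 : e (N + j + 1) * (w (N + j + 1) - w (N + j + 2))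
          ≤ 2 * (e (N + j + 1) * w (N + j + 1) - e (N + j + 2) * w (N + j + 2)) :=
        peak_telescope ha hl hu'
      have i3 := h2 (N + j + 1) (by omega) hu'
      rw [show N + (j + 1) = N + j + 1 by ring, hstep]
      have i4 : |Cs (N + j + 1) * (w (N + j + 1) - w (N + j + 2))|
          ≤ q * (e (N + j + 1) * (w (N + j + 1) - w (N + j + 2))) := by
        rw [abs_mul, abs_of_nonneg (sub_nonneg.mpr i1)]
        calc _ ≤ L * (e (N + j + 1) * Real.exp (-(3 / 2 * u))) * (w (N + j + 1) - w (N + j + 2)) :=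
              mul_le_mul_of_nonneg_right i3 (sub_nonneg.mpr i1)
          _ = _ := by rw [hq]; ring
      have i5 := mul_le_mul_of_nonneg_left i2 hq0
      refine (abs_add_le _ _).trans ?_
      have : N + j + 1 + 1 = N + j + 2 := rfl
      rw [this]
      nlinarith
  have hfin : q * (e (N + 1) * w (N + 1)) ≤ 4 * L := by
    have i4 : w (N + 1) ≤ Real.exp (-(u / 2)) := peak_le (by linarith) _
    have i5 : e (N + 1) ≤ 4 * Real.exp (2 * u) := by
      have : Real.log (N + 1 : ℕ) ≤ Real.log 2 + u := by
        rw [show Real.log 2 + u = Real.log (2 * Real.exp u) by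
          rw [Real.log_mul (by norm_num) (Real.exp_pos u).ne', Real.log_exp]]
        refine Real.log_le_log (by positivity) ?_
        have i6 : (N : ℝ) ≤ Real.exp u := Nat.floor_le (Real.exp_pos u).le
        have i7 : (1 : ℝ) ≤ Real.exp u := Real.one_le_exp hu
        push_cast; linarith
      calc e (N + 1) ≤ Real.exp (2 * (Real.log 2 + u)) := by
            simp only [he]; gcongr
        _ = Real.exp (Real.log 2) ^ 2 * Real.exp (2 * u) := by
            rw [← Real.exp_nat_mul, ← Real.exp_add]; congr 1; push_cast; ring
        _ = _ := by rw [Real.exp_log (by norm_num)]; norm_num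
    calc q * (e (N + 1) * w (N + 1)) ≤ q * (4 * Real.exp (2 * u) * Real.exp (-(u / 2))) := by
          have := (hw0 (N + 1)).le
          gcongr
      _ = 4 * L * (Real.exp (-(3 / 2 * u)) * Real.exp (2 * u) * Real.exp (-(u / 2))) := by
          rw [hq]; ring
      _ = 4 * L := by
          rw [← Real.exp_add, ← Real.exp_add]; ring_nf; simp
  filter_upwards [eventually_ge_atTop (N + 2)] with K hK
  obtain ⟨j, hj⟩ : ∃ j, K = N + j + 1 := ⟨K - N - 1, by omega⟩
  have hj1 : 1 ≤ j := by omega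
  have i1 := hβ j
  have hu' : u ≤ Real.log (N + j : ℕ) := huN.trans (hlog (by omega) (by omega))
  have i2 := h2 (N + j) (by omega) hu'
  have hTK : ∑ k ∈ Finset.range K, c k * peak a u (Real.log k)
      = R (N + j) + Cs (N + j) * w (N + j + 1) := by
    rw [hj]; simp only [hR, hT, hw]; ring
  have i3 : |Cs (N + j) * w (N + j + 1)| ≤ q * (e (N + j + 1) * w (N + j + 1)) := by
    rw [abs_mul, abs_of_pos (hw0 _)]
    have i4 : e (N + j) ≤ e (N + j + 1) := by
      simp only [he]
      have := hlog (n := N + j) (k := N + j + 1) (by omega) (by omega)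
      gcongr
    calc _ ≤ L * (e (N + j) * Real.exp (-(3 / 2 * u))) * w (N + j + 1) :=
          mul_le_mul_of_nonneg_right i2 (hw0 _).le
      _ = q * (e (N + j) * w (N + j + 1)) := by rw [hq]; ring
      _ ≤ _ := by
        have := (hw0 (N + j + 1)).le
        gcongr
  have i5 : 0 ≤ q * (e (N + j + 1) * w (N + j + 1)) :=
    mul_nonneg hq0 (mul_nonneg (Real.exp_pos _).le (hw0 _).le)
  rw [hTK]
  refine (abs_add_le _ _).trans ?_
  nlinarith

/-- The iterated logarithm `log log log x` in terms of `u = log x`, shifted so as to be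
nonnegative for `u ≥ 0`. -/
noncomputable def lll (u : ℝ) : ℝ := Real.log (1 + Real.log (1 + u))

lemma log_add_le {x d : ℝ} (hx : 1 ≤ x) (hd : 0 ≤ d) : Real.log (x + d) ≤ Real.log x + d := by
  have h0 : 0 < x := by linarith
  rw [show x + d = x * (1 + d / x) by field_simp, Real.log_mul h0.ne' (by positivity)]
  have h1 := Real.log_le_sub_one_of_pos (x := 1 + d / x) (by positivity)
  have h2 : d / x ≤ d := div_le_self hd hx
  linarith

lemma lll_mono {u v : ℝ} (hu : 0 ≤ u) (h : u ≤ v) : lll u ≤ lll v := by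
  have h0 : 0 ≤ Real.log (1 + u) := Real.log_nonneg (by linarith)
  have h1 : Real.log (1 + u) ≤ Real.log (1 + v) := Real.log_le_log (by linarith) (by linarith)
  exact Real.log_le_log (by linarith) (by linarith)

lemma lll_nonneg {u : ℝ} (hu : 0 ≤ u) : 0 ≤ lll u := by
  have h0 : 0 ≤ Real.log (1 + u) := Real.log_nonneg (by linarith)
  exact Real.log_nonneg (by linarith)

lemma lll_add_le {u d : ℝ} (hu : 0 ≤ u) (hd : 0 ≤ d) : lll (u + d) ≤ lll u + d := by
  have h0 : 0 ≤ Real.log (1 + u) := Real.log_nonneg (by linarith)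
  have h1 : Real.log (1 + (u + d)) ≤ Real.log (1 + u) + d := by
    rw [← add_assoc]; exact log_add_le (by linarith) hd
  have h2 : 0 ≤ Real.log (1 + (u + d)) := Real.log_nonneg (by linarith)
  calc lll (u + d) ≤ Real.log (1 + Real.log (1 + u) + d) :=
        Real.log_le_log (by linarith) (by linarith)
    _ ≤ _ := log_add_le (by linarith) hd

lemma sqrt_natCast_eq_exp {n : ℕ} (hn : 1 ≤ n) : √(n : ℝ) = Real.exp (Real.log n / 2) := by
  have : (0:ℝ) < n := by exact_mod_cast hn
  rw [Real.exp_half, Real.exp_log this]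

namespace FormulaData
variable {E : FormulaData}

lemma abs_A_le {C B : ℝ} (hC : 0 ≤ C) (hB : 0 ≤ B)
    (hsum : ∀ n : ℕ, 1 ≤ n → |∑ k ∈ Finset.range (n + 1), E.c k| ≤ √(n : ℝ) * (C + B * lll (Real.log n)))
    {a u : ℝ} (ha : 4 ≤ a) (hu : 0 ≤ u) :
    |E.A a u| ≤ 10 * (C + B * lll u + B)
      + ∑' n : ℕ, |E.c n| * (n : ℝ) ^ (-(1 / 2) : ℝ) * Real.exp (-(1 * Real.log n)) := by
  set L := C + B * lll u + B with hL
  have hl0 := lll_nonneg hu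
  have hL0 : 0 ≤ L := by positivity
  have hpk : ∀ n : ℕ, E.c n * (n : ℝ) ^ (-(1 / 2) : ℝ) * Real.exp (-(a * |u - Real.log n|))
      = E.c n * peak a u (Real.log n) := by
    intro n
    rcases eq_or_ne n 0 with rfl | hn
    · simp [E.hc₀]
    · have : (0:ℝ) < n := by positivity
      rw [Real.rpow_def_of_pos this, mul_assoc, ← Real.exp_add, peak]
      congr 2; ring
  have hsumm := hc_exp (E := E) (x := 1) (by norm_num)
  have hl : ∀ n : ℕ, 0 ≤ Real.log n := fun n => Real.log_natCast_nonneg n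
  have hs2 : Summable fun n : ℕ => E.c n * (n : ℝ) ^ (-(1 / 2) : ℝ) *
      (Real.exp (-(a * Real.log n)) * Real.exp (-(a * |u|))) := by
    refine Summable.of_norm_bounded hsumm fun n => ?_
    rw [norm_mul, norm_mul, Real.norm_eq_abs, Real.norm_of_nonneg (by positivity),
      Real.norm_of_nonneg (by positivity)]
    refine mul_le_mul_of_nonneg_left ?_ (by positivity)
    rw [← Real.exp_add, Real.exp_le_exp]
    have := hl n
    have := mul_nonneg (by linarith : 0 ≤ a) (abs_nonneg u)
    nlinarith
  have hb2 : |∑' n : ℕ, E.c n * (n : ℝ) ^ (-(1 / 2) : ℝ) *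
      (Real.exp (-(a * Real.log n)) * Real.exp (-(a * |u|)))|
      ≤ ∑' n : ℕ, |E.c n| * (n : ℝ) ^ (-(1 / 2) : ℝ) * Real.exp (-(1 * Real.log n)) := by
    rw [← Real.norm_eq_abs]
    refine tsum_of_norm_bounded hsumm.hasSum fun n => ?_
    rw [norm_mul, norm_mul, Real.norm_eq_abs, Real.norm_of_nonneg (by positivity),
      Real.norm_of_nonneg (by positivity)]
    refine mul_le_mul_of_nonneg_left ?_ (by positivity)
    rw [← Real.exp_add, Real.exp_le_exp]
    have := hl n
    have := mul_nonneg (by linarith : 0 ≤ a) (abs_nonneg u)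
    nlinarith
  have hs0 : Summable fun n : ℕ => E.c n * (n : ℝ) ^ (-(1 / 2) : ℝ) *
    (Real.exp (-(a * |u - Real.log n|)) + Real.exp (-(a * Real.log n)) * Real.exp (-(a * |u|))) :=
    Summable.of_norm_bounded (((hc_exp (E := E) (x := a) (by linarith)).mul_left 2).mul_right _)
      (fun n => A_bound (E := E) (by linarith) n u)
  have hs1 : Summable fun n : ℕ => E.c n * peak a u (Real.log n) := by
    refine (hs0.sub hs2).congr fun n => ?_
    rw [← hpk]; ring
  have hA : E.A a u = ∑' n : ℕ, E.c n * peak a u (Real.log n) + ∑' n : ℕ, E.c n *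
      (n : ℝ) ^ (-(1 / 2) : ℝ) * (Real.exp (-(a * Real.log n)) * Real.exp (-(a * |u|))) := by
    rw [← hs1.tsum_add hs2, A]
    refine tsum_congr fun n => ?_
    rw [← hpk]; ring
  have hb1 : |∑' n : ℕ, E.c n * peak a u (Real.log n)| ≤ 10 * L := by
    refine le_of_tendsto (hs1.hasSum.tendsto_sum_nat.abs) ?_
    refine abs_sum_peak_le E.hc₀ ha hu hL0 (fun n hn hnu => ?_) (fun n hn hnu => ?_)
    · refine (hsum n hn).trans ?_
      rw [sqrt_natCast_eq_exp hn, mul_comm]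
      have h1 := lll_mono (hl n) hnu
      have h2 : C + B * lll (Real.log n) ≤ L := by
        have := mul_le_mul_of_nonneg_left h1 hB
        linarith
      gcongr
    · refine (hsum n hn).trans ?_
      rw [sqrt_natCast_eq_exp hn]
      set d := Real.log n - u with hd
      have hd0 : 0 ≤ d := by linarith
      have h1 := lll_add_le hu hd0
      rw [show u + d = Real.log n by rw [hd]; ring] at h1
      have h2 : Real.exp (2 * Real.log n) * Real.exp (-(3 / 2 * u))
          = Real.exp (Real.log n / 2) * Real.exp (3 / 2 * d) := by
        rw [← Real.exp_add, ← Real.exp_add]; congr 1; rw [hd]; ring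
      rw [h2, mul_left_comm]
      refine mul_le_mul_of_nonneg_left ?_ (Real.exp_pos _).le
      have h3 := Real.add_one_le_exp (3 / 2 * d)
      have h4 := mul_le_mul_of_nonneg_left h1 hB
      have h5 := mul_le_mul_of_nonneg_left h3 hL0
      have h6 : B * d ≤ L * (3 / 2 * d) := by
        have : B ≤ L := by rw [hL]; have := mul_nonneg hB hl0; linarith
        nlinarith
      rw [hL] at *
      linarith
  rw [hA]
  exact (abs_add_le _ _).trans (by linarith)

end FormulaData

/-- Simultaneous Dirichlet approximation. -/
lemma exists_cos_ge (ι : Type) (F : Finset ι) (γ : ι → ℝ) :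
    ∃ n : ℕ, 1 ≤ n ∧ n ≤ 10 ^ F.card ∧ ∀ i ∈ F, 4 / 5 ≤ Real.cos (γ i * n) := by
  set fr : ℕ → F → ℝ := fun k i => Int.fract (γ i * k / (2 * π)) with hfr
  set f : ℕ → (F → Fin 10) := fun k i => ⟨⌊10 * fr k i⌋₊, by
    rw [Nat.floor_lt (by have := Int.fract_nonneg (γ i * k / (2 * π)); positivity)]
    have := Int.fract_lt_one (γ i * k / (2 * π))
    push_cast
    simp only [hfr]
    linarith⟩ with hf
  obtain ⟨k, hk, l, hl, hkl, hfkl⟩ := Finset.exists_ne_map_eq_of_card_lt_of_maps_to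
    (s := Finset.range (10 ^ F.card + 1)) (t := (Finset.univ : Finset (F → Fin 10)))
    (f := f) (by simp) (fun _ _ => Finset.mem_univ _)
  wlog hlt : k < l generalizing k l
  · exact this l hl k hk hkl.symm hfkl.symm (by omega)
  rw [Finset.mem_range] at hk hl
  refine ⟨l - k, by omega, by omega, fun i hi => ?_⟩
  have h1 : ⌊10 * fr k ⟨i, hi⟩⌋₊ = ⌊10 * fr l ⟨i, hi⟩⌋₊ := by
    have := congrArg Fin.val (congrFun hfkl ⟨i, hi⟩)
    simpa [hf] using this
  have hn : ∀ k, 0 ≤ 10 * fr k ⟨i, hi⟩ := fun k => by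
    have := Int.fract_nonneg (γ i * k / (2 * π))
    simp only [hfr]; positivity
  have h2 := Nat.floor_le (hn k)
  have h3 := Nat.floor_le (hn l)
  have h4 := Nat.lt_floor_add_one (10 * fr k ⟨i, hi⟩)
  have h5 := Nat.lt_floor_add_one (10 * fr l ⟨i, hi⟩)
  rw [h1] at h2 h4
  set δ := fr l ⟨i, hi⟩ - fr k ⟨i, hi⟩ with hδ
  have h6 : |δ| ≤ 1 / 10 := by rw [abs_le]; constructor <;> linarith
  have h7 : γ i * (l - k : ℕ) = 2 * π * δ
      + (⌊γ i * l / (2 * π)⌋ - ⌊γ i * k / (2 * π)⌋ : ℤ) * (2 * π) := by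
    have e1 := Int.self_sub_floor (γ i * l / (2 * π))
    have e2 := Int.self_sub_floor (γ i * k / (2 * π))
    rw [hδ]
    simp only [hfr]
    rw [← e1, ← e2, Nat.cast_sub hlt.le]
    push_cast
    field_simp
    ring
  rw [h7, Real.cos_add_int_mul_two_pi]
  have h8 := Real.one_sub_sq_div_two_le_cos (x := 2 * π * δ)
  have h9 : δ ^ 2 ≤ (1 / 10) ^ 2 := sq_le_sq' (by linarith [abs_le.mp h6]) (by linarith [abs_le.mp h6])
  have h10 : π ^ 2 ≤ 3.15 ^ 2 := by
    have := Real.pi_lt_d2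
    have := Real.pi_pos
    gcongr
  have h11 : (2 * π * δ) ^ 2 ≤ 4 * 3.15 ^ 2 * (1 / 10) ^ 2 := by
    rw [mul_pow, mul_pow]
    norm_num at *
    nlinarith [sq_nonneg δ, sq_nonneg π]
  norm_num at h11
  linarith

namespace FormulaData
variable {E : FormulaData}

lemma exists_h_bounds (E : FormulaData) : ∃ C : ℝ, 0 ≤ C ∧ ∀ x : ℝ, 1 ≤ x →
    |E.g x - Fintype.card E.κ / 2 * Real.log x| ≤ C ∧
    |E.h x - Fintype.card E.κ / 2 * Real.log x| ≤ C := by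
  set P1 := ∑' n : ℕ, |E.c n| * (n : ℝ) ^ (-(1 / 2) : ℝ) * Real.exp (-(1 * Real.log n)) with hP1
  have hP : ∀ x : ℝ, 1 ≤ x → |E.P x| ≤ P1 := by
    intro x hx
    rw [← (hasSum_P (E := E) (x := x) (by linarith)).tsum_eq, ← Real.norm_eq_abs]
    refine tsum_of_norm_bounded (hc_exp (E := E) (x := 1) (by norm_num)).hasSum fun n => ?_
    rw [norm_mul, norm_mul, Real.norm_eq_abs, Real.norm_of_nonneg (by positivity),
      Real.norm_of_nonneg (by positivity)]
    have := Real.log_natCast_nonneg n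
    gcongr
  have hP0 : 0 ≤ P1 := tsum_nonneg fun n => by positivity
  have hd : ∀ x : ℝ, 1 ≤ x → ∀ j : E.κ,
      |1 / 2 * realDigamma ((x + E.β j) / 2) - 1 / 2 * Real.log x| ≤ 3 := by
    intro x hx j
    have hb := β_pos j
    have hb1 : 1 / 2 ≤ E.β j ∧ E.β j ≤ 3 / 2 := by
      rcases E.hβ j with h | h <;> rw [h] <;> norm_num
    have h0 : 0 < (x + E.β j) / 2 := by positivity
    have h1 := realDigamma_le_log h0
    have h2 := log_sub_inv_le_realDigamma h0
    have h3 : Real.log ((x + E.β j) / 2) ≤ Real.log x + 1 := by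
      have : Real.log ((x + E.β j) / 2) ≤ Real.log (x + 1) := Real.log_le_log h0 (by linarith)
      exact this.trans (log_add_le hx zero_le_one)
    have h4 : Real.log x - 1 ≤ Real.log ((x + E.β j) / 2) := by
      have : Real.log (x / 2) ≤ Real.log ((x + E.β j) / 2) :=
        Real.log_le_log (by linarith) (by linarith)
      rw [Real.log_div (by linarith) (by norm_num)] at this
      linarith [Real.log_two_lt_d9]
    have h5 : 1 / ((x + E.β j) / 2) ≤ 4 := by
      rw [div_le_iff₀ h0]; linarith
    rw [abs_le]
    constructor <;> linarith
  have hg : ∀ x : ℝ, 1 ≤ x → |E.g x - Fintype.card E.κ / 2 * Real.log x|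
      ≤ |E.C₀| + Fintype.card E.κ * 3 := by
    intro x hx
    have e : E.g x - Fintype.card E.κ / 2 * Real.log x
        = E.C₀ + ∑ j, (1 / 2 * realDigamma ((x + E.β j) / 2) - 1 / 2 * Real.log x) := by
      rw [g, Finset.sum_sub_distrib, Finset.sum_const, Finset.card_univ, nsmul_eq_mul]; ring
    rw [e]
    refine (abs_add_le _ _).trans (add_le_add le_rfl ?_)
    refine (Finset.abs_sum_le_sum_abs _ _).trans ?_
    refine (Finset.sum_le_sum fun j _ => hd x hx j).trans ?_
    rw [Finset.sum_const, Finset.card_univ, nsmul_eq_mul]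
  refine ⟨|E.C₀| + Fintype.card E.κ * 3 + P1, by positivity, fun x hx => ⟨?_, ?_⟩⟩
  · linarith [hg x hx]
  · rw [h_eq (by linarith), sub_right_comm]
    exact (abs_sub _ _).trans (add_le_add (hg x hx) (hP x hx))

lemma card_le (hm1 : ∀ i, 1 ≤ E.m i) {T : ℝ} (hT : 1 ≤ T) (F : Finset E.ι)
    (hF : ∀ i ∈ F, |E.γ i| ≤ T) : (F.card : ℝ) ≤ 2 * T * E.h T := by
  have h1 := sum_le_hasSum F (fun i _ => by have := E.hm i; positivity)
    (hasSum_h (E := E) (x := T) (by linarith))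
  have h2 : ∑ i ∈ F, 1 / (2 * T) ≤ ∑ i ∈ F, E.m i * (T / (T ^ 2 + E.γ i ^ 2)) := by
    refine Finset.sum_le_sum fun i hi => ?_
    have h3 : E.γ i ^ 2 ≤ T ^ 2 := by
      rw [← sq_abs (E.γ i)]
      have := hF i hi
      gcongr
    have h4 : 1 / (2 * T) ≤ T / (T ^ 2 + E.γ i ^ 2) := by
      rw [div_le_div_iff₀ (by positivity) (by positivity)]; nlinarith
    have h5 := hm1 i
    have h6 : 0 ≤ T / (T ^ 2 + E.γ i ^ 2) := by positivity
    nlinarith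
  rw [Finset.sum_const, nsmul_eq_mul, mul_one_div] at h2
  have h3 := h2.trans h1
  rwa [div_le_iff₀ (by positivity), mul_comm] at h3

lemma finite_gamma_le (hm1 : ∀ i, 1 ≤ E.m i) {T : ℝ} (hT : 1 ≤ T) :
    {i | |E.γ i| ≤ T}.Finite := by
  by_contra hinf
  obtain ⟨F, hF, hc⟩ := Set.Infinite.exists_subset_card_eq hinf (⌈2 * T * E.h T⌉₊ + 1)
  have h1 := card_le hm1 hT F (fun i hi => hF hi)
  rw [hc] at h1
  have := Nat.le_ceil (2 * T * E.h T)
  push_cast at h1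
  linarith

lemma exists_S_ge (hm1 : ∀ i, 1 ≤ E.m i) {a : ℝ} (ha : 1 ≤ a) :
    ∃ n : ℕ, 1 ≤ n ∧ (Real.log n ≤ 2 * (32 * a) * E.h (32 * a) * Real.log 10) ∧
      8 / 5 * E.h a - 9 / 40 * E.h (32 * a) ≤ E.S a n := by
  have hfin := finite_gamma_le hm1 (T := 32 * a) (by linarith)
  obtain ⟨n, hn1, hn2, hn3⟩ := exists_cos_ge E.ι hfin.toFinset E.γ
  refine ⟨n, hn1, ?_, ?_⟩
  · have h1 := card_le hm1 (T := 32 * a) (by linarith) hfin.toFinset (fun i hi => by simpa using hi)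
    have h2 : Real.log n ≤ hfin.toFinset.card * Real.log 10 := by
      rw [← Real.log_pow]
      exact Real.log_le_log (by exact_mod_cast hn1) (by exact_mod_cast hn2)
    refine h2.trans ?_
    have : 0 ≤ Real.log 10 := Real.log_nonneg (by norm_num)
    gcongr
  · have hs1 := hasSum_h (E := E) (x := a) (by linarith)
    have hs2 := hasSum_h (E := E) (x := 32 * a) (by linarith)
    have hs3 : Summable fun i => E.m i * (2 * a / (a ^ 2 + E.γ i ^ 2)) * Real.cos (E.γ i * n) :=
      Summable.of_norm_bounded ((summable_m (E := E) (a := a) (by linarith)).mul_right _)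
        (fun i => S_bound (E := E) (by linarith) i n)
    refine hasSum_le (fun i => ?_) ((hs1.mul_left (8 / 5)).sub (hs2.mul_left (9 / 40))) hs3.hasSum
    have h0 := E.hm i
    have ha0 : 0 < a := by linarith
    set f := E.m i * (2 * a / (a ^ 2 + E.γ i ^ 2)) with hf
    have hf0 : 0 ≤ f := by positivity
    have e1 : E.m i * (a / (a ^ 2 + E.γ i ^ 2)) = f / 2 := by rw [hf]; ring
    have hg0 : 0 ≤ E.m i * (32 * a / ((32 * a) ^ 2 + E.γ i ^ 2)) := by positivity
    rw [e1]
    by_cases hi : |E.γ i| ≤ 32 * a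
    · have := hn3 i (by simpa using hi)
      have := mul_le_mul_of_nonneg_left this hf0
      linarith
    · push Not at hi
      have h1 := Real.neg_one_le_cos (E.γ i * n)
      have h2 := mul_le_mul_of_nonneg_left h1 hf0
      have h3 : (32 * a) ^ 2 ≤ E.γ i ^ 2 := by
        rw [← sq_abs (E.γ i)]; gcongr
      have h4 : 2 * a / (a ^ 2 + E.γ i ^ 2)
          ≤ 1 / 8 * (32 * a / ((32 * a) ^ 2 + E.γ i ^ 2)) := by
        rw [mul_div_assoc', div_le_div_iff₀ (by positivity) (by positivity)]
        nlinarith [sq_nonneg a]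
      have h5 : f ≤ 1 / 8 * (E.m i * (32 * a / ((32 * a) ^ 2 + E.γ i ^ 2))) := by
        rw [hf, mul_left_comm]
        exact mul_le_mul_of_nonneg_left h4 h0
      linarith

/-- A power-saving-free bound `√n (C + B log log log n)` on the coefficient sums forces `B` to be
at least a fixed multiple of the number of gamma factors. -/
theorem card_le_of_partial_sums (E : FormulaData) (hm1 : ∀ i, 1 ≤ E.m i) {C B : ℝ} (hC : 0 ≤ C)
    (hB : 0 ≤ B) (hsum : ∀ n : ℕ, 1 ≤ n →
      |∑ k ∈ Finset.range (n + 1), E.c k| ≤ √(n : ℝ) * (C + B * lll (Real.log n))) :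
    (Fintype.card E.κ : ℝ) ≤ 100 * B := by
  obtain ⟨H, hH0, hH⟩ := exists_h_bounds E
  set k := (Fintype.card E.κ : ℝ) with hk
  have hk0 : 0 ≤ k := by positivity
  set P1 := ∑' n : ℕ, |E.c n| * (n : ℝ) ^ (-(1 / 2) : ℝ) * Real.exp (-(1 * Real.log n)) with hP1
  -- eventual smallness of the number of zeros
  have hev : ∀ᶠ a : ℕ in atTop, 2 * (32 * (a:ℝ)) * (k / 2 * Real.log (32 * a) + H) * Real.log 10 ≤ (a:ℝ) ^ 2 := by
    have h1 : (fun x : ℝ => (k / 2 * Real.log x + H)) =o[atTop] fun x : ℝ => x := by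
      refine Asymptotics.IsLittleO.add (Real.isLittleO_log_id_atTop.const_mul_left _) ?_
      exact Asymptotics.isLittleO_const_left.2 (Or.inr tendsto_norm_atTop_atTop)
    have h2 := h1.def (c := 1 / (2 * 32 * 32 * Real.log 10)) (by have := Real.log_pos (x := 10) (by norm_num); positivity)
    have h3 : Tendsto (fun a : ℕ => 32 * (a:ℝ)) atTop atTop :=
      tendsto_natCast_atTop_atTop.const_mul_atTop (by norm_num)
    filter_upwards [h3.eventually h2] with a ha
    have h4 : 0 < Real.log 10 := Real.log_pos (by norm_num)
    have h5 := (le_abs_self _).trans ha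
    rw [Real.norm_of_nonneg (by positivity)] at h5
    calc 2 * (32 * (a:ℝ)) * (k / 2 * Real.log (32 * a) + H) * Real.log 10
        ≤ 2 * (32 * (a:ℝ)) * (1 / (2 * 32 * 32 * Real.log 10) * (32 * a)) * Real.log 10 := by gcongr
      _ = _ := by field_simp
  have hmain : ∀ᶠ a : ℕ in atTop, (k / 2 - 40 * B) * Real.log a
      ≤ 2 * H + k + 10 * C + 10 * B + P1 + 2 * (k + H) := by
    filter_upwards [hev, eventually_ge_atTop 4] with a hev ha4
    have ha : (4:ℝ) ≤ a := by exact_mod_cast ha4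
    obtain ⟨n, hn1, hn2, hn3⟩ := exists_S_ge hm1 (a := a) (by linarith)
    have hn1' : (1:ℝ) ≤ n := by exact_mod_cast hn1
    have h1 := abs_le.mp (hH a (by linarith)).1
    have h2 := abs_le.mp (hH a (by linarith)).2
    have h3 := abs_le.mp (hH (32 * a) (by linarith)).2
    have h4 := S_le (E := E) (a := a) (by omega) (u := n) (by linarith)
    have h5 := abs_A_le (E := E) hC hB hsum (a := a) (u := n) ha (by linarith)
    have hla : 0 ≤ Real.log a := Real.log_nonneg (by linarith)
    have h6 : Real.log n ≤ (a:ℝ) ^ 2 := by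
      refine hn2.trans (le_trans ?_ hev)
      have : E.h (32 * a) ≤ k / 2 * Real.log (32 * a) + H := by linarith
      have : 0 ≤ Real.log 10 := Real.log_nonneg (by norm_num)
      gcongr
    have h7 : lll n ≤ 4 * Real.log a := by
      have e1 : Real.log (1 + n) ≤ Real.log n + 1 := by
        rw [add_comm]; exact log_add_le hn1' zero_le_one
      have e0 : 0 ≤ Real.log (1 + n) := Real.log_nonneg (by linarith)
      have e2 : 1 + Real.log (1 + n) ≤ (a:ℝ) ^ 4 := by
        have e3 : (16:ℝ) ≤ (a:ℝ) ^ 2 := by nlinarith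
        have e4 : (a:ℝ) ^ 4 = (a:ℝ) ^ 2 * (a:ℝ) ^ 2 := by ring
        nlinarith
      rw [lll, show 4 * Real.log a = Real.log ((a:ℝ) ^ 4) by rw [Real.log_pow]; norm_num]
      exact Real.log_le_log (by linarith) e2
    have h8 : |E.g a| * Real.exp (-(a * n)) ≤ k + H := by
      have e1 : |E.g a| ≤ k * a + H := by
        have : Real.log a ≤ a := Real.log_le_self (by linarith)
        have e2 : k / 2 * Real.log a ≤ k * a := by nlinarith
        have e3 : 0 ≤ k / 2 * Real.log a := by positivity
        rw [abs_le]
        constructor <;> linarith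
      have e2 : Real.exp (-(a * n)) ≤ Real.exp (-a) := by
        rw [Real.exp_le_exp]; nlinarith
      have e3 : a * Real.exp (-a) ≤ 1 := by
        rw [Real.exp_neg, ← div_eq_mul_inv, div_le_one (Real.exp_pos _)]
        linarith [Real.add_one_le_exp (a:ℝ)]
      have e4 : Real.exp (-(a:ℝ)) ≤ 1 := by rw [Real.exp_le_one_iff]; linarith
      calc |E.g a| * Real.exp (-(a * n)) ≤ (k * a + H) * Real.exp (-a) := by gcongr
        _ = k * (a * Real.exp (-a)) + H * Real.exp (-a) := by ring
        _ ≤ k * 1 + H * 1 := by gcongr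
        _ = _ := by ring
    have h9 : Real.log (32 * a) = Real.log 32 + Real.log a :=
      Real.log_mul (by norm_num) (by linarith)
    have h10 : Real.log 32 ≤ 4 := by
      rw [show (32:ℝ) = 2 ^ 5 by norm_num, Real.log_pow]
      have := Real.log_two_lt_d9
      push_cast; linarith
    have h11 : B * lll n ≤ B * (4 * Real.log a) := mul_le_mul_of_nonneg_left h7 hB
    rw [h9] at h3
    have h12 : k * Real.log 32 ≤ k * 4 := mul_le_mul_of_nonneg_left h10 hk0
    have h13 : 0 ≤ k * Real.log a := by positivity
    nlinarith
  by_contra hcon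
  push Not at hcon
  have hpos : 0 < k / 2 - 40 * B := by linarith
  have h1 : Tendsto (fun a : ℕ => (k / 2 - 40 * B) * Real.log a) atTop atTop :=
    (Real.tendsto_log_atTop.comp tendsto_natCast_atTop_atTop).const_mul_atTop hpos
  obtain ⟨a, h2, h3⟩ := (hmain.and (h1.eventually_gt_atTop _)).exists
  exact absurd h2 (not_le.mpr h3)

end FormulaData

section Abel
open MeasureTheory Set

/-- The Abel-summation integral attached to a coefficient sequence. -/
noncomputable def abelInt (f : ℕ → ℂ) (s : ℂ) : ℂ :=
  s * ∫ t in Set.Ioi (1 : ℝ), (∑ k ∈ Finset.Icc 1 ⌊t⌋₊, f k) * (t : ℂ) ^ (-(s + 1))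

variable {f : ℕ → ℂ} {r K : ℝ}

lemma norm_partialSum_le (hr : 0 ≤ r) (hK : 0 ≤ K)
    (hf : ∀ n : ℕ, ‖∑ k ∈ Finset.Icc 1 n, f k‖ ≤ K * (n : ℝ) ^ r) {t : ℝ} (ht : 0 ≤ t) :
    ‖∑ k ∈ Finset.Icc 1 ⌊t⌋₊, f k‖ ≤ K * t ^ r := by
  refine (hf _).trans ?_
  have := Nat.floor_le ht
  gcongr

lemma measurable_partialSum : Measurable fun t : ℝ => ∑ k ∈ Finset.Icc 1 ⌊t⌋₊, f k :=
  (measurable_from_nat (f := fun n : ℕ => ∑ k ∈ Finset.Icc 1 n, f k)).comp Nat.measurable_floor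

lemma differentiableAt_abelInt (hr : 0 ≤ r) (hK : 0 ≤ K)
    (hf : ∀ n : ℕ, ‖∑ k ∈ Finset.Icc 1 n, f k‖ ≤ K * (n : ℝ) ^ r) {s : ℂ} (hs : r < s.re) :
    DifferentiableAt ℂ (abelInt f) s := by
  set S : ℝ → ℂ := (Ioi (1:ℝ)).indicator fun t : ℝ => ∑ k ∈ Finset.Icc 1 ⌊t⌋₊, f k with hS
  have hmeas : Measurable S := measurable_partialSum.indicator measurableSet_Ioi
  have hbd : ∀ t, 0 ≤ t → ‖S t‖ ≤ K * t ^ r := by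
    intro t ht
    rw [hS, Set.indicator_apply]
    split_ifs
    · exact norm_partialSum_le hr hK hf ht
    · rw [norm_zero]; positivity
  have heq : ∀ s, abelInt f s = s * mellin S (-s) := by
    intro s
    rw [abelInt, mellin]
    congr 1
    have : ∀ t : ℝ, (t : ℂ) ^ (-s - 1) • S t
        = (Ioi (1:ℝ)).indicator (fun t : ℝ => (∑ k ∈ Finset.Icc 1 ⌊t⌋₊, f k) * (t : ℂ) ^ (-(s + 1))) t := by
      intro t
      rw [hS, Set.indicator_apply, Set.indicator_apply]
      split_ifs
      · rw [smul_eq_mul, mul_comm, neg_add']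
      · simp
    simp_rw [this]
    rw [setIntegral_indicator measurableSet_Ioi, Set.inter_eq_right.mpr (Ioi_subset_Ioi zero_le_one)]
  have hd : DifferentiableAt ℂ (mellin S) (-s) := by
    refine mellin_differentiableAt_of_isBigO_rpow (a := -r) (b := -s.re - 1) ?_ ?_ ?_ ?_ ?_
    · rw [locallyIntegrableOn_iff isOpen_Ioi.isLocallyClosed]
      intro k hk hkc
      obtain ⟨b, hb⟩ := hkc.bddAbove
      refine Measure.integrableOn_of_bounded (M := K * (max b 0) ^ r) hkc.measure_lt_top.ne
        hmeas.aestronglyMeasurable ?_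
      refine (ae_restrict_iff' hkc.measurableSet).mpr (Eventually.of_forall fun t ht => ?_)
      have h0 : 0 < t := hk ht
      refine (hbd t h0.le).trans ?_
      have : t ≤ max b 0 := (hb ht).trans (le_max_left _ _)
      gcongr
    · refine Asymptotics.IsBigO.of_bound K ?_
      filter_upwards [eventually_ge_atTop 0] with t ht
      rw [neg_neg, Real.norm_of_nonneg (by positivity)]
      exact hbd t ht
    · simpa using hs
    · refine Asymptotics.IsBigO.of_bound 0 ?_
      have : ∀ᶠ t : ℝ in nhdsWithin 0 (Ioi 0), t < 1 :=
        nhdsWithin_le_nhds (Iio_mem_nhds one_pos)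
      filter_upwards [this] with t ht
      rw [hS, Set.indicator_of_notMem (by simpa using ht.le)]
      simp
    · simp
  have : abelInt f = fun s => s * mellin S (-s) := funext heq
  rw [this]
  exact differentiableAt_id.mul (DifferentiableAt.comp s (f := fun s : ℂ => -s) (g := mellin S) hd differentiableAt_id.neg)

lemma norm_abelInt_le (hr : 0 ≤ r) (hK : 0 ≤ K)
    (hf : ∀ n : ℕ, ‖∑ k ∈ Finset.Icc 1 n, f k‖ ≤ K * (n : ℝ) ^ r) {s : ℂ} (hs : r < s.re) :
    ‖abelInt f s‖ ≤ ‖s‖ * (K / (s.re - r)) := by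
  rw [abelInt, norm_mul]
  refine mul_le_mul_of_nonneg_left ?_ (norm_nonneg _)
  have h1 : ∫ t in Ioi (1:ℝ), K * t ^ (r - s.re - 1) = K / (s.re - r) := by
    rw [integral_const_mul, integral_Ioi_rpow_of_lt (by linarith) one_pos, Real.one_rpow]
    have : s.re - r ≠ 0 := by linarith
    have : r - s.re ≠ 0 := by linarith
    rw [show r - s.re - 1 + 1 = -(s.re - r) by ring]
    field_simp
  rw [← h1]
  refine norm_integral_le_of_norm_le ?_ ?_
  · exact (integrableOn_Ioi_rpow_of_lt (by linarith) one_pos).const_mul K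
  · refine (ae_restrict_iff' measurableSet_Ioi).mpr (Eventually.of_forall fun t ht => ?_)
    have h0 : 0 < t := lt_trans one_pos ht
    rw [norm_mul, Complex.norm_cpow_eq_rpow_re_of_pos h0]
    have h2 : (-(s + 1)).re = -s.re - 1 := by simp; ring
    rw [h2]
    calc _ ≤ K * t ^ r * t ^ (-s.re - 1) := by
          gcongr
          exact norm_partialSum_le hr hK hf h0.le
      _ = _ := by rw [mul_assoc, ← Real.rpow_add h0]; ring_nf

lemma LSeries_eq_abelInt (hr : 0 ≤ r)
    (hf : ∀ n : ℕ, ‖∑ k ∈ Finset.Icc 1 n, f k‖ ≤ K * (n : ℝ) ^ r) {s : ℂ} (hs : r < s.re)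
    (hS : LSeriesSummable f s) : LSeries f s = abelInt f s := by
  refine LSeries_eq_mul_integral f hr hs hS (Asymptotics.IsBigO.of_bound K ?_)
  refine Eventually.of_forall fun n => ?_
  rw [Real.norm_of_nonneg (by positivity)]
  exact hf n

end Abel

section Dirichlet
variable {N : ℕ} [NeZero N]

lemma norm_sum_dirichletCharacter_le {χ : DirichletCharacter ℂ N} (hχ : χ ≠ 1) (n : ℕ) :
    ‖∑ k ∈ Finset.Icc 1 n, χ k‖ ≤ 2 * N + 1 := by
  have hper : ∀ n : ℕ, ∑ k ∈ Finset.range (n + N), χ k = ∑ k ∈ Finset.range n, χ k := by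
    intro n
    rw [Finset.sum_range_add, add_eq_left]
    have h1 : ∑ a : ZMod N, χ ((n : ZMod N) + a) = 0 := by
      rw [← χ.sum_eq_zero_of_ne_one hχ]
      exact Fintype.sum_equiv (Equiv.addLeft (n : ZMod N)) _ _ (fun _ => rfl)
    rw [← h1]
    push_cast
    refine Finset.sum_bij' (fun k _ => (k : ZMod N)) (fun a _ => a.val) (by simp)
      (fun a _ => by simpa using ZMod.val_lt a) (fun k hk => ?_) (fun a _ => by simp) (fun k _ => rfl)
    exact ZMod.val_cast_of_lt (by simpa using hk)
  have hb : ∀ n : ℕ, ‖∑ k ∈ Finset.range n, χ k‖ ≤ N := by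
    intro n
    induction n using Nat.strong_induction_on with
    | _ n ih =>
      rcases lt_or_ge n N with h | h
      · refine (norm_sum_le _ _).trans ?_
        refine (Finset.sum_le_card_nsmul _ _ 1 fun k _ => χ.norm_le_one _).trans ?_
        simp; exact_mod_cast h.le
      · obtain ⟨m, rfl⟩ := Nat.exists_eq_add_of_le' h
        rw [hper]
        exact ih m (by have := NeZero.pos N; omega)
  have h2 : ∑ k ∈ Finset.Icc 1 n, χ k = ∑ k ∈ Finset.range (n + 1), χ k - χ 0 := by
    rw [Finset.range_eq_Ico, Finset.sum_eq_sum_Ico_succ_bot (by omega)]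
    simp
    rfl
  rw [h2]
  refine (norm_sub_le _ _).trans ?_
  have := hb (n + 1)
  have := χ.norm_le_one 0
  have : (0:ℝ) ≤ N := by positivity
  linarith

lemma LFunction_eq_abelInt {χ : DirichletCharacter ℂ N} (hχ : χ ≠ 1) {s : ℂ} (hs : 0 < s.re) :
    DirichletCharacter.LFunction χ s = abelInt (fun n => χ n) s := by
  have hf : ∀ n : ℕ, ‖∑ k ∈ Finset.Icc 1 n, (fun n : ℕ => χ n) k‖ ≤ (2 * N + 1) * (n : ℝ) ^ (0:ℝ) := by
    intro n; rw [Real.rpow_zero, mul_one]; exact norm_sum_dirichletCharacter_le hχ n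
  have hop : IsOpen {s : ℂ | 0 < s.re} := isOpen_lt continuous_const continuous_re
  have h1 : AnalyticOnNhd ℂ (DirichletCharacter.LFunction χ) {s : ℂ | 0 < s.re} :=
    (DirichletCharacter.differentiable_LFunction hχ).differentiableOn.analyticOnNhd hop
  have h2 : AnalyticOnNhd ℂ (abelInt (fun n => χ n)) {s : ℂ | 0 < s.re} :=
    DifferentiableOn.analyticOnNhd (fun s hs => (differentiableAt_abelInt le_rfl
      (by positivity) hf hs).differentiableWithinAt) hop
  refine h1.eqOn_of_preconnected_of_eventuallyEq h2 (convex_halfSpace_re_gt 0).isPreconnected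
    (z₀ := 2) (by simp) ?_ hs
  have : ∀ᶠ s : ℂ in nhds 2, 1 < s.re :=
    (isOpen_lt continuous_const continuous_re).mem_nhds (by simp)
  filter_upwards [this] with s hs
  rw [DirichletCharacter.LFunction_eq_LSeries _ hs]
  exact LSeries_eq_abelInt le_rfl hf (by linarith)
    (DirichletCharacter.LSeriesSummable_of_one_lt_re χ hs)

lemma norm_LFunction_le {χ : DirichletCharacter ℂ N} (hχ : χ ≠ 1) {s : ℂ} (hs : 1 / 2 ≤ s.re) :
    ‖DirichletCharacter.LFunction χ s‖ ≤ (4 * N + 2) * ‖s‖ := by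
  have hf : ∀ n : ℕ, ‖∑ k ∈ Finset.Icc 1 n, (fun n : ℕ => χ n) k‖ ≤ (2 * N + 1) * (n : ℝ) ^ (0:ℝ) := by
    intro n; rw [Real.rpow_zero, mul_one]; exact norm_sum_dirichletCharacter_le hχ n
  rw [LFunction_eq_abelInt hχ (by linarith)]
  refine (norm_abelInt_le le_rfl (by positivity) hf (by linarith : 0 < s.re)).trans ?_
  rw [mul_comm]
  gcongr
  rw [sub_zero, div_le_iff₀ (by linarith)]
  have : (0:ℝ) ≤ N := by positivity
  nlinarith

end Dirichlet

/-- If the logarithmic derivative of an entire function extends holomorphically to a right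
half-plane, then the function does not vanish there. -/
lemma ne_zero_of_deriv_eq_mul {Z Φ : ℂ → ℂ} {r : ℝ} (hZ : Differentiable ℂ Z)
    (hΦ : ∀ s : ℂ, r < s.re → DifferentiableAt ℂ Φ s)
    (heq : ∀ s : ℂ, 1 < s.re → deriv Z s = Z s * Φ s) (hne : ∀ s : ℂ, 1 < s.re → Z s ≠ 0)
    {s : ℂ} (hs : r < s.re) : Z s ≠ 0 := by
  have hop : IsOpen {s : ℂ | r < s.re} := isOpen_lt continuous_const continuous_re
  have hΦ' : AnalyticOnNhd ℂ Φ {s : ℂ | r < s.re} :=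
    DifferentiableOn.analyticOnNhd (fun s hs => (hΦ s hs).differentiableWithinAt) hop
  have hZ' : AnalyticOnNhd ℂ Z {s : ℂ | r < s.re} := hZ.differentiableOn.analyticOnNhd hop
  have heq' : Set.EqOn (deriv Z) (fun s => Z s * Φ s) {s : ℂ | r < s.re} := by
    refine hZ'.deriv.eqOn_of_preconnected_of_eventuallyEq (hZ'.mul hΦ')
      (convex_halfSpace_re_gt r).isPreconnected (z₀ := ((max r 1 + 1 : ℝ) : ℂ)) ?_ ?_
    · rw [Set.mem_ofPred_eq, ofReal_re]
      linarith [le_max_left r 1]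
    · have : ∀ᶠ s : ℂ in nhds ((max r 1 + 1 : ℝ) : ℂ), 1 < s.re := by
        refine (isOpen_lt continuous_const continuous_re).mem_nhds ?_
        rw [Set.mem_ofPred_eq, ofReal_re]
        linarith [le_max_right r 1]
      filter_upwards [this] with s hs using heq s hs
  intro h0
  have hZs : AnalyticAt ℂ Z s := hZ' s hs
  have h1 : analyticOrderAt (deriv Z) s + 1 = analyticOrderAt Z s := by
    rw [hZs.analyticOrderAt_deriv_add_one]
    simp [h0]
  have h2 : analyticOrderAt (deriv Z) s = analyticOrderAt Z s + analyticOrderAt Φ s := by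
    rw [← analyticOrderAt_mul hZs (hΦ' s hs)]
    refine analyticOrderAt_congr ?_
    filter_upwards [hop.mem_nhds hs] with w hw using heq' hw
  have htop : analyticOrderAt Z s = ⊤ := by
    by_contra hfin
    obtain ⟨n, hn⟩ := ENat.ne_top_iff_exists.mp hfin
    rw [h2, ← hn] at h1
    have h3 : analyticOrderAt Φ s ≠ ⊤ := by
      intro h; rw [h] at h1; simp at h1
    obtain ⟨m, hm⟩ := ENat.ne_top_iff_exists.mp h3
    rw [← hm] at h1
    have : n + m + 1 = n := by exact_mod_cast h1
    omega
  rw [analyticOrderAt_eq_top] at htop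
  have h3 : Set.EqOn Z 0 Set.univ :=
    (hZ.differentiableOn.analyticOnNhd isOpen_univ).eqOn_zero_of_preconnected_of_eventuallyEq_zero
      isPreconnected_univ (Set.mem_univ s) htop
  exact hne 2 (by simp) (h3 (Set.mem_univ 2))

/-- Growth of order at most `3/2` in the right half-plane. -/
def GrowthBound (f : ℂ → ℂ) : Prop :=
  ∃ C : ℝ, 0 ≤ C ∧ ∀ z : ℂ, 0 ≤ z.re → ‖f z‖ ≤ Real.exp (C * (1 + ‖z‖) ^ (3 / 2 : ℝ))

lemma GrowthBound.mul {f g : ℂ → ℂ} (hf : GrowthBound f) (hg : GrowthBound g) :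
    GrowthBound fun z => f z * g z := by
  obtain ⟨C, hC, h1⟩ := hf
  obtain ⟨D, hD, h2⟩ := hg
  refine ⟨C + D, by positivity, fun z hz => ?_⟩
  rw [norm_mul, add_mul, Real.exp_add]
  exact mul_le_mul (h1 z hz) (h2 z hz) (norm_nonneg _) (Real.exp_pos _).le

lemma GrowthBound.prod {ι : Type*} (s : Finset ι) {f : ι → ℂ → ℂ} (hf : ∀ i, GrowthBound (f i)) :
    GrowthBound fun z => ∏ i ∈ s, f i z := by
  induction s using Finset.induction_on with
  | empty => exact ⟨0, le_rfl, fun z _ => by simp⟩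
  | insert i s hi ih =>
    have := (hf i).mul ih
    simpa only [Finset.prod_insert hi] using this

lemma one_add_norm_le_rpow (z : ℂ) : 1 + ‖z‖ ≤ (1 + ‖z‖) ^ (3 / 2 : ℝ) := by
  have := norm_nonneg z
  exact Real.self_le_rpow_of_one_le (by linarith) (by norm_num)

lemma growthBound_of_le_mul {f : ℂ → ℂ} {A : ℝ} (hA : 0 ≤ A)
    (h : ∀ z : ℂ, 0 ≤ z.re → ‖f z‖ ≤ A * (1 + ‖z‖)) : GrowthBound f := by
  refine ⟨A, hA, fun z hz => (h z hz).trans ?_⟩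
  have h1 := one_add_norm_le_rpow z
  have h2 := Real.add_one_le_exp (A * (1 + ‖z‖) ^ (3 / 2 : ℝ))
  nlinarith

lemma norm_Gamma_le {s : ℂ} (hs : 0 < s.re) : ‖Complex.Gamma s‖ ≤ Real.Gamma s.re := by
  rw [Complex.Gamma_eq_integral hs, Real.Gamma_eq_integral hs, Complex.GammaIntegral]
  refine (MeasureTheory.norm_integral_le_integral_norm _).trans (le_of_eq ?_)
  refine MeasureTheory.setIntegral_congr_fun measurableSet_Ioi fun t ht => ?_
  have h0 : 0 < t := ht
  simp only [norm_mul, Complex.norm_cpow_eq_rpow_re_of_pos h0, sub_re, one_re]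
  rw [Complex.norm_real, Real.norm_of_nonneg (Real.exp_pos _).le]

lemma real_Gamma_le {σ : ℝ} (hσ : 1 / 4 ≤ σ) :
    Real.Gamma σ ≤ Real.exp (2 + 2 * (σ + 2) ^ (3 / 2 : ℝ)) := by
  have h1 : Real.Gamma (σ + 2) = (σ + 1) * (σ * Real.Gamma σ) := by
    rw [← Real.Gamma_add_one (by linarith), ← Real.Gamma_add_one (by linarith)]
    congr 1; ring
  have hpos := Real.Gamma_pos_of_pos (by linarith : 0 < σ)
  have h2 : Real.Gamma σ ≤ 4 * Real.Gamma (σ + 2) := by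
    rw [h1]; nlinarith [mul_pos hpos (by linarith : 0 < σ)]
  set m := ⌈σ⌉₊ with hm
  have hm1 : σ ≤ m := Nat.le_ceil σ
  have hm2 : (m : ℝ) < σ + 1 := Nat.ceil_lt_add_one (by linarith)
  have h3 : Real.Gamma (σ + 2) ≤ ((m + 1).factorial : ℝ) := by
    rw [← Real.Gamma_nat_eq_factorial]
    refine Real.Gamma_strictMonoOn_Ici.monotoneOn ?_ ?_ ?_
    · rw [Set.mem_Ici]; linarith
    · rw [Set.mem_Ici]; push_cast; linarith
    · push_cast; linarith
  have h4 : ((m + 1).factorial : ℝ) ≤ ((m + 1 : ℕ) : ℝ) ^ (m + 1) := by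
    exact_mod_cast Nat.factorial_le_pow (m + 1)
  have h5 : ((m + 1 : ℕ) : ℝ) ^ (m + 1) ≤ Real.exp (2 * (σ + 2) ^ (3 / 2 : ℝ)) := by
    have hp : (0:ℝ) < ((m + 1 : ℕ) : ℝ) := by positivity
    rw [← Real.exp_log (pow_pos hp _), Real.exp_le_exp, Real.log_pow]
    have hle : ((m + 1 : ℕ) : ℝ) ≤ σ + 2 := by push_cast; linarith
    have hlog : Real.log ((m + 1 : ℕ) : ℝ) ≤ 2 * (σ + 2) ^ (1 / 2 : ℝ) := by
      calc Real.log ((m + 1 : ℕ) : ℝ) ≤ Real.log (σ + 2) := Real.log_le_log hp hle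
        _ = 2 * Real.log ((σ + 2) ^ (1 / 2 : ℝ)) := by rw [Real.log_rpow (by linarith)]; ring
        _ ≤ 2 * (σ + 2) ^ (1 / 2 : ℝ) := by
          have := Real.log_le_self (by positivity : 0 ≤ (σ + 2) ^ (1 / 2 : ℝ))
          linarith
    calc ((m + 1 : ℕ) : ℝ) * Real.log ((m + 1 : ℕ) : ℝ)
        ≤ (σ + 2) * (2 * (σ + 2) ^ (1 / 2 : ℝ)) := by
          have : 0 ≤ Real.log ((m + 1 : ℕ) : ℝ) := Real.log_natCast_nonneg _
          gcongr
      _ = 2 * ((σ + 2) ^ (1:ℝ) * (σ + 2) ^ (1 / 2 : ℝ)) := by rw [Real.rpow_one]; ring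
      _ = _ := by rw [← Real.rpow_add (by linarith)]; norm_num
  have h6 : (4:ℝ) ≤ Real.exp 2 := by
    have := Real.quadratic_le_exp_of_nonneg (x := 2) (by norm_num)
    linarith
  rw [Real.exp_add]
  calc Real.Gamma σ ≤ 4 * Real.Gamma (σ + 2) := h2
    _ ≤ _ := by
      have := h3.trans (h4.trans h5)
      have : 0 ≤ Real.Gamma (σ + 2) := (Real.Gamma_pos_of_pos (by linarith)).le
      gcongr

lemma growthBound_Gammaℝ {β : ℝ} (hβ : β = 1 / 2 ∨ β = 3 / 2) :
    GrowthBound fun z => Gammaℝ (z + β) := by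
  have hb : 1 / 2 ≤ β ∧ β ≤ 3 / 2 := by rcases hβ with h | h <;> rw [h] <;> norm_num
  refine ⟨2 + 2 * 3 ^ (3 / 2 : ℝ), by positivity, fun z hz => ?_⟩
  have hy1 : 1 ≤ 1 + ‖z‖ := by linarith [norm_nonneg z]
  have hre : ((z + β) / 2).re = (z.re + β) / 2 := by
    rw [show ((z + β) / 2) = ((1 / 2 : ℝ) : ℂ) * (z + β) by push_cast; ring, re_ofReal_mul]
    simp; ring
  have hre' : (-(z + β) / 2).re = -((z.re + β) / 2) := by
    rw [neg_div, neg_re, hre]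
  have hzre : z.re ≤ ‖z‖ := re_le_norm z
  beta_reduce
  rw [Gammaℝ_def, norm_mul, Complex.norm_cpow_eq_rpow_re_of_pos Real.pi_pos, hre']
  have h1 : π ^ (-((z.re + β) / 2)) ≤ 1 :=
    Real.rpow_le_one_of_one_le_of_nonpos (by linarith [Real.pi_gt_three]) (by linarith)
  have h2 := norm_Gamma_le (s := (z + β) / 2) (by rw [hre]; linarith)
  rw [hre] at h2
  have h3 := real_Gamma_le (σ := (z.re + β) / 2) (by linarith)
  calc _ ≤ 1 * Real.exp (2 + 2 * ((z.re + β) / 2 + 2) ^ (3 / 2 : ℝ)) :=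
        mul_le_mul h1 (h2.trans h3) (norm_nonneg _) zero_le_one
    _ ≤ _ := by
      rw [one_mul, Real.exp_le_exp, add_mul]
      have e1 : ((z.re + β) / 2 + 2) ^ (3 / 2 : ℝ) ≤ (3 * (1 + ‖z‖)) ^ (3 / 2 : ℝ) := by
        refine Real.rpow_le_rpow (by linarith) (by linarith) (by norm_num)
      rw [Real.mul_rpow (by norm_num) (by linarith)] at e1
      have e2 : 1 ≤ (1 + ‖z‖) ^ (3 / 2 : ℝ) := Real.one_le_rpow hy1 (by norm_num)
      nlinarith

lemma differentiableAt_Gammaℝ {s : ℂ} (hs : 0 < s.re) : DifferentiableAt ℂ Gammaℝ s := by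
  have h := (differentiable_Gammaℝ_inv s).inv (inv_ne_zero (Gammaℝ_ne_zero_of_re_pos hs))
  have e : Gammaℝ = (fun s => (Gammaℝ s)⁻¹)⁻¹ := by ext; simp
  rw [e]
  exact h

lemma re_logDeriv_Gamma {x : ℝ} (hx : 0 < x) :
    (logDeriv Complex.Gamma (x : ℂ)).re = realDigamma x := by
  have hd : DifferentiableAt ℂ Complex.Gamma (x : ℂ) := by
    refine Complex.differentiableAt_Gamma _ fun m h => ?_
    have h1 : x = -(m:ℝ) := by exact_mod_cast h
    have : (0:ℝ) ≤ m := m.cast_nonneg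
    linarith
  have h1 : HasDerivAt Real.Gamma (deriv Complex.Gamma x).re x := by
    have := hd.hasDerivAt.real_of_complex
    simpa [Complex.Gamma_ofReal] using this
  have h2 := (h1.log (Real.Gamma_pos_of_pos hx).ne').deriv
  rw [realDigamma, h2, logDeriv_apply, Complex.Gamma_ofReal, div_ofReal_re]

lemma re_logDeriv_Gammaℝ {x : ℝ} (hx : 0 < x) :
    (logDeriv Gammaℝ (x : ℂ)).re = -(Real.log π / 2) + 1 / 2 * realDigamma (x / 2) := by
  have hpi : (π : ℂ) ≠ 0 := by exact_mod_cast Real.pi_ne_zero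
  have hx2 : ((x:ℂ) / 2) = ((x / 2 : ℝ) : ℂ) := by push_cast; ring
  have hG : DifferentiableAt ℂ Complex.Gamma ((x:ℂ) / 2) := by
    rw [hx2]
    refine Complex.differentiableAt_Gamma _ fun m h => ?_
    have h1 : x / 2 = -(m:ℝ) := by exact_mod_cast h
    have : (0:ℝ) ≤ m := m.cast_nonneg
    linarith
  have hG0 : Complex.Gamma ((x:ℂ) / 2) ≠ 0 := by
    rw [hx2]; exact Complex.Gamma_ne_zero_of_re_pos (by rw [ofReal_re]; linarith)
  have hp : HasDerivAt (fun s : ℂ => (π : ℂ) ^ (-s / 2)) ((π:ℂ) ^ (-(x:ℂ) / 2) * Complex.log π * (-1 / 2)) x := by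
    have := ((hasDerivAt_id (x:ℂ)).neg.div_const 2).const_cpow (c := (π:ℂ)) (Or.inl hpi)
    simpa using this
  have h1 : logDeriv Gammaℝ (x:ℂ) = logDeriv (fun s : ℂ => (π : ℂ) ^ (-s / 2)) x
      + logDeriv (fun s : ℂ => Complex.Gamma (s / 2)) x := by
    rw [← logDeriv_mul]
    · rfl
    · simp [hpi]
    · exact hG0
    · exact hp.differentiableAt
    · exact DifferentiableAt.comp (x:ℂ) (f := fun s : ℂ => s / 2) hG (by fun_prop)
  have h2 : logDeriv (fun s : ℂ => Complex.Gamma (s / 2)) x = logDeriv Complex.Gamma ((x:ℂ) / 2) * (1 / 2) := by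
    have := logDeriv_comp (f := Complex.Gamma) (g := fun s : ℂ => s / 2) (x := (x:ℂ)) hG (by fun_prop)
    rw [Function.comp_def] at this
    rw [this]
    congr 1
    simp [deriv_div_const]
  have h3 : logDeriv (fun s : ℂ => (π : ℂ) ^ (-s / 2)) x = ((-(Real.log π / 2) : ℝ) : ℂ) := by
    rw [logDeriv_apply, hp.deriv]
    have : (π:ℂ) ^ (-(x:ℂ) / 2) ≠ 0 := by simp [hpi]
    push_cast
    rw [Complex.ofReal_log Real.pi_pos.le]
    field_simp
  rw [h1, h2, h3, add_re, ofReal_re, hx2, show (1 / 2 : ℂ) = ((1 / 2 : ℝ) : ℂ) by push_cast; ring,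
    re_mul_ofReal, re_logDeriv_Gamma (by linarith)]
  ring

end FixedQ

namespace FixedQ
open DirichletCharacter

lemma isPrimitive_inv {N : ℕ} {χ : DirichletCharacter ℂ N} (h : χ.IsPrimitive) :
    χ⁻¹.IsPrimitive := by
  have key : ∀ ψ : DirichletCharacter ℂ N, ψ.conductorSet ⊆ ψ⁻¹.conductorSet := by
    rintro ψ d ⟨hd, ψ₀, h0⟩
    exact ⟨hd, ψ₀⁻¹, by rw [map_inv, ← h0]⟩
  have : χ⁻¹.conductorSet = χ.conductorSet :=
    Set.Subset.antisymm (by simpa using key χ⁻¹) (key χ)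
  rw [isPrimitive_def] at h ⊢
  rwa [DirichletCharacter.conductor, this]

variable {N : ℕ}

/-- The shift of the archimedean factor of `xi χ`. -/
noncomputable def gammaShift (χ : DirichletCharacter ℂ N) : ℝ := if χ.Even then 1 / 2 else 3 / 2

lemma gammaShift_eq_or (χ : DirichletCharacter ℂ N) :
    gammaShift χ = 1 / 2 ∨ gammaShift χ = 3 / 2 := by
  unfold gammaShift; split_ifs <;> simp

lemma gammaShift_pos (χ : DirichletCharacter ℂ N) : 0 < gammaShift χ := by
  rcases gammaShift_eq_or χ with h | h <;> rw [h] <;> norm_num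

lemma gammaFactor_half_add (χ : DirichletCharacter ℂ N) (z : ℂ) :
    gammaFactor χ (1 / 2 + z) = Gammaℝ (z + gammaShift χ) := by
  unfold gammaShift
  split_ifs with h
  · rw [h.gammaFactor_def]; congr 1; push_cast; ring
  · rw [(χ.even_or_odd.resolve_left h).gammaFactor_def]; congr 1; push_cast; ring

lemma gammaShift_inv (χ : DirichletCharacter ℂ N) : gammaShift χ⁻¹ = gammaShift χ := by
  unfold gammaShift
  have : χ⁻¹.Even ↔ χ.Even := by
    unfold DirichletCharacter.Even
    rw [MulChar.inv_apply_eq_inv', inv_eq_one]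
  simp only [this]

/-- The coefficients of the logarithmic derivative of `L(s, χ) L(s, χ⁻¹)`, up to sign. -/
noncomputable def coeff (χ : DirichletCharacter ℂ N) (n : ℕ) : ℝ :=
  ArithmeticFunction.vonMangoldt n * (2 * (χ n).re)

lemma coeff_eq (χ : DirichletCharacter ℂ N) (n : ℕ) : (coeff χ n : ℂ) =
    χ n * (ArithmeticFunction.vonMangoldt n : ℂ)
      + χ⁻¹ n * (ArithmeticFunction.vonMangoldt n : ℂ) := by
  have : χ⁻¹ n = (starRingEnd ℂ) (χ n) := by
    rw [← MulChar.star_eq_inv]; rfl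
  rw [this, ← add_mul, Complex.add_conj, coeff]
  push_cast; ring

variable {χ : DirichletCharacter ℂ N}

lemma LSeriesSummable_coeff {s : ℂ} (hs : 1 < s.re) :
    LSeriesSummable (fun n => (coeff χ n : ℂ)) s := by
  have := (LSeriesSummable_twist_vonMangoldt χ hs).add (LSeriesSummable_twist_vonMangoldt χ⁻¹ hs)
  refine (LSeriesSummable_congr s fun {n} _ => ?_).mp this
  simp only [Pi.add_apply, Pi.mul_apply]
  rw [coeff_eq]

variable [NeZero N]

/-- The product of the completed `L`-functions of a character and its inverse, centred at the
symmetry point. -/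
noncomputable def xi (χ : DirichletCharacter ℂ N) (z : ℂ) : ℂ :=
  (N : ℂ) ^ z * (completedLFunction χ (1 / 2 + z) * completedLFunction χ⁻¹ (1 / 2 + z))

lemma completedLFunction_half_add (hχ : χ ≠ 1) {z : ℂ} (hz : 0 ≤ z.re) :
    completedLFunction χ (1 / 2 + z) = Gammaℝ (z + gammaShift χ) * LFunction χ (1 / 2 + z) := by
  have hN : N ≠ 1 := fun h => hχ (level_one' _ h)
  have h0 : Gammaℝ (z + gammaShift χ) ≠ 0 :=
    Gammaℝ_ne_zero_of_re_pos (by rw [add_re, ofReal_re]; linarith [gammaShift_pos χ])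
  rw [LFunction_eq_completed_div_gammaFactor χ _ (Or.inr hN), gammaFactor_half_add]
  field_simp

lemma xi_eq (hχ : χ ≠ 1) {z : ℂ} (hz : 0 ≤ z.re) :
    xi χ z = (N : ℂ) ^ z * Gammaℝ (z + gammaShift χ) ^ 2
      * (LFunction χ (1 / 2 + z) * LFunction χ⁻¹ (1 / 2 + z)) := by
  rw [xi, completedLFunction_half_add hχ hz,
    completedLFunction_half_add (inv_ne_one.mpr hχ) hz, gammaShift_inv]
  ring

lemma natCast_level_ne_zero : (N : ℂ) ≠ 0 := Nat.cast_ne_zero.mpr (NeZero.ne N)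

lemma differentiable_xi (hχ : χ ≠ 1) : Differentiable ℂ (xi χ) := by
  have h1 := differentiable_completedLFunction hχ
  have h2 := differentiable_completedLFunction (inv_ne_one.mpr hχ)
  have h3 : Differentiable ℂ fun z : ℂ => (N : ℂ) ^ z := fun z =>
    differentiableAt_id.const_cpow (Or.inl natCast_level_ne_zero)
  exact h3.mul ((h1.comp (by fun_prop : Differentiable ℂ fun z : ℂ => 1 / 2 + z)).mul
    (h2.comp (by fun_prop : Differentiable ℂ fun z : ℂ => 1 / 2 + z)))

lemma xi_neg (hp : χ.IsPrimitive) (z : ℂ) :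
    xi χ (-z) = rootNumber χ * rootNumber χ⁻¹ * xi χ z := by
  have hN := natCast_level_ne_zero (N := N)
  have h1 := hp.completedLFunction_one_sub (1 / 2 + z)
  have h2 := (isPrimitive_inv hp).completedLFunction_one_sub (1 / 2 + z)
  rw [inv_inv] at h2
  rw [show (1 : ℂ) - (1 / 2 + z) = 1 / 2 + -z by ring, show 1 / 2 + z - 1 / 2 = z by ring] at h1 h2
  rw [xi, xi, h1, h2, Complex.cpow_neg]
  have : (N : ℂ) ^ z ≠ 0 := by simp [hN]
  field_simp

lemma growthBound_xi (hχ : χ ≠ 1) : GrowthBound (xi χ) := by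
  have hL : ∀ ψ : DirichletCharacter ℂ N, ψ ≠ 1 →
      GrowthBound fun z => LFunction ψ (1 / 2 + z) := by
    intro ψ hψ
    refine growthBound_of_le_mul (A := 4 * N + 2) (by positivity) fun z hz => ?_
    refine (norm_LFunction_le hψ (s := 1 / 2 + z) ?_).trans ?_
    · simp; linarith
    · gcongr
      refine (norm_add_le _ _).trans ?_
      norm_num
  have hN : GrowthBound fun z : ℂ => (N : ℂ) ^ z := by
    have h1 : (1:ℝ) ≤ N := by exact_mod_cast NeZero.one_le
    refine ⟨Real.log N, Real.log_nonneg h1, fun z hz => ?_⟩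
    have hN0 : (0:ℝ) < N := by linarith
    have h2 := Complex.norm_cpow_eq_rpow_re_of_pos hN0 z
    rw [ofReal_natCast] at h2
    rw [h2, Real.rpow_def_of_pos hN0, Real.exp_le_exp]
    have h3 := one_add_norm_le_rpow z
    have h4 := re_le_norm z
    have h5 := Real.log_nonneg h1
    exact mul_le_mul_of_nonneg_left (by linarith) h5
  have hG := growthBound_Gammaℝ (gammaShift_eq_or χ)
  obtain ⟨C, hC, h⟩ := (hN.mul (hG.mul hG)).mul ((hL χ hχ).mul (hL _ (inv_ne_one.mpr hχ)))
  refine ⟨C, hC, fun z hz => ?_⟩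
  rw [xi_eq hχ hz, pow_two]
  exact h z hz

lemma logDeriv_LFunction {s : ℂ} (hs : 1 < s.re) :
    logDeriv (LFunction χ) s
      = -LSeries ((fun n : ℕ => χ n) * fun n => (ArithmeticFunction.vonMangoldt n : ℂ)) s := by
  rw [LSeries_twist_vonMangoldt_eq χ hs, logDeriv_apply, LFunction_eq_LSeries χ hs,
    deriv_LFunction_eq_deriv_LSeries χ hs]
  ring

lemma LFunction_ne_zero {s : ℂ} (hs : 1 < s.re) : LFunction χ s ≠ 0 := by
  rw [LFunction_eq_LSeries χ hs]
  exact LSeries_ne_zero_of_one_lt_re χ hs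

lemma LSeries_coeff {s : ℂ} (hs : 1 < s.re) :
    LSeries (fun n => (coeff χ n : ℂ)) s
      = -(logDeriv (LFunction χ) s + logDeriv (LFunction χ⁻¹) s) := by
  rw [logDeriv_LFunction hs, logDeriv_LFunction hs, ← neg_add, neg_neg,
    ← LSeries_add (LSeriesSummable_twist_vonMangoldt χ hs)
      (LSeriesSummable_twist_vonMangoldt χ⁻¹ hs)]
  refine LSeries_congr (fun {n} _ => ?_) s
  simp only [Pi.add_apply, Pi.mul_apply]
  rw [coeff_eq]

lemma logDeriv_cpow (z : ℂ) : logDeriv (fun z : ℂ => (N : ℂ) ^ z) z = Real.log N := by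
  have hN := natCast_level_ne_zero (N := N)
  have h := ((hasDerivAt_id z).const_cpow (c := (N:ℂ)) (Or.inl hN)).deriv
  simp only [id, mul_one] at h
  have : (N : ℂ) ^ z ≠ 0 := by simp [hN]
  rw [logDeriv_apply, h, Complex.ofReal_log (by positivity), ofReal_natCast]
  field_simp

lemma logDeriv_xi (hχ : χ ≠ 1) {x : ℝ} (hx : 1 / 2 < x) :
    xi χ x ≠ 0 ∧ logDeriv (xi χ) x = Real.log N + 2 * logDeriv Gammaℝ ((x + gammaShift χ : ℝ) : ℂ)
      - LSeries (fun n => (coeff χ n : ℂ)) (1 / 2 + x) := by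
  have hN := natCast_level_ne_zero (N := N)
  have hs : 1 < (1 / 2 + (x:ℂ)).re := by simp; linarith
  have hg := gammaShift_pos χ
  have hgr : 0 < ((x:ℂ) + gammaShift χ).re := by simp; linarith
  have h1 : DifferentiableAt ℂ (fun z : ℂ => (N : ℂ) ^ z) x :=
    differentiableAt_id.const_cpow (Or.inl hN)
  have h10 : (N : ℂ) ^ (x:ℂ) ≠ 0 := by simp [hN]
  have h2 : DifferentiableAt ℂ (fun z : ℂ => Gammaℝ (z + gammaShift χ)) x :=
    (differentiableAt_Gammaℝ hgr).comp (x:ℂ) (f := fun z : ℂ => z + gammaShift χ) (by fun_prop)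
  have h20 := Gammaℝ_ne_zero_of_re_pos hgr
  have h3 : ∀ ψ : DirichletCharacter ℂ N, ψ ≠ 1 →
      DifferentiableAt ℂ (fun z : ℂ => LFunction ψ (1 / 2 + z)) x := fun ψ hψ =>
    (differentiable_LFunction hψ _).comp (x:ℂ) (f := fun z : ℂ => 1 / 2 + z) (by fun_prop)
  have hshift : ∀ (f : ℂ → ℂ) (c y : ℂ), logDeriv (fun z => f (z + c)) y = logDeriv f (y + c) := by
    intro f c y
    rw [logDeriv_apply, logDeriv_apply, deriv_comp_add_const]
  have hshift' : ∀ (f : ℂ → ℂ) (c y : ℂ), logDeriv (fun z => f (c + z)) y = logDeriv f (c + y) := by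
    intro f c y
    simp only [add_comm c]; exact hshift f c y
  have hev : xi χ =ᶠ[nhds (x:ℂ)] fun z => ((N : ℂ) ^ z * (Gammaℝ (z + gammaShift χ)
      * Gammaℝ (z + gammaShift χ))) * (LFunction χ (1 / 2 + z) * LFunction χ⁻¹ (1 / 2 + z)) := by
    have : ∀ᶠ z : ℂ in nhds (x:ℂ), 0 < z.re := by
      refine (isOpen_lt continuous_const continuous_re).mem_nhds ?_
      rw [Set.mem_ofPred_eq, ofReal_re]; linarith
    filter_upwards [this] with z hz
    rw [xi_eq hχ hz.le, pow_two]
  have hL0 := LFunction_ne_zero (χ := χ) hs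
  have hL0' := LFunction_ne_zero (χ := χ⁻¹) hs
  refine ⟨?_, ?_⟩
  · rw [hev.eq_of_nhds]
    exact mul_ne_zero (mul_ne_zero h10 (mul_ne_zero h20 h20)) (mul_ne_zero hL0 hL0')
  · have he : logDeriv (xi χ) x = logDeriv (fun z => ((N : ℂ) ^ z * (Gammaℝ (z + gammaShift χ)
        * Gammaℝ (z + gammaShift χ))) * (LFunction χ (1 / 2 + z) * LFunction χ⁻¹ (1 / 2 + z))) x := by
      rw [logDeriv_apply, logDeriv_apply, hev.deriv_eq, hev.eq_of_nhds]
    have hmul : ∀ {f g : ℂ → ℂ}, DifferentiableAt ℂ f x → DifferentiableAt ℂ g x → f x ≠ 0 →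
        g x ≠ 0 → logDeriv (fun z => f z * g z) x = logDeriv f x + logDeriv g x :=
      fun hf hg hf0 hg0 => logDeriv_mul (x:ℂ) hf0 hg0 hf hg
    rw [he, hmul (h1.fun_mul (h2.fun_mul h2))
        ((h3 χ hχ).fun_mul (h3 _ (inv_ne_one.mpr hχ)))
        (mul_ne_zero h10 (mul_ne_zero h20 h20)) (mul_ne_zero hL0 hL0'),
      hmul h1 (h2.fun_mul h2) h10 (mul_ne_zero h20 h20),
      hmul h2 h2 h20 h20,
      hmul (h3 χ hχ) (h3 _ (inv_ne_one.mpr hχ)) hL0 hL0',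
      LSeries_coeff hs, logDeriv_cpow, hshift, hshift', hshift']
    push_cast; ring

lemma re_LSeries_ofReal {f : ℕ → ℝ} (hf : f 0 = 0) {x : ℝ}
    (hS : LSeriesSummable (fun n => (f n : ℂ)) (1 / 2 + x)) :
    (LSeries (fun n => (f n : ℂ)) (1 / 2 + x)).re = ∑' n : ℕ, f n * (n : ℝ) ^ (-(1 / 2) - x) := by
  rw [LSeries, Complex.re_tsum hS]
  refine tsum_congr fun n => ?_
  rcases eq_or_ne n 0 with rfl | hn
  · simp [hf]
  · rw [LSeries.term_of_ne_zero hn]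
    have h1 : ((n:ℂ)) ^ (1 / 2 + (x:ℂ)) = (((n:ℝ) ^ (1 / 2 + x) : ℝ) : ℂ) := by
      rw [Complex.ofReal_cpow (by positivity)]; push_cast; rfl
    rw [h1, ← ofReal_div, ofReal_re, div_eq_mul_inv, ← Real.rpow_neg (by positivity)]
    congr 2; ring

lemma summable_of_LSeriesSummable {f : ℕ → ℝ} (hf : f 0 = 0) {x : ℝ}
    (hS : LSeriesSummable (fun n => (f n : ℂ)) (1 / 2 + x)) :
    Summable fun n : ℕ => |f n| * (n : ℝ) ^ (-(1 / 2) - x) := by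
  refine hS.norm.congr fun n => ?_
  rcases eq_or_ne n 0 with rfl | hn
  · simp [hf]
  · have hn' : (0:ℝ) < n := by exact_mod_cast Nat.pos_of_ne_zero hn
    have h2 := Complex.norm_cpow_eq_rpow_re_of_pos hn' (1 / 2 + (x:ℂ))
    rw [ofReal_natCast] at h2
    rw [LSeries.term_of_ne_zero hn, norm_div, h2, Complex.norm_real, Real.norm_eq_abs,
      div_eq_mul_inv, ← Real.rpow_neg hn'.le]
    congr 2; simp; ring

end FixedQ

namespace FixedQ
open DirichletCharacter

section Family

variable {J : Type} [Fintype J] {N : J → ℕ}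

/-- The sum of the coefficients over a family of characters. -/
noncomputable def familyCoeff (χ : ∀ j, DirichletCharacter ℂ (N j)) (n : ℕ) : ℝ :=
  ∑ j, coeff (χ j) n

lemma familyCoeff_zero (χ : ∀ j, DirichletCharacter ℂ (N j)) : familyCoeff χ 0 = 0 := by
  simp [familyCoeff, coeff]

variable {χ : ∀ j, DirichletCharacter ℂ (N j)}

lemma LSeriesSummable_familyCoeff {s : ℂ} (hs : 1 < s.re) :
    LSeriesSummable (fun n => (familyCoeff χ n : ℂ)) s := by
  have := LSeriesSummable.sum (S := Finset.univ) (f := fun j n => (coeff (χ j) n : ℂ)) (s := s)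
    fun j _ => LSeriesSummable_coeff hs
  refine (LSeriesSummable_congr s fun {n} _ => ?_).mp this
  simp [familyCoeff]

lemma LSeries_familyCoeff {s : ℂ} (hs : 1 < s.re) :
    LSeries (fun n => (familyCoeff χ n : ℂ)) s = ∑ j, LSeries (fun n => (coeff (χ j) n : ℂ)) s := by
  rw [← LSeries_sum (S := Finset.univ) (f := fun j n => (coeff (χ j) n : ℂ)) (s := s)
    fun j _ => LSeriesSummable_coeff hs]
  refine LSeries_congr (fun {n} _ => ?_) s
  simp [familyCoeff]

lemma exists_partialSum_le {C B : ℝ} (hC : 0 ≤ C) (hB : 0 ≤ B)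
    (hsum : ∀ n : ℕ, 1 ≤ n →
      |∑ k ∈ Finset.range (n + 1), familyCoeff χ k| ≤ √(n : ℝ) * (C + B * lll (Real.log n)))
    {r : ℝ} (hr : 1 / 2 < r) : ∃ K : ℝ, 0 ≤ K ∧
      ∀ n : ℕ, ‖∑ k ∈ Finset.Icc 1 n, (familyCoeff χ k : ℂ)‖ ≤ K * (n : ℝ) ^ r := by
  have hε : 0 < r - 1 / 2 := by linarith
  refine ⟨C + B / (r - 1 / 2), by positivity, fun n => ?_⟩
  rcases Nat.eq_zero_or_pos n with rfl | hn
  · simp only [Finset.Icc_eq_empty (by norm_num : ¬ (1:ℕ) ≤ 0), Finset.sum_empty, norm_zero]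
    positivity
  have hn1 : (1:ℝ) ≤ n := by exact_mod_cast hn
  have hn0 : (0:ℝ) < n := by linarith
  have e : ∑ k ∈ Finset.range (n + 1), familyCoeff χ k = ∑ k ∈ Finset.Icc 1 n, familyCoeff χ k := by
    rw [Finset.range_eq_Ico, Finset.sum_eq_sum_Ico_succ_bot (by omega), familyCoeff_zero, zero_add]
    rfl
  have h1 := hsum n hn
  rw [e] at h1
  rw [← ofReal_sum, Complex.norm_real, Real.norm_eq_abs]
  refine h1.trans ?_
  have hlog := Real.log_nonneg hn1
  have h2 : lll (Real.log n) ≤ Real.log n := by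
    have a1 : Real.log (1 + Real.log n) ≤ Real.log n := by
      have := Real.log_le_sub_one_of_pos (x := 1 + Real.log n) (by linarith)
      linarith
    have a2 : 0 ≤ Real.log (1 + Real.log n) := Real.log_nonneg (by linarith)
    have := Real.log_le_sub_one_of_pos (x := 1 + Real.log (1 + Real.log n)) (by linarith)
    unfold lll; linarith
  have h3 : Real.log n ≤ (n:ℝ) ^ (r - 1 / 2) / (r - 1 / 2) := Real.log_le_rpow_div hn0.le hε
  have h4 : (1:ℝ) ≤ (n:ℝ) ^ (r - 1 / 2) := Real.one_le_rpow hn1 hε.le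
  have h5 : C + B * lll (Real.log n) ≤ (C + B / (r - 1 / 2)) * (n:ℝ) ^ (r - 1 / 2) := by
    have := mul_le_mul_of_nonneg_left (h2.trans h3) hB
    have := mul_le_mul_of_nonneg_left h4 hC
    rw [add_mul, div_mul_eq_mul_div, ← mul_div_assoc] at *
    linarith
  calc √(n:ℝ) * (C + B * lll (Real.log n))
      ≤ √(n:ℝ) * ((C + B / (r - 1 / 2)) * (n:ℝ) ^ (r - 1 / 2)) := by gcongr
    _ = (C + B / (r - 1 / 2)) * ((n:ℝ) ^ (1 / 2 : ℝ) * (n:ℝ) ^ (r - 1 / 2)) := by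
        rw [Real.sqrt_eq_rpow]; ring
    _ = _ := by rw [← Real.rpow_add hn0]; congr 2; ring

variable [∀ j, NeZero (N j)]

lemma prod_LFunction_ne_zero (hχ : ∀ j, χ j ≠ 1)
    (hps : ∀ r : ℝ, 1 / 2 < r → ∃ K : ℝ, 0 ≤ K ∧
      ∀ n : ℕ, ‖∑ k ∈ Finset.Icc 1 n, (familyCoeff χ k : ℂ)‖ ≤ K * (n : ℝ) ^ r)
    {s : ℂ} (hs : 1 / 2 < s.re) :
    ∏ j, (LFunction (χ j) s * LFunction (χ j)⁻¹ s) ≠ 0 := by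
  set r := min ((1 / 2 + s.re) / 2) 1 with hr
  have hr1 : 1 / 2 < r := lt_min (by linarith) (by norm_num)
  have hrs : r < s.re := (min_le_left _ _).trans_lt (by linarith)
  have hrle : r ≤ 1 := min_le_right _ _
  obtain ⟨K, hK, hf⟩ := hps r hr1
  have hd : ∀ j, Differentiable ℂ fun s => LFunction (χ j) s * LFunction (χ j)⁻¹ s := fun j =>
    (differentiable_LFunction (hχ j)).mul (differentiable_LFunction (inv_ne_one.mpr (hχ j)))
  have hne : ∀ s : ℂ, 1 < s.re → ∀ j, LFunction (χ j) s * LFunction (χ j)⁻¹ s ≠ 0 :=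
    fun s hs j => mul_ne_zero (LFunction_ne_zero hs) (LFunction_ne_zero hs)
  refine ne_zero_of_deriv_eq_mul (Z := fun s => ∏ j, (LFunction (χ j) s * LFunction (χ j)⁻¹ s))
    (Φ := fun s => -abelInt (fun k => (familyCoeff χ k : ℂ)) s) (r := r) ?_ ?_ ?_ ?_ hrs
  · exact Differentiable.fun_finsetProd fun j _ => hd j
  · exact fun s hs => (differentiableAt_abelInt (by linarith) hK hf hs).neg
  · intro s hs
    have hZ0 : ∏ j, (LFunction (χ j) s * LFunction (χ j)⁻¹ s) ≠ 0 :=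
      Finset.prod_ne_zero_iff.mpr fun j _ => hne s hs j
    have h1 : logDeriv (fun s => ∏ j, (LFunction (χ j) s * LFunction (χ j)⁻¹ s)) s
        = -abelInt (fun k => (familyCoeff χ k : ℂ)) s := by
      rw [logDeriv_prod (fun j _ => hne s hs j) (fun j _ => hd j s),
        ← LSeries_eq_abelInt (by linarith) hf (by linarith) (LSeriesSummable_familyCoeff hs),
        LSeries_familyCoeff hs, ← Finset.sum_neg_distrib]
      refine Finset.sum_congr rfl fun j _ => ?_
      rw [LSeries_coeff hs, neg_neg]
      exact logDeriv_mul s (LFunction_ne_zero hs) (LFunction_ne_zero hs)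
        (differentiable_LFunction (hχ j) s) (differentiable_LFunction (inv_ne_one.mpr (hχ j)) s)
    simp only [← h1, logDeriv_apply]
    field_simp
  · exact fun s hs => Finset.prod_ne_zero_iff.mpr fun j _ => hne s hs j

/-- The product of `xi` over a family of characters. -/
noncomputable def familyXi (χ : ∀ j, DirichletCharacter ℂ (N j)) (z : ℂ) : ℂ := ∏ j, xi (χ j) z

/-- The constant in the functional equation of `familyXi`. -/
noncomputable def familyRoot (χ : ∀ j, DirichletCharacter ℂ (N j)) : ℂ :=
  ∏ j, (rootNumber (χ j) * rootNumber (χ j)⁻¹)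

lemma differentiable_familyXi (hχ : ∀ j, χ j ≠ 1) : Differentiable ℂ (familyXi χ) :=
  Differentiable.fun_finsetProd fun j _ => differentiable_xi (hχ j)

lemma familyXi_neg (hp : ∀ j, (χ j).IsPrimitive) (z : ℂ) :
    familyXi χ (-z) = familyRoot χ * familyXi χ z := by
  simp only [familyXi, familyRoot, ← Finset.prod_mul_distrib]
  exact Finset.prod_congr rfl fun j _ => xi_neg (hp j) z

lemma exists_norm_familyXi_le (hp : ∀ j, (χ j).IsPrimitive) (hχ : ∀ j, χ j ≠ 1) :
    ∃ C : ℝ, 0 ≤ C ∧ ∀ z, ‖familyXi χ z‖ ≤ Real.exp (C * (1 + ‖z‖) ^ (3 / 2 : ℝ)) := by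
  obtain ⟨C, hC, h⟩ := GrowthBound.prod Finset.univ fun j => growthBound_xi (hχ j)
  refine ⟨C + ‖familyRoot χ‖, by positivity, fun z => ?_⟩
  have hz1 : 1 ≤ (1 + ‖z‖) ^ (3 / 2 : ℝ) :=
    Real.one_le_rpow (by linarith [norm_nonneg z]) (by norm_num)
  rw [add_mul, Real.exp_add]
  rcases le_total 0 z.re with hz | hz
  · refine (h z hz).trans (le_mul_of_one_le_right (Real.exp_pos _).le (Real.one_le_exp ?_))
    positivity
  · have h1 := h (-z) (by simpa using hz)
    rw [norm_neg] at h1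
    have h2 := familyXi_neg hp (-z)
    rw [neg_neg] at h2
    rw [h2, norm_mul, mul_comm]
    have h3 : ‖familyRoot χ‖ ≤ Real.exp (‖familyRoot χ‖ * (1 + ‖z‖) ^ (3 / 2 : ℝ)) := by
      have := Real.add_one_le_exp (‖familyRoot χ‖ * (1 + ‖z‖) ^ (3 / 2 : ℝ))
      have := mul_le_mul_of_nonneg_left hz1 (norm_nonneg (familyRoot χ))
      linarith
    exact mul_le_mul h1 h3 (norm_nonneg _) (Real.exp_pos _).le

lemma re_eq_zero_of_familyXi_eq_zero (hp : ∀ j, (χ j).IsPrimitive) (hχ : ∀ j, χ j ≠ 1)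
    (hne : ∀ s : ℂ, 1 / 2 < s.re → ∏ j, (LFunction (χ j) s * LFunction (χ j)⁻¹ s) ≠ 0)
    {z : ℂ} (hz : familyXi χ z = 0) : z.re = 0 := by
  have key : ∀ z : ℂ, 0 < z.re → familyXi χ z ≠ 0 := by
    intro z hz
    refine Finset.prod_ne_zero_iff.mpr fun j hj => ?_
    rw [xi_eq (hχ j) hz.le]
    have h1 := Finset.prod_ne_zero_iff.mp (hne (1 / 2 + z) (by simp [hz])) j hj
    have h2 : Gammaℝ (z + gammaShift (χ j)) ≠ 0 :=
      Gammaℝ_ne_zero_of_re_pos (by rw [add_re, ofReal_re]; linarith [gammaShift_pos (χ j)])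
    exact mul_ne_zero (mul_ne_zero (by simp [NeZero.ne (N j)]) (pow_ne_zero _ h2)) h1
  rcases lt_trichotomy z.re 0 with h | h | h
  · refine absurd ?_ (key (-z) (by simpa using h))
    rw [familyXi_neg hp, hz, mul_zero]
  · exact h
  · exact absurd hz (key z h)

lemma re_logDeriv_familyXi (hχ : ∀ j, χ j ≠ 1) {x : ℝ} (hx : 1 / 2 < x) :
    (logDeriv (familyXi χ) x).re = ∑ j, (Real.log (N j) - Real.log π)
      + ∑ j, realDigamma ((x + gammaShift (χ j)) / 2)
      - ∑' n : ℕ, familyCoeff χ n * (n : ℝ) ^ (-(1 / 2) - x) := by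
  have hs : 1 < (1 / 2 + (x:ℂ)).re := by simp; linarith
  have h : logDeriv (familyXi χ) x = ∑ j, logDeriv (xi (χ j)) x :=
    logDeriv_prod (fun j _ => (logDeriv_xi (hχ j) hx).1) fun j _ => differentiable_xi (hχ j) _
  rw [h, Complex.re_sum, ← re_LSeries_ofReal (familyCoeff_zero χ) (LSeriesSummable_familyCoeff hs),
    LSeries_familyCoeff hs, Complex.re_sum, ← Finset.sum_add_distrib, ← Finset.sum_sub_distrib]
  refine Finset.sum_congr rfl fun j _ => ?_
  rw [(logDeriv_xi (hχ j) hx).2, sub_re, add_re, ofReal_re, show ∀ w : ℂ, (2 * w).re = 2 * w.re by simp,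
    re_logDeriv_Gammaℝ (by linarith [gammaShift_pos (χ j)])]
  ring

lemma exists_formulaData (hp : ∀ j, (χ j).IsPrimitive) (hχ : ∀ j, χ j ≠ 1)
    (hne : ∀ s : ℂ, 1 / 2 < s.re → ∏ j, (LFunction (χ j) s * LFunction (χ j)⁻¹ s) ≠ 0) :
    ∃ E : FormulaData, (∀ i, 1 ≤ E.m i) ∧ E.c = familyCoeff χ ∧
      Fintype.card E.κ = 2 * Fintype.card J := by
  obtain ⟨C, hC, hgrowth⟩ := exists_norm_familyXi_le hp hχ
  have hd := differentiable_familyXi hχ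
  have hzero : ∀ z, familyXi χ z = 0 → z.re = 0 := fun z =>
    re_eq_zero_of_familyXi_eq_zero hp hχ hne
  have hsum : ∀ {x : ℝ}, 0 < x → _ := fun {x} hx =>
    hasSum_logDeriv_of_entire hd (familyXi_neg hp) hzero hC hgrowth hx
  have h1 : familyXi χ 1 ≠ 0 := fun h => by simpa using hzero 1 h
  have hm : ∀ ρ : {ρ : ℂ // familyXi χ ρ = 0}, 1 ≤ analyticOrderNatAt (familyXi χ) ρ := by
    rintro ⟨ρ, hρ⟩
    have h2 := analyticOrderAt_ne_top_of_entire hd h1 ρ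
    have h3 : analyticOrderAt (familyXi χ) ρ ≠ 0 := by
      rw [Ne, (hd.analyticAt ρ).analyticOrderAt_eq_zero]; simpa using hρ
    rw [← Nat.cast_analyticOrderNatAt h2] at h3
    exact Nat.one_le_iff_ne_zero.mpr (by exact_mod_cast h3)
  have hm' : ∀ ρ : {ρ : ℂ // familyXi χ ρ = 0}, (1:ℝ) ≤ analyticOrderNatAt (familyXi χ) ρ :=
    fun ρ => by exact_mod_cast hm ρ
  have hcount : Countable {ρ : ℂ // familyXi χ ρ = 0} := by
    have := (hsum one_pos).summable.countable_support
    refine Set.countable_univ_iff.mp (this.mono fun ρ _ => ?_)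
    have h0 := hm' ρ
    rw [Function.mem_support]
    positivity
  refine ⟨{ ι := {ρ : ℂ // familyXi χ ρ = 0}, hι := hcount, γ := fun ρ => (ρ : ℂ).im,
            m := fun ρ => analyticOrderNatAt (familyXi χ) ρ, hm := fun ρ => by positivity,
            κ := J ⊕ J, hκ := inferInstance,
            β := fun j => gammaShift (χ (j.elim id id)), hβ := fun j => gammaShift_eq_or _,
            C₀ := ∑ j, (Real.log (N j) - Real.log π), c := familyCoeff χ,
            hc₀ := familyCoeff_zero χ, hc := fun x hx => ?_, formula := fun x hx => ?_ },
    hm', rfl, ?_⟩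
  · exact summable_of_LSeriesSummable (familyCoeff_zero χ)
      (LSeriesSummable_familyCoeff (by simp; linarith))
  · have := hsum (x := x) (by linarith)
    rw [re_logDeriv_familyXi hχ hx] at this
    convert this using 3
    rw [Fintype.sum_sum_type, ← Finset.sum_add_distrib]
    refine Finset.sum_congr rfl fun j _ => ?_
    simp only [Sum.elim_inl, Sum.elim_inr, id]
    ring
  · rw [Fintype.card_sum]; ring

/-- Small partial sums of the coefficients force the family to be small. -/
theorem card_le_of_familyCoeff_partial_sums (hp : ∀ j, (χ j).IsPrimitive) (hχ : ∀ j, χ j ≠ 1)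
    {C B : ℝ} (hC : 0 ≤ C) (hB : 0 ≤ B) (hsum : ∀ n : ℕ, 1 ≤ n →
      |∑ k ∈ Finset.range (n + 1), familyCoeff χ k| ≤ √(n : ℝ) * (C + B * lll (Real.log n))) :
    2 * (Fintype.card J : ℝ) ≤ 100 * B := by
  obtain ⟨E, hm, hc, hcard⟩ := exists_formulaData hp hχ fun s hs =>
    prod_LFunction_ne_zero hχ (fun r hr => exists_partialSum_le hC hB hsum hr) hs
  have := E.card_le_of_partial_sums hm hC hB (by rw [hc]; exact hsum)
  rw [hcard] at this
  exact_mod_cast this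

end Family

end FixedQ

namespace FixedQ
open DirichletCharacter

/-- The contribution of primes to the von Mangoldt function. -/
noncomputable def primeLog (k : ℕ) : ℝ := if k.Prime then Real.log k else 0

lemma primeLog_le_vonMangoldt (k : ℕ) : primeLog k ≤ ArithmeticFunction.vonMangoldt k := by
  unfold primeLog; split_ifs with h
  · rw [ArithmeticFunction.vonMangoldt_apply_prime h]
  · exact ArithmeticFunction.vonMangoldt_nonneg

lemma exists_sum_sub_primeLog_le : ∃ D : ℝ, 0 ≤ D ∧ ∀ n : ℕ,
    ∑ k ∈ Finset.range (n + 1), (ArithmeticFunction.vonMangoldt k - primeLog k) ≤ D * √(n : ℝ) := by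
  obtain ⟨D, hD⟩ := Chebyshev.psi_sub_theta_le_mul_sqrt
  refine ⟨max D 0, le_max_right _ _, fun n => ?_⟩
  have h := hD n
  rw [Chebyshev.psi_eq_sum_Icc, Chebyshev.theta_eq_sum_Icc, Nat.floor_natCast,
    Finset.sum_filter] at h
  rw [Finset.sum_sub_distrib, Finset.range_eq_Ico]
  exact h.trans (mul_le_mul_of_nonneg_right (le_max_left _ _) (Real.sqrt_nonneg _))

variable {q : ℕ}

/-- The weight detecting the class of `1` among reduced residue classes. -/
noncomputable def classWeight (q k : ℕ) : ℝ :=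
  (if k % q = 1 then (q.totient : ℝ) else 0) - (if k.Coprime q then 1 else 0)

lemma coprime_of_mod_eq_one {k : ℕ} (h : k % q = 1) : k.Coprime q := by
  rw [Nat.coprime_comm, Nat.Coprime, Nat.gcd_rec, h, Nat.gcd_one_left]

lemma classWeight_of_not_coprime {k : ℕ} (h : ¬ k.Coprime q) : classWeight q k = 0 := by
  rw [classWeight, if_neg (mt coprime_of_mod_eq_one h), if_neg h, sub_zero]

lemma abs_classWeight_le [NeZero q] (k : ℕ) : |classWeight q k| ≤ q.totient := by
  have : (1:ℝ) ≤ q.totient := by exact_mod_cast Nat.totient_pos.mpr (NeZero.pos q)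
  unfold classWeight
  rw [abs_le]
  split_ifs <;> constructor <;> linarith

/-- The primitive characters inducing the nonprincipal characters modulo `q`. -/
noncomputable def primitiveFamily (q : ℕ) (χ : {χ : DirichletCharacter ℂ q // χ ≠ 1}) :
    DirichletCharacter ℂ χ.1.conductor := χ.1.primitiveCharacter

lemma primitiveFamily_ne_one (χ : {χ : DirichletCharacter ℂ q // χ ≠ 1}) :
    primitiveFamily q χ ≠ 1 := by
  intro h
  refine χ.2 ?_
  rw [← χ.1.changeLevel_primitiveCharacter]
  rw [primitiveFamily] at h
  rw [h, changeLevel_one]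

lemma primitiveFamily_apply {k : ℕ} (hk : k.Coprime q)
    (χ : {χ : DirichletCharacter ℂ q // χ ≠ 1}) : primitiveFamily q χ k = χ.1 k := by
  have := χ.1.primitiveCharacter_apply_of_isCoprime (a := (k : ℤ)) (Nat.isCoprime_iff_coprime.mpr hk)
  simpa [primitiveFamily] using this

lemma one_mem_reduced (hq : 3 ≤ q) :
    1 ∈ (Finset.range q).filter (fun a => Nat.Coprime a q) := by
  rw [Finset.mem_filter, Finset.mem_range]
  exact ⟨by omega, Nat.coprime_one_left q⟩

variable [NeZero q]

lemma card_nonprincipal : (Fintype.card {χ : DirichletCharacter ℂ q // χ ≠ 1} : ℝ)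
    = q.totient - 1 := by
  have h1 : Fintype.card (DirichletCharacter ℂ q) = q.totient := by
    rw [← Nat.card_eq_fintype_card]; exact card_eq_totient_of_hasEnoughRootsOfUnity ℂ q
  have h2 : Fintype.card {χ : DirichletCharacter ℂ q // χ ≠ 1} = q.totient - 1 := by
    rw [Fintype.card_subtype_compl, h1, Fintype.card_subtype_eq]
  rw [h2, Nat.cast_sub (Nat.totient_pos.mpr (NeZero.pos q)), Nat.cast_one]

lemma familyCoeff_of_coprime {k : ℕ} (hk : k.Coprime q) (hq : q ≠ 1) :
    familyCoeff (primitiveFamily q) k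
      = 2 * (ArithmeticFunction.vonMangoldt k * classWeight q k) := by
  have h1 : ∑ χ : {χ : DirichletCharacter ℂ q // χ ≠ 1}, χ.1 (k : ZMod q)
      = (if (k : ZMod q) = 1 then (q.totient : ℂ) else 0) - 1 := by
    rw [← sum_characters_eq ℂ (k : ZMod q), eq_sub_iff_add_eq,
      ← Fintype.sum_subtype_add_sum_subtype (fun χ : DirichletCharacter ℂ q => χ ≠ 1)
        (fun χ => χ (k : ZMod q))]
    congr 1
    have hu : IsUnit (k : ZMod q) := (ZMod.isUnit_iff_coprime k q).mpr hk
    have : ∀ χ : {χ : DirichletCharacter ℂ q // ¬ χ ≠ 1}, χ.1 (k : ZMod q) = 1 := by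
      rintro ⟨χ, hχ⟩
      obtain rfl := not_not.mp hχ
      exact MulChar.one_apply hu
    rw [Finset.sum_congr rfl fun χ _ => this χ]
    simp
  have h2 : (k : ZMod q) = 1 ↔ k % q = 1 := by
    have : (k : ZMod q) = ((1 : ℕ) : ZMod q) ↔ k ≡ 1 [MOD q] := ZMod.natCast_eq_natCast_iff _ _ _
    rw [Nat.cast_one] at this
    rw [this, Nat.ModEq, Nat.mod_eq_of_lt (a := 1)]
    have := NeZero.pos q
    omega
  have h3 := congrArg Complex.re h1
  rw [Complex.re_sum] at h3
  simp only [familyCoeff, coeff, primitiveFamily_apply hk]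
  rw [← Finset.mul_sum, ← Finset.mul_sum, h3, classWeight, if_pos hk]
  simp only [h2]
  split_ifs <;> simp <;> ring

lemma abs_familyCoeff_le (k : ℕ) :
    |familyCoeff (primitiveFamily q) k| ≤ 2 * q.totient * ArithmeticFunction.vonMangoldt k := by
  have hΛ : 0 ≤ ArithmeticFunction.vonMangoldt k := ArithmeticFunction.vonMangoldt_nonneg
  unfold familyCoeff
  refine (Finset.abs_sum_le_sum_abs _ _).trans ?_
  have : ∀ χ ∈ (Finset.univ : Finset {χ : DirichletCharacter ℂ q // χ ≠ 1}),
      |coeff (primitiveFamily q χ) k| ≤ 2 * ArithmeticFunction.vonMangoldt k := by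
    intro χ _
    rw [coeff, abs_mul, abs_mul, abs_of_nonneg hΛ, abs_two]
    have := (Complex.abs_re_le_norm _).trans ((primitiveFamily q χ).norm_le_one k)
    nlinarith
  refine (Finset.sum_le_card_nsmul _ _ _ this).trans ?_
  rw [Finset.card_univ, nsmul_eq_mul, card_nonprincipal]
  nlinarith

lemma abs_familyCoeff_sub_le (hq : q ≠ 1) (k : ℕ) :
    |familyCoeff (primitiveFamily q) k - 2 * (ArithmeticFunction.vonMangoldt k * classWeight q k)|
      ≤ 2 * q.totient * ((ArithmeticFunction.vonMangoldt k - primeLog k)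
        + if k ≤ q then ArithmeticFunction.vonMangoldt k else 0) := by
  have hΛ : 0 ≤ ArithmeticFunction.vonMangoldt k := ArithmeticFunction.vonMangoldt_nonneg
  have hp := primeLog_le_vonMangoldt k
  have hif : 0 ≤ if k ≤ q then ArithmeticFunction.vonMangoldt k else 0 := by
    split_ifs
    exacts [hΛ, le_rfl]
  by_cases hk : k.Coprime q
  · rw [familyCoeff_of_coprime hk hq, sub_self, abs_zero]
    have : 0 ≤ ArithmeticFunction.vonMangoldt k - primeLog k := by linarith
    positivity
  · rw [classWeight_of_not_coprime hk, mul_zero, mul_zero, sub_zero]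
    refine (abs_familyCoeff_le k).trans (mul_le_mul_of_nonneg_left ?_ (by positivity))
    by_cases hkp : k.Prime
    · have : k ≤ q := Nat.le_of_dvd (NeZero.pos q)
        (by_contra fun h => hk ((Nat.Prime.coprime_iff_not_dvd hkp).mpr h))
      rw [if_pos this]; linarith
    · have : primeLog k = 0 := by rw [primeLog, if_neg hkp]
      linarith

lemma exists_abs_sum_familyCoeff_le (hq : q ≠ 1) : ∃ D : ℝ, 0 ≤ D ∧ ∀ n : ℕ, 1 ≤ n →
    |∑ k ∈ Finset.range (n + 1), familyCoeff (primitiveFamily q) k|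
      ≤ 2 * |∑ k ∈ Finset.range (n + 1), ArithmeticFunction.vonMangoldt k * classWeight q k|
        + D * √(n : ℝ) := by
  obtain ⟨D, hD, h⟩ := exists_sum_sub_primeLog_le
  set M := ∑ k ∈ Finset.range (q + 1), ArithmeticFunction.vonMangoldt k with hM
  have hM0 : 0 ≤ M := Finset.sum_nonneg fun _ _ => ArithmeticFunction.vonMangoldt_nonneg
  refine ⟨2 * q.totient * (D + M), by positivity, fun n hn => ?_⟩
  have hsq : 1 ≤ √(n : ℝ) := Real.one_le_sqrt.mpr (by exact_mod_cast hn)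
  have h1 : |∑ k ∈ Finset.range (n + 1), familyCoeff (primitiveFamily q) k
      - 2 * ∑ k ∈ Finset.range (n + 1), ArithmeticFunction.vonMangoldt k * classWeight q k|
      ≤ 2 * q.totient * (D + M) * √(n : ℝ) := by
    rw [Finset.mul_sum, ← Finset.sum_sub_distrib]
    refine (Finset.abs_sum_le_sum_abs _ _).trans
      ((Finset.sum_le_sum fun k _ => abs_familyCoeff_sub_le hq k).trans ?_)
    rw [← Finset.mul_sum, Finset.sum_add_distrib, mul_assoc _ (D + M)]
    refine mul_le_mul_of_nonneg_left ?_ (by positivity)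
    have h2 : ∑ k ∈ Finset.range (n + 1), (if k ≤ q then ArithmeticFunction.vonMangoldt k else 0)
        ≤ M := by
      rw [← Finset.sum_filter]
      refine Finset.sum_le_sum_of_subset_of_nonneg (fun k hk => ?_)
        fun _ _ _ => ArithmeticFunction.vonMangoldt_nonneg
      rw [Finset.mem_filter] at hk
      rw [Finset.mem_range]; omega
    have := h n
    nlinarith
  have h2 := abs_sub_abs_le_abs_sub (∑ k ∈ Finset.range (n + 1), familyCoeff (primitiveFamily q) k)
    (2 * ∑ k ∈ Finset.range (n + 1), ArithmeticFunction.vonMangoldt k * classWeight q k)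
  rw [abs_mul, abs_two] at h2
  linarith

lemma abs_sum_vonMangoldt_classWeight_le_Vvar (hq : 3 ≤ q) (n : ℕ) :
    |∑ k ∈ Finset.range (n + 1), ArithmeticFunction.vonMangoldt k * classWeight q k|
      ≤ q.totient * √(Vvar n q) := by
  have hφ : (0:ℝ) < q.totient := by exact_mod_cast Nat.totient_pos.mpr (NeZero.pos q)
  have h1 := Finset.single_le_sum (f := fun a =>
    ((∑ k ∈ (Finset.range (Nat.floor (n:ℝ) + 1)).filter (fun k => k % q = a),
        ArithmeticFunction.vonMangoldt k)
      - (1 / (Nat.totient q : ℝ)) *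
        ∑ k ∈ (Finset.range (Nat.floor (n:ℝ) + 1)).filter (fun k => Nat.Coprime k q),
          ArithmeticFunction.vonMangoldt k) ^ 2) (fun _ _ => sq_nonneg _) (one_mem_reduced hq)
  have h2 := Real.abs_le_sqrt h1
  rw [Nat.floor_natCast] at h2
  have h3 : ∑ k ∈ Finset.range (n + 1), ArithmeticFunction.vonMangoldt k * classWeight q k
      = q.totient * ((∑ k ∈ (Finset.range (n + 1)).filter (fun k => k % q = 1),
        ArithmeticFunction.vonMangoldt k)
      - (1 / (Nat.totient q : ℝ)) *
        ∑ k ∈ (Finset.range (n + 1)).filter (fun k => Nat.Coprime k q),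
          ArithmeticFunction.vonMangoldt k) := by
    rw [mul_sub, ← mul_assoc, mul_one_div_cancel hφ.ne', one_mul, Finset.sum_filter,
      Finset.sum_filter, Finset.mul_sum, ← Finset.sum_sub_distrib]
    refine Finset.sum_congr rfl fun k _ => ?_
    unfold classWeight
    split_ifs <;> ring
  rw [h3, abs_mul, abs_of_pos hφ]
  refine mul_le_mul_of_nonneg_left (h2.trans (le_of_eq ?_)) hφ.le
  rw [Vvar, Nat.floor_natCast]

lemma sum_primeLog_mul_classWeight (n : ℕ) :
    ∑ k ∈ Finset.range (n + 1), primeLog k * classWeight q k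
      = q.totient * thetaQA n q 1
        - ∑ a ∈ (Finset.range q).filter (fun a => Nat.Coprime a q), thetaQA n q a := by
  have h1 : ∀ a, thetaQA n q a
      = ∑ k ∈ Finset.range (n + 1), if k % q = a then primeLog k else 0 := by
    intro a
    rw [thetaQA, Nat.floor_natCast, Finset.sum_filter]
    refine Finset.sum_congr rfl fun k _ => ?_
    unfold primeLog
    split_ifs <;> simp_all
  simp only [h1]
  rw [Finset.sum_comm, Finset.mul_sum, ← Finset.sum_sub_distrib]
  refine Finset.sum_congr rfl fun k _ => ?_
  have h2 : ∑ a ∈ (Finset.range q).filter (fun a => Nat.Coprime a q),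
      (if k % q = a then primeLog k else 0) = if k.Coprime q then primeLog k else 0 := by
    rw [Finset.sum_ite_eq]
    have : k % q ∈ (Finset.range q).filter (fun a => Nat.Coprime a q) ↔ k.Coprime q := by
      rw [Finset.mem_filter, Finset.mem_range]
      have h3 : (k % q).Coprime q ↔ k.Coprime q := by
        rw [Nat.Coprime, Nat.Coprime, ← Nat.gcd_rec, Nat.gcd_comm]
      rw [h3]
      exact and_iff_right (Nat.mod_lt _ (NeZero.pos q))
    simp only [this]
  rw [h2, classWeight]
  split_ifs <;> ring

lemma abs_sum_primeLog_classWeight_le_Gvar (hq : 3 ≤ q) (n : ℕ) :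
    |∑ k ∈ Finset.range (n + 1), primeLog k * classWeight q k|
      ≤ 2 * q.totient * √(Gvar n q) := by
  have hφ : (0:ℝ) < q.totient := by exact_mod_cast Nat.totient_pos.mpr (NeZero.pos q)
  set R := (Finset.range q).filter (fun a => Nat.Coprime a q) with hR
  have hd : ∀ a ∈ R, |thetaQA n q a - n / q.totient| ≤ √(Gvar n q) := fun a ha =>
    Real.abs_le_sqrt (Finset.single_le_sum
      (f := fun a => (thetaQA n q a - n / q.totient) ^ 2) (fun _ _ => sq_nonneg _) ha)
  have hcard : (R.card : ℝ) = q.totient := by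
    rw [Nat.totient_eq_card_coprime]
    congr 2
    exact Finset.filter_congr fun a _ => Nat.coprime_comm
  have h1 : ∑ k ∈ Finset.range (n + 1), primeLog k * classWeight q k
      = q.totient * (thetaQA n q 1 - n / q.totient)
        - ∑ a ∈ R, (thetaQA n q a - n / q.totient) := by
    rw [sum_primeLog_mul_classWeight, Finset.sum_sub_distrib, Finset.sum_const, nsmul_eq_mul, hcard]
    ring
  have h2 : |∑ a ∈ R, (thetaQA n q a - n / q.totient)| ≤ q.totient * √(Gvar n q) := by
    refine (Finset.abs_sum_le_sum_abs _ _).trans ((Finset.sum_le_card_nsmul _ _ _ hd).trans ?_)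
    rw [nsmul_eq_mul, hcard]
  have h3 := mul_le_mul_of_nonneg_left (hd 1 (one_mem_reduced hq)) hφ.le
  rw [h1]
  refine (abs_sub _ _).trans ?_
  rw [abs_mul, abs_of_pos hφ]
  linarith

lemma exists_abs_sum_vonMangoldt_classWeight_le_Gvar (hq : 3 ≤ q) : ∃ D : ℝ, 0 ≤ D ∧ ∀ n : ℕ,
    |∑ k ∈ Finset.range (n + 1), ArithmeticFunction.vonMangoldt k * classWeight q k|
      ≤ 2 * q.totient * √(Gvar n q) + D * √(n : ℝ) := by
  obtain ⟨D, hD, h⟩ := exists_sum_sub_primeLog_le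
  refine ⟨q.totient * D, by positivity, fun n => ?_⟩
  have h1 := abs_sum_primeLog_classWeight_le_Gvar hq n
  have h2 : |∑ k ∈ Finset.range (n + 1),
      (ArithmeticFunction.vonMangoldt k - primeLog k) * classWeight q k|
      ≤ q.totient * D * √(n : ℝ) := by
    refine (Finset.abs_sum_le_sum_abs _ _).trans ?_
    rw [mul_assoc]
    refine le_trans ?_ (mul_le_mul_of_nonneg_left (h n) (by positivity))
    rw [Finset.mul_sum]
    refine Finset.sum_le_sum fun k _ => ?_
    have h3 := primeLog_le_vonMangoldt k
    rw [abs_mul, abs_of_nonneg (by linarith), mul_comm]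
    exact mul_le_mul_of_nonneg_right (abs_classWeight_le k) (by linarith)
  have h3 : ∑ k ∈ Finset.range (n + 1), ArithmeticFunction.vonMangoldt k * classWeight q k
      = ∑ k ∈ Finset.range (n + 1), primeLog k * classWeight q k
        + ∑ k ∈ Finset.range (n + 1),
          (ArithmeticFunction.vonMangoldt k - primeLog k) * classWeight q k := by
    rw [← Finset.sum_add_distrib]
    exact Finset.sum_congr rfl fun k _ => by ring
  rw [h3]
  exact (abs_add_le _ _).trans (add_le_add h1 h2)

lemma log_log_log_bounds {x : ℝ} (hx : Real.exp (Real.exp 1) ≤ x) :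
    0 ≤ Real.log (Real.log (Real.log x)) ∧
      Real.log (Real.log (Real.log x)) ≤ lll (Real.log x) := by
  have h1 : Real.exp 1 ≤ Real.log x :=
    (Real.le_log_iff_exp_le (lt_of_lt_of_le (Real.exp_pos _) hx)).mpr hx
  have h0 : 0 < Real.log x := (Real.exp_pos 1).trans_le h1
  have h2 : 1 ≤ Real.log (Real.log x) := (Real.le_log_iff_exp_le h0).mpr h1
  refine ⟨Real.log_nonneg h2, Real.log_le_log (by linarith) ?_⟩
  have : Real.log (Real.log x) ≤ Real.log (1 + Real.log x) := Real.log_le_log h0 (by linarith)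
  linarith

lemma exists_large_of_abs_sum_le (hq : 3 ≤ q) {W : ℕ → ℝ} {D : ℝ} (hD : 0 ≤ D)
    (hW : ∀ n : ℕ, 1 ≤ n → |∑ k ∈ Finset.range (n + 1), familyCoeff (primitiveFamily q) k|
      ≤ 4 * q.totient * √(W n) + D * √(n : ℝ)) (X : ℕ) :
    ∃ n : ℕ, X ≤ n ∧
      1 / 1000000 * ((n : ℝ) * Real.log (Real.log (Real.log (n : ℝ))) ^ 2) ≤ W n := by
  by_contra! hlt
  have hφ : (2:ℝ) ≤ q.totient := by
    have h1 := Nat.totient_even (n := q) (by omega)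
    have h2 := Nat.totient_pos.mpr (NeZero.pos q)
    obtain ⟨m, hm⟩ := h1
    have : 2 ≤ q.totient := by omega
    exact_mod_cast this
  set X₀ := max X ⌈Real.exp (Real.exp 1)⌉₊ with hX₀
  set M := ∑ n ∈ Finset.range X₀,
    |∑ k ∈ Finset.range (n + 1), familyCoeff (primitiveFamily q) k| with hM
  have hM0 : 0 ≤ M := Finset.sum_nonneg fun _ _ => abs_nonneg _
  have key : ∀ n : ℕ, 1 ≤ n → |∑ k ∈ Finset.range (n + 1), familyCoeff (primitiveFamily q) k|
      ≤ √(n : ℝ) * ((M + D) + (4 * q.totient / 1000) * lll (Real.log n)) := by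
    intro n hn
    have hsq : 1 ≤ √(n : ℝ) := Real.one_le_sqrt.mpr (by exact_mod_cast hn)
    have hl : 0 ≤ lll (Real.log n) := lll_nonneg (Real.log_natCast_nonneg n)
    rcases lt_or_ge n X₀ with h | h
    · have h1 := Finset.single_le_sum (f := fun n : ℕ =>
        |∑ k ∈ Finset.range (n + 1), familyCoeff (primitiveFamily q) k|)
        (fun _ _ => abs_nonneg _) (Finset.mem_range.mpr h)
      refine h1.trans ?_
      have : 0 ≤ 4 * (q.totient : ℝ) / 1000 * lll (Real.log n) := by positivity
      change M ≤ _
      nlinarith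
    · have hx : Real.exp (Real.exp 1) ≤ n :=
        (Nat.le_ceil _).trans (by exact_mod_cast (le_max_right _ _).trans h)
      obtain ⟨h1, h2⟩ := log_log_log_bounds hx
      have h3 : √(W n) ≤ √(n : ℝ) * (1 / 1000 * lll (Real.log n)) := by
        refine Real.sqrt_le_iff.mpr ⟨by positivity, (hlt n ((le_max_left _ _).trans h)).le.trans ?_⟩
        rw [mul_pow, Real.sq_sqrt (by positivity)]
        have : Real.log (Real.log (Real.log (n:ℝ))) ^ 2 ≤ lll (Real.log n) ^ 2 :=
          pow_le_pow_left₀ h1 h2 2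
        have hn0 : (0:ℝ) ≤ n := by positivity
        nlinarith [mul_le_mul_of_nonneg_left this hn0]
      refine (hW n hn).trans ?_
      have h4 := mul_le_mul_of_nonneg_left h3 (by positivity : (0:ℝ) ≤ 4 * q.totient)
      nlinarith
  have hNZ : ∀ χ : {χ : DirichletCharacter ℂ q // χ ≠ 1}, NeZero χ.1.conductor := fun χ =>
    ⟨χ.1.conductor_ne_zero⟩
  have := card_le_of_familyCoeff_partial_sums (χ := primitiveFamily q)
    (fun χ => χ.1.primitiveCharacter_isPrimitive) primitiveFamily_ne_one
    (by positivity) (by positivity) key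
  rw [card_nonprincipal] at this
  linarith

lemma exists_seq_of_forall_exists {P : ℝ → Prop} (h : ∀ X : ℕ, ∃ n : ℕ, X ≤ n ∧ P n) :
    ∃ x : ℕ → ℝ, Tendsto x atTop atTop ∧ ∀ i, P (x i) := by
  choose f hf hP using h
  refine ⟨fun i => f i, ?_, hP⟩
  exact tendsto_natCast_atTop_atTop.comp (tendsto_atTop_mono hf tendsto_id)

end FixedQ

theorem fixed_q_oscillation_variance :
    ∃ c : ℝ, 0 < c ∧ ∀ (q : ℕ), 3 ≤ q →
      (∃ x : ℕ → ℝ, Tendsto x atTop atTop ∧ ∀ i,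
        c * (x i * Real.log (Real.log (Real.log (x i))) ^ 2) ≤ Gvar (x i) q) ∧
      (∃ x : ℕ → ℝ, Tendsto x atTop atTop ∧ ∀ i,
        c * (x i * Real.log (Real.log (Real.log (x i))) ^ 2) ≤ Vvar (x i) q) := by
  refine ⟨1 / 1000000, by norm_num, fun q hq => ?_⟩
  have : NeZero q := ⟨by omega⟩
  obtain ⟨D, hD, hsum⟩ := FixedQ.exists_abs_sum_familyCoeff_le (q := q) (by omega)
  obtain ⟨D', hD', hG⟩ := FixedQ.exists_abs_sum_vonMangoldt_classWeight_le_Gvar hq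
  constructor
  · refine FixedQ.exists_seq_of_forall_exists
      (P := fun x => 1 / 1000000 * (x * Real.log (Real.log (Real.log x)) ^ 2) ≤ Gvar x q)
      (FixedQ.exists_large_of_abs_sum_le hq (W := fun n => Gvar n q)
        (by positivity : 0 ≤ D + 2 * D') fun n hn => ?_)
    have h1 := hsum n hn
    have h2 := hG n
    linarith
  · refine FixedQ.exists_seq_of_forall_exists
      (P := fun x => 1 / 1000000 * (x * Real.log (Real.log (Real.log x)) ^ 2) ≤ Vvar x q)
      (FixedQ.exists_large_of_abs_sum_le hq (W := fun n => Vvar n q) hD fun n hn => ?_)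
    have h1 := hsum n hn
    have h2 := FixedQ.abs_sum_vonMangoldt_classWeight_le_Vvar hq n
    have h3 : 0 ≤ (q.totient : ℝ) * √(Vvar n q) := by positivity
    linarith
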